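/- There exists a nonzero polynomial function p on the 84-dimensional complex vector space ⋀³ℂ⁹ such that for every ω ∈ ⋀³ℂ⁹ with p(ω) ≠ 0, the set of 1-dimensional subspaces V₁ ⊆ ℂ⁹ for which there exists a flag of subspaces U₂ ⊆ U₅ ⊆ U₇ ⊆ ℂ⁹/V₁ with dim U₂ = 2, dim U₅ = 5, dim U₇ = 7 and ω/V₁ ∈ ⋀²U₂∧(ℂ⁹/V₁) + U₂∧U₅∧U₇ + ⋀³U₅, has exactly 81 elements. -/

import Mathlib

open ExteriorAlgebra

noncomputable section

variable {W : Type*} [AddCommGroup W] [Module ℂ W]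

/-- For subspaces `S, T, U` of a complex vector space `W`, the subspace `S∧T∧U` of `⋀³W`,
realized as the span, inside the exterior algebra, of all products `s∧t∧u` with
`s ∈ S`, `t ∈ T`, `u ∈ U`. In particular `wSpan S S ⊤ = ⋀²S∧W` and `wSpan S S S = ⋀³S`. -/
def wSpan (S T U : Submodule ℂ W) : Submodule ℂ (ExteriorAlgebra ℂ W) :=
  Submodule.span ℂ {x | ∃ s ∈ S, ∃ t ∈ T, ∃ u ∈ U, x = ι ℂ s * ι ℂ t * ι ℂ u}

/-- A function on a complex vector space is polynomial if it belongs to the subalgebra of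
functions generated by the linear forms. -/
def IsPolyFun (p : W → ℂ) : Prop :=
  p ∈ Algebra.adjoin ℂ (Set.range fun φ : Module.Dual ℂ W => (φ : W → ℂ))

/-- `V₉ = ℂ⁹`. -/
abbrev V9 : Type := Fin 9 → ℂ

namespace Trivector

open Equiv

/-- Square matrices of size nine. -/
abbrev Mat (R : Type*) := Matrix (Fin 9) (Fin 9) R

/-- Three-index tensors on a free module of rank nine. -/
abbrev Ten (R : Type*) := Fin 9 → Fin 9 → Fin 9 → R

section Basic

variable {R : Type*} [CommRing R]

/-- A matrix acting on the first index of a tensor. -/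
def slotA : Mat R →ₗ[R] Ten R →ₗ[R] Ten R :=
  LinearMap.mk₂ R (fun g x i j k => ∑ a, g i a * x a j k)
    (by intros; ext; simp [add_mul, Finset.sum_add_distrib])
    (by intros; ext; simp [mul_assoc, Finset.mul_sum])
    (by intros; ext; simp [mul_add, Finset.sum_add_distrib])
    (by intros; ext; simp [mul_left_comm, Finset.mul_sum])

/-- A matrix acting on the second index of a tensor. -/
def slotB : Mat R →ₗ[R] Ten R →ₗ[R] Ten R :=
  LinearMap.mk₂ R (fun g x i j k => ∑ a, g j a * x i a k)
    (by intros; ext; simp [add_mul, Finset.sum_add_distrib])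
    (by intros; ext; simp [mul_assoc, Finset.mul_sum])
    (by intros; ext; simp [mul_add, Finset.sum_add_distrib])
    (by intros; ext; simp [mul_left_comm, Finset.mul_sum])

/-- A matrix acting on the third index of a tensor. -/
def slotC : Mat R →ₗ[R] Ten R →ₗ[R] Ten R :=
  LinearMap.mk₂ R (fun g x i j k => ∑ a, g k a * x i j a)
    (by intros; ext; simp [add_mul, Finset.sum_add_distrib])
    (by intros; ext; simp [mul_assoc, Finset.mul_sum])
    (by intros; ext; simp [mul_add, Finset.sum_add_distrib])
    (by intros; ext; simp [mul_left_comm, Finset.mul_sum])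

theorem slotA_apply (g : Mat R) (x : Ten R) (i j k : Fin 9) :
    slotA g x i j k = ∑ a, g i a * x a j k := rfl

theorem slotB_apply (g : Mat R) (x : Ten R) (i j k : Fin 9) :
    slotB g x i j k = ∑ a, g j a * x i a k := rfl

theorem slotC_apply (g : Mat R) (x : Ten R) (i j k : Fin 9) :
    slotC g x i j k = ∑ a, g k a * x i j a := rfl

theorem slotA_mul (g h : Mat R) (x : Ten R) : slotA g (slotA h x) = slotA (g * h) x := by
  ext i j k
  simp only [slotA_apply, Matrix.mul_apply, Finset.mul_sum, Finset.sum_mul]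
  rw [Finset.sum_comm]
  simp [mul_assoc]

theorem slotB_mul (g h : Mat R) (x : Ten R) : slotB g (slotB h x) = slotB (g * h) x := by
  ext i j k
  simp only [slotB_apply, Matrix.mul_apply, Finset.mul_sum, Finset.sum_mul]
  rw [Finset.sum_comm]
  simp [mul_assoc]

theorem slotC_mul (g h : Mat R) (x : Ten R) : slotC g (slotC h x) = slotC (g * h) x := by
  ext i j k
  simp only [slotC_apply, Matrix.mul_apply, Finset.mul_sum, Finset.sum_mul]
  rw [Finset.sum_comm]
  simp [mul_assoc]

theorem slotA_one (x : Ten R) : slotA 1 x = x := by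
  ext i j k
  simp [slotA_apply, Matrix.one_apply]

theorem slotB_one (x : Ten R) : slotB 1 x = x := by
  ext i j k
  simp [slotB_apply, Matrix.one_apply]

theorem slotC_one (x : Ten R) : slotC 1 x = x := by
  ext i j k
  simp [slotC_apply, Matrix.one_apply]

theorem slotB_slotA (g h : Mat R) (x : Ten R) : slotB g (slotA h x) = slotA h (slotB g x) := by
  ext i j k
  simp only [slotA_apply, slotB_apply, Finset.mul_sum]
  rw [Finset.sum_comm]
  simp [mul_left_comm]

theorem slotC_slotA (g h : Mat R) (x : Ten R) : slotC g (slotA h x) = slotA h (slotC g x) := by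
  ext i j k
  simp only [slotA_apply, slotC_apply, Finset.mul_sum]
  rw [Finset.sum_comm]
  simp [mul_left_comm]

theorem slotC_slotB (g h : Mat R) (x : Ten R) : slotC g (slotB h x) = slotB h (slotC g x) := by
  ext i j k
  simp only [slotB_apply, slotC_apply, Finset.mul_sum]
  rw [Finset.sum_comm]
  simp [mul_left_comm]

/-- The action of a matrix on a tensor through all three indices. -/
def act (g : Mat R) : Ten R →ₗ[R] Ten R := slotA g ∘ₗ slotB g ∘ₗ slotC g

theorem act_eq (g : Mat R) (x : Ten R) : act g x = slotA g (slotB g (slotC g x)) := rfl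

theorem act_apply (g : Mat R) (x : Ten R) (i j k : Fin 9) :
    act g x i j k = ∑ a, g i a * ∑ b, g j b * ∑ c, g k c * x a b c := rfl

/-- The derivative of `act`, the Lie algebra action. -/
def der : Mat R →ₗ[R] Ten R →ₗ[R] Ten R := slotA + slotB + slotC

theorem der_eq (g : Mat R) (x : Ten R) : der g x = slotA g x + slotB g x + slotC g x := rfl

theorem act_mul (g h : Mat R) (x : Ten R) : act (g * h) x = act g (act h x) := by
  simp only [act_eq, ← slotA_mul, ← slotB_mul, ← slotC_mul, slotB_slotA, slotC_slotA, slotC_slotB]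

theorem act_one (x : Ten R) : act 1 x = x := by
  simp only [act_eq, slotA_one, slotB_one, slotC_one]

theorem der_act {X Y g : Mat R} (h : Y * g = g * X) (x : Ten R) :
    der Y (act g x) = act g (der X x) := by
  simp only [act_eq, der_eq, map_add]
  congr 1
  · congr 1
    · rw [slotA_mul, h, ← slotA_mul, slotC_slotA, slotB_slotA]
    · rw [slotB_slotA, slotB_mul, h, ← slotB_mul, slotC_slotB]
  · rw [slotC_slotA, slotC_slotB, slotC_mul, h, ← slotC_mul]

/-- The elementary tensor supported at one index triple. -/
def delta (a b c : Fin 9) : Ten R := fun i j k => if i = a ∧ j = b ∧ k = c then 1 else 0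

theorem ten_eq_sum (x : Ten R) : x = ∑ a, ∑ b, ∑ c, x a b c • (delta a b c : Ten R) := by
  ext i j k
  simp [Finset.sum_apply, delta, ite_and]

/-- Evaluation of a tensor at an index triple. -/
def coordAt (a b c : Fin 9) : Ten R →ₗ[R] R :=
  LinearMap.proj c ∘ₗ LinearMap.proj b ∘ₗ LinearMap.proj a

theorem coordAt_apply (a b c : Fin 9) (x : Ten R) : coordAt a b c x = x a b c := rfl

/-- The signed sum of products of three tensors over a set of permutations. -/
def psiSum (s : Finset (Perm (Fin 9))) : Ten R →ₗ[R] Ten R →ₗ[R] Ten R →ₗ[R] R :=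
  ∑ σ ∈ s, ((Perm.sign σ : ℤ) : R) •
    ((coordAt (σ 0) (σ 1) (σ 2)).smulRight
      ((coordAt (σ 3) (σ 4) (σ 5)).smulRight (coordAt (σ 6) (σ 7) (σ 8))))

theorem psiSum_apply (s : Finset (Perm (Fin 9))) (α β γ : Ten R) :
    psiSum s α β γ = ∑ σ ∈ s, ((Perm.sign σ : ℤ) : R) *
      (α (σ 0) (σ 1) (σ 2) * β (σ 3) (σ 4) (σ 5) * γ (σ 6) (σ 7) (σ 8)) := by
  simp only [psiSum, LinearMap.sum_apply, LinearMap.smul_apply, LinearMap.smulRight_apply,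
    coordAt_apply, smul_eq_mul, mul_assoc]

theorem exists_eq_psiSum_univ :
    ∃ f : Ten R →ₗ[R] Ten R →ₗ[R] Ten R →ₗ[R] R, f = psiSum Finset.univ := ⟨_, rfl⟩

/-- The trilinear form `α ∧ β ∧ γ`, valued in the top exterior power. The choice operator keeps
the kernel from unfolding the sum over all permutations. -/
def psi : Ten R →ₗ[R] Ten R →ₗ[R] Ten R →ₗ[R] R :=
  Classical.choose exists_eq_psiSum_univ

theorem psi_apply (α β γ : Ten R) : psi α β γ = ∑ σ : Perm (Fin 9), ((Perm.sign σ : ℤ) : R) *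
    (α (σ 0) (σ 1) (σ 2) * β (σ 3) (σ 4) (σ 5) * γ (σ 6) (σ 7) (σ 8)) := by
  rw [← psiSum_apply, psi, Classical.choose_spec exists_eq_psiSum_univ]

theorem psi_rankOne (g : Mat R) (t : Fin 9 → Fin 9) :
    psi (fun i j k => g i (t 0) * (g j (t 1) * g k (t 2)))
      (fun i j k => g i (t 3) * (g j (t 4) * g k (t 5)))
      (fun i j k => g i (t 6) * (g j (t 7) * g k (t 8))) = (g.submatrix id t).det := by
  rw [psi_apply, Matrix.det_apply']
  refine Finset.sum_congr rfl fun σ _ => ?_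
  rw [Fin.prod_univ_succ, Fin.prod_univ_eight]
  simp only [Matrix.submatrix_apply, id]
  exact congrArg _ (by simp only [mul_assoc]; rfl)

theorem act_delta (g : Mat R) (a b c : Fin 9) :
    act g (delta a b c) = fun i j k => g i a * (g j b * g k c) := by
  ext i j k
  simp [act_apply, delta, ite_and]

theorem delta_eq (a b c : Fin 9) : (delta a b c : Ten R) =
    fun i j k => (1 : Mat R) i a * ((1 : Mat R) j b * (1 : Mat R) k c) := by
  rw [← act_delta, act_one]

theorem psi_act (g : Mat R) (α β γ : Ten R) :
    psi (act g α) (act g β) (act g γ) = g.det * psi α β γ := by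
  have key : ∀ a b c d e f p q r : Fin 9,
      psi (act g (delta a b c)) (act g (delta d e f)) (act g (delta p q r)) =
        g.det * psi (delta a b c) (delta d e f) (delta p q r) := by
    intro a b c d e f p q r
    have h1 := psi_rankOne g ![a, b, c, d, e, f, p, q, r]
    have h2 := psi_rankOne (1 : Mat R) ![a, b, c, d, e, f, p, q, r]
    have h3 : g.submatrix id ![a, b, c, d, e, f, p, q, r] =
        g * (1 : Mat R).submatrix id ![a, b, c, d, e, f, p, q, r] := by
      ext i j
      simp [Matrix.mul_apply, Matrix.one_apply]
    rw [h3, Matrix.det_mul, ← h2] at h1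
    rw [act_delta, act_delta, act_delta, delta_eq a b c, delta_eq d e f, delta_eq p q r]
    exact h1
  have ext3 : ∀ {M : Type _} [AddCommGroup M] [Module R M] (F G : Ten R →ₗ[R] M),
      (∀ a b c, F (delta a b c) = G (delta a b c)) → ∀ x, F x = G x := by
    intro M _ _ F G h x
    rw [ten_eq_sum x]
    simp only [map_sum, map_smul, h]
  have h3 : ∀ a b c d e f, ∀ γ, psi (act g (delta a b c)) (act g (delta d e f)) (act g γ) =
      g.det * psi (delta a b c) (delta d e f) γ := fun a b c d e f =>
    ext3 (psi (act g (delta a b c)) (act g (delta d e f)) ∘ₗ act g)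
      (g.det • psi (delta a b c) (delta d e f)) (key a b c d e f)
  have h2 : ∀ a b c, ∀ β, psi (act g (delta a b c)) (act g β) (act g γ) =
      g.det * psi (delta a b c) β γ := fun a b c =>
    ext3 ((psi (act g (delta a b c)) ∘ₗ act g).flip (act g γ))
      (g.det • (psi (delta a b c)).flip γ) fun d e f => h3 a b c d e f γ
  exact ext3 (((psi ∘ₗ act g).flip (act g β)).flip (act g γ))
      (g.det • (psi.flip β).flip γ) (fun a b c => h2 a b c β) α

end Basic

section Operator

variable {R : Type*} [CommRing R]

/-- Alternating tensors, up to the vanishing on repeated indices, which follows when `2` is not a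
zero divisor. -/
structure IsAlt (x : Ten R) : Prop where
  swap12 : ∀ i j k, x j i k = -x i j k
  swap23 : ∀ i j k, x i k j = -x i j k

theorem IsAlt.act {x : Ten R} (hx : IsAlt x) (g : Mat R) : IsAlt (act g x) := by
  constructor
  · intro i j k
    simp only [act_apply, Finset.mul_sum, ← Finset.sum_neg_distrib]
    rw [Finset.sum_comm]
    refine Finset.sum_congr rfl fun a _ => Finset.sum_congr rfl fun b _ =>
      Finset.sum_congr rfl fun c _ => ?_
    rw [hx.swap12]
    ring
  · intro i j k
    simp only [act_apply, Finset.mul_sum, ← Finset.sum_neg_distrib]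
    refine Finset.sum_congr rfl fun a _ => ?_
    rw [Finset.sum_comm]
    refine Finset.sum_congr rfl fun b _ => Finset.sum_congr rfl fun c _ => ?_
    rw [hx.swap23]
    ring

theorem IsAlt.add {x y : Ten R} (hx : IsAlt x) (hy : IsAlt y) : IsAlt (x + y) :=
  ⟨fun i j k => by simp [hx.swap12 i j k, hy.swap12 i j k, add_comm],
    fun i j k => by simp [hx.swap23 i j k, hy.swap23 i j k, add_comm]⟩

theorem IsAlt.smul {x : Ten R} (hx : IsAlt x) (r : R) : IsAlt (r • x) :=
  ⟨fun i j k => by simp [hx.swap12 i j k], fun i j k => by simp [hx.swap23 i j k]⟩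

theorem IsAlt.der {x : Ten R} (hx : IsAlt x) (g : Mat R) : IsAlt (der g x) := by
  constructor
  · intro i j k
    simp only [der_eq, Pi.add_apply, slotA_apply, slotB_apply, slotC_apply]
    simp only [fun a => hx.swap12 a j k, fun a => hx.swap12 i a k, fun a => hx.swap12 i j a,
      mul_neg, Finset.sum_neg_distrib]
    ring
  · intro i j k
    simp only [der_eq, Pi.add_apply, slotA_apply, slotB_apply, slotC_apply]
    simp only [fun a => hx.swap23 a j k, fun a => hx.swap23 i a k, fun a => hx.swap23 i j a,
      mul_neg, Finset.sum_neg_distrib]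
    ring

theorem psi_eq_zero {α β γ : Ten R} (h : ∀ σ : Perm (Fin 9),
    α (σ 0) (σ 1) (σ 2) * β (σ 3) (σ 4) (σ 5) * γ (σ 6) (σ 7) (σ 8) = 0) : psi α β γ = 0 := by
  rw [psi_apply]
  exact Finset.sum_eq_zero fun σ _ => by rw [h σ, mul_zero]

theorem psi_swap (α β γ : Ten R) : psi β α γ = -psi α β γ := by
  let τ : Perm (Fin 9) := swap 0 3 * swap 1 4 * swap 2 5
  have hτ : Perm.sign τ = -1 := by decide
  rw [psi_apply, psi_apply, ← Equiv.sum_comp (Equiv.mulRight τ), ← Finset.sum_neg_distrib]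
  refine Finset.sum_congr rfl fun σ _ => ?_
  have h : ∀ i, (Equiv.mulRight τ σ) i = σ (τ i) := fun i => rfl
  rw [h, h, h, h, h, h, h, h, h]
  have hs : Perm.sign (Equiv.mulRight τ σ) = -Perm.sign σ := by
    simp [hτ]
  rw [hs, show τ 0 = 3 by decide, show τ 1 = 4 by decide, show τ 2 = 5 by decide,
    show τ 3 = 0 by decide, show τ 4 = 1 by decide, show τ 5 = 2 by decide,
    show τ 6 = 6 by decide, show τ 7 = 7 by decide, show τ 8 = 8 by decide]
  push_cast
  ring

/-- The moment-type operator on matrices attached to a tensor: `trace (tee x X * Y)` is the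
symplectic pairing of `X • x` and `Y • x`. -/
def tee (x : Ten R) : Mat R →ₗ[R] Mat R where
  toFun X := Matrix.of fun i j => psi x (der X x) (der (Matrix.single j i 1) x)
  map_add' X Y := by ext; simp
  map_smul' r X := by ext; simp

theorem tee_apply (x : Ten R) (X : Mat R) (i j : Fin 9) :
    tee x X i j = psi x (der X x) (der (Matrix.single j i 1) x) := rfl

theorem trace_tee_mul (x : Ten R) (X Y : Mat R) :
    Matrix.trace (tee x X * Y) = psi x (der X x) (der Y x) := by
  conv_rhs => rw [Matrix.matrix_eq_sum_single Y]
  have h : ∀ i j, der (Matrix.single i j (Y i j)) x =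
      Y i j • der (Matrix.single i j (1 : R)) x := fun i j => by
    rw [← LinearMap.smul_apply, ← map_smul, Matrix.smul_single, smul_eq_mul, mul_one]
  simp only [map_sum, LinearMap.sum_apply, h, map_smul, Matrix.trace, Matrix.diag,
    Matrix.mul_apply, tee_apply, smul_eq_mul]
  rw [Finset.sum_comm]
  simp only [mul_comm]

theorem tee_act {g h : Mat R} (gh : g * h = 1) (hg : h * g = 1) (x : Ten R) (X : Mat R) :
    tee (act g x) (g * X * h) = g.det • (g * tee x X * h) := by
  refine Matrix.ext_iff_trace_mul_right.2 fun Y => ?_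
  rw [trace_tee_mul]
  have e1 : der (g * X * h) (act g x) = act g (der X x) :=
    der_act (by rw [mul_assoc, hg, mul_one]) x
  have e2 : der Y (act g x) = act g (der (h * Y * g) x) :=
    der_act (by rw [← mul_assoc, ← mul_assoc, gh, one_mul]) x
  rw [e1, e2, psi_act, ← trace_tee_mul, Matrix.smul_mul, Matrix.trace_smul, smul_eq_mul]
  congr 1
  rw [← mul_assoc, ← mul_assoc, Matrix.trace_mul_comm]
  simp only [mul_assoc]

theorem der_one (x : Ten R) : der 1 x = (3 : R) • x := by
  simp only [der_eq, slotA_one, slotB_one, slotC_one]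
  module

end Operator

section Unstable

/-- The tensor `x` is supported on index triples of weight at least `p`. -/
def SuppGE (l : Fin 9 → ℤ) (p : ℤ) (x : Ten ℂ) : Prop :=
  ∀ a b c, l a + l b + l c < p → x a b c = 0

theorem SuppGE.add {l : Fin 9 → ℤ} {p : ℤ} {x y : Ten ℂ} (hx : SuppGE l p x)
    (hy : SuppGE l p y) : SuppGE l p (x + y) := fun a b c h => by
  simp [hx a b c h, hy a b c h]

theorem SuppGE.smul {l : Fin 9 → ℤ} {p : ℤ} {x : Ten ℂ} (r : ℂ) (hx : SuppGE l p x) :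
    SuppGE l p (r • x) := fun a b c h => by
  simp [hx a b c h]

theorem SuppGE.mono {l : Fin 9 → ℤ} {p q : ℤ} {x : Ten ℂ} (hx : SuppGE l p x) (h : q ≤ p) :
    SuppGE l q x := fun a b c h' => hx a b c (by omega)

theorem SuppGE.sum {ι : Type*} {l : Fin 9 → ℤ} {p : ℤ} {s : Finset ι} {f : ι → Ten ℂ}
    (h : ∀ i ∈ s, SuppGE l p (f i)) : SuppGE l p (∑ i ∈ s, f i) := fun a b c h' => by
  simp only [Finset.sum_apply]
  exact Finset.sum_eq_zero fun i hi => h i hi a b c h'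

theorem SuppGE.psi_eq_zero {l : Fin 9 → ℤ} (hl : ∑ i, l i = 0) {p q r : ℤ} {α β γ : Ten ℂ}
    (hα : SuppGE l p α) (hβ : SuppGE l q β) (hγ : SuppGE l r γ) (h : 0 < p + q + r) :
    psi α β γ = 0 := by
  refine Trivector.psi_eq_zero fun σ => ?_
  have hs : ∑ i, l (σ i) = 0 := by rw [Equiv.sum_comp σ l, hl]
  rw [Fin.sum_univ_succ, Fin.sum_univ_eight] at hs
  simp only [Fin.succ_zero_eq_one, Fin.succ_one_eq_two, show Fin.succ (2 : Fin 8) = 3 from rfl,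
    show Fin.succ (3 : Fin 8) = 4 from rfl, show Fin.succ (4 : Fin 8) = 5 from rfl,
    show Fin.succ (5 : Fin 8) = 6 from rfl, show Fin.succ (6 : Fin 8) = 7 from rfl,
    show Fin.succ (7 : Fin 8) = 8 from rfl] at hs
  by_cases h1 : l (σ 0) + l (σ 1) + l (σ 2) < p
  · simp [hα _ _ _ h1]
  by_cases h2 : l (σ 3) + l (σ 4) + l (σ 5) < q
  · simp [hβ _ _ _ h2]
  by_cases h3 : l (σ 6) + l (σ 7) + l (σ 8) < r
  · simp [hγ _ _ _ h3]
  omega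

theorem SuppGE.der_of {l : Fin 9 → ℤ} {p d : ℤ} {x : Ten ℂ} (hx : SuppGE l p x) {X : Mat ℂ}
    (hX : ∀ i j, l i - l j < d → X i j = 0) : SuppGE l (p + d) (der X x) := by
  intro a b c h
  simp only [der_eq, Pi.add_apply, slotA_apply, slotB_apply, slotC_apply]
  have h1 : ∀ u, X a u * x u b c = 0 := fun u => by
    by_cases hu : l a - l u < d
    · simp [hX _ _ hu]
    · simp [hx u b c (by omega)]
  have h2 : ∀ u, X b u * x a u c = 0 := fun u => by
    by_cases hu : l b - l u < d
    · simp [hX _ _ hu]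
    · simp [hx a u c (by omega)]
  have h3 : ∀ u, X c u * x a b u = 0 := fun u => by
    by_cases hu : l c - l u < d
    · simp [hX _ _ hu]
    · simp [hx a b u (by omega)]
  simp [h1, h2, h3]

theorem SuppGE.der_single {l : Fin 9 → ℤ} {p : ℤ} {x : Ten ℂ} (hx : SuppGE l p x)
    (i j : Fin 9) (r : ℂ) : SuppGE l (p + (l i - l j)) (der (Matrix.single i j r) x) := by
  refine hx.der_of fun a b h => ?_
  rw [Matrix.single_apply]
  split_ifs with hab
  · obtain ⟨rfl, rfl⟩ := hab
    exact absurd h (lt_irrefl _)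
  · rfl

theorem SuppGE.der_diagonal {l : Fin 9 → ℤ} {x : Ten ℂ} (hx : SuppGE l 0 x) :
    SuppGE l 1 (der (Matrix.diagonal fun i => (l i : ℂ)) x) := by
  intro a b c h
  simp only [der_eq, Pi.add_apply, slotA_apply, slotB_apply, slotC_apply, Matrix.diagonal_apply,
    ite_mul, zero_mul, Finset.sum_ite_eq, Finset.mem_univ, if_true]
  rw [← add_mul, ← add_mul]
  by_cases h0 : l a + l b + l c < 0
  · simp [hx a b c h0]
  · have : l a + l b + l c = 0 := by omega
    have : (l a : ℂ) + l b + l c = 0 := by exact_mod_cast this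
    simp [this]

/-- The tangent space at `x` carries no degeneracy beyond the scalars. -/
def IsNice (x : Ten ℂ) : Prop :=
  ∀ X : Mat ℂ, (∀ Y, psi x (der X x) (der Y x) = 0) → ∃ s : ℂ, X = s • 1

theorem IsNice.act {x : Ten ℂ} (hx : IsNice x) {g h : Mat ℂ} (gh : g * h = 1) :
    IsNice (act g x) := by
  have hg : h * g = 1 := mul_eq_one_comm.1 gh
  have hd : g.det ≠ 0 := fun h0 => by
    have := congrArg Matrix.det gh
    simp [h0] at this
  intro X hX
  obtain ⟨s, hs⟩ := hx (h * X * g) fun Y => by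
    have h1 := hX (g * Y * h)
    have e1 : der X (Trivector.act g x) = Trivector.act g (der (h * X * g) x) :=
      der_act (by rw [← mul_assoc, ← mul_assoc, gh, one_mul]) x
    have e2 : der (g * Y * h) (Trivector.act g x) = Trivector.act g (der Y x) :=
      der_act (by rw [mul_assoc, hg, mul_one]) x
    rw [e1, e2, psi_act] at h1
    exact (mul_eq_zero.1 h1).resolve_left hd
  refine ⟨s, ?_⟩
  calc X = g * (h * X * g) * h := by
        simp only [← mul_assoc, gh, one_mul]; rw [mul_assoc, gh, mul_one]
    _ = s • 1 := by rw [hs]; simp [gh]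

theorem not_isNice_of_suppGE {x : Ten ℂ} (l : Fin 9 → ℤ) (hl : ∑ i, l i = 0) (hl0 : l ≠ 0)
    (hx : SuppGE l 0 x) : ¬IsNice x := by
  classical
  intro hn
  let P := {p : Fin 9 × Fin 9 // l p.2 < l p.1}
  let Q := {p : Fin 9 × Fin 9 // l p.1 < l p.2}
  let X : (P → ℂ) × ℂ →ₗ[ℂ] Mat ℂ :=
    LinearMap.coprod (∑ p : P, (LinearMap.proj p).smulRight (Matrix.single p.1.1 p.1.2 (1 : ℂ)))
      ((LinearMap.id).smulRight (Matrix.diagonal fun i => (l i : ℂ)))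
  have hX : ∀ v, X v = ∑ p : P, v.1 p • Matrix.single p.1.1 p.1.2 (1 : ℂ) +
      v.2 • Matrix.diagonal fun i => (l i : ℂ) := fun v => by
    simp [X, LinearMap.sum_apply]
  let Φ : (P → ℂ) × ℂ →ₗ[ℂ] (Q → ℂ) :=
    LinearMap.pi fun q => (psi x).flip (der (Matrix.single q.1.1 q.1.2 1) x) ∘ₗ der.flip x ∘ₗ X
  have hΦ : ∀ v q, Φ v q = psi x (der (X v) x) (der (Matrix.single q.1.1 q.1.2 1) x) :=
    fun v q => rfl
  have hdim : Module.finrank ℂ (Q → ℂ) < Module.finrank ℂ ((P → ℂ) × ℂ) := by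
    have e : P ≃ Q := (Equiv.prodComm _ _).subtypeEquiv fun p => Iff.rfl
    simp [Module.finrank_prod, Fintype.card_congr e]
  obtain ⟨v, hv, hv0⟩ := Submodule.exists_mem_ne_zero_of_ne_bot
    (LinearMap.ker_ne_bot_of_finrank_lt (f := Φ) hdim)
  have hsupp : SuppGE l 1 (der (X v) x) := by
    rw [hX, map_add, map_smul, LinearMap.add_apply, LinearMap.smul_apply, map_sum,
      LinearMap.sum_apply]
    refine SuppGE.add (SuppGE.sum fun p _ => ?_) (hx.der_diagonal.smul _)
    rw [map_smul, LinearMap.smul_apply]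
    exact ((hx.der_single _ _ _).smul _).mono (by have := p.2; omega)
  obtain ⟨s, hs⟩ := hn (X v) fun Y => by
    rw [Matrix.matrix_eq_sum_single Y]
    simp only [map_sum, LinearMap.sum_apply]
    refine Finset.sum_eq_zero fun i _ => Finset.sum_eq_zero fun j _ => ?_
    by_cases hij : l i < l j
    · have := congrFun (LinearMap.mem_ker.1 hv) ⟨(i, j), hij⟩
      rw [hΦ] at this
      have e : Matrix.single i j (Y i j) = Y i j • Matrix.single i j (1 : ℂ) := by
        rw [Matrix.smul_single, smul_eq_mul, mul_one]
      rw [e, map_smul, LinearMap.smul_apply, map_smul, this]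
      simp
    · exact hx.psi_eq_zero hl hsupp (hx.der_single i j _) (by omega)
  have hdiag : ∀ i, v.2 * l i = s := fun i => by
    have h1 := congrFun (congrFun hs i) i
    rw [hX] at h1
    have h2 : ∀ p : P, (v.1 p • Matrix.single p.1.1 p.1.2 (1 : ℂ)) i i = 0 := fun p => by
      have := p.2
      rw [Matrix.smul_apply, Matrix.single_apply_of_ne, smul_zero]
      rintro ⟨h1, h2⟩
      rw [h1, h2] at this
      exact lt_irrefl _ this
    rw [Matrix.add_apply, Matrix.sum_apply, Finset.sum_eq_zero fun p _ => h2 p] at h1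
    simpa using h1
  have hs0 : s = 0 := by
    have h1 : ∑ i, v.2 * (l i : ℂ) = 9 * s := by simp [hdiag]
    rw [← Finset.mul_sum, show ∑ i, (l i : ℂ) = 0 by exact_mod_cast hl] at h1
    simpa using h1.symm
  have ht : v.2 = 0 := by
    obtain ⟨i, hi⟩ := Function.ne_iff.1 hl0
    have := hdiag i
    rw [hs0] at this
    exact (mul_eq_zero.1 this).resolve_right (by exact_mod_cast hi)
  apply hv0
  refine Prod.ext (funext fun p => ?_) ht
  have h1 := congrFun (congrFun hs p.1.1) p.1.2
  rw [hX, hs0, ht, zero_smul, add_zero, zero_smul, Matrix.sum_apply,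
    Finset.sum_eq_single p] at h1
  · simpa using h1
  · intro q _ hq
    rw [Matrix.smul_apply, Matrix.single_apply_of_ne, smul_zero]
    rintro ⟨h1, h2⟩
    exact hq (Subtype.ext (Prod.ext h1 h2))
  · simp

end Unstable

section ListTensors

/-- The integer entries of the alternating tensor `e_a ∧ e_b ∧ e_c`. -/
def monoZ (a b c i j k : Fin 9) : ℤ :=
  (if i = a ∧ j = b ∧ k = c then 1 else 0) - (if i = b ∧ j = a ∧ k = c then 1 else 0)
  + (if i = b ∧ j = c ∧ k = a then 1 else 0) - (if i = c ∧ j = b ∧ k = a then 1 else 0)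
  + (if i = c ∧ j = a ∧ k = b then 1 else 0) - (if i = a ∧ j = c ∧ k = b then 1 else 0)

/-- An integer combination of products of three basis vectors. -/
abbrev TenList := List (ℤ × Fin 9 × Fin 9 × Fin 9)

/-- An integer combination of elementary matrices. -/
abbrev MatList := List (ℤ × Fin 9 × Fin 9)

/-- The entries of the tensor described by a list. -/
def evalL (l : TenList) (i j k : Fin 9) : ℤ :=
  l.foldr (fun m s => m.1 * monoZ m.2.1 m.2.2.1 m.2.2.2 i j k + s) 0

/-- The Lie algebra action on lists. -/
def derL (X : MatList) (l : TenList) : TenList :=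
  X.flatMap fun u => l.flatMap fun m =>
    (if m.2.1 = u.2.2 then [(u.1 * m.1, u.2.1, m.2.2.1, m.2.2.2)] else []) ++
    ((if m.2.2.1 = u.2.2 then [(u.1 * m.1, m.2.1, u.2.1, m.2.2.2)] else []) ++
    (if m.2.2.2 = u.2.2 then [(u.1 * m.1, m.2.1, m.2.2.1, u.2.1)] else []))

variable {R : Type*} [CommRing R]

/-- The alternating tensor `e_a ∧ e_b ∧ e_c`. -/
def mono (a b c : Fin 9) : Ten R := fun i j k => (monoZ a b c i j k : R)

/-- The tensor described by a list. -/
def toTen (l : TenList) : Ten R :=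
  (l.map fun m => (m.1 : R) • mono m.2.1 m.2.2.1 m.2.2.2).sum

/-- The matrix described by a list. -/
def toMat (X : MatList) : Mat R := (X.map fun u => (u.1 : R) • Matrix.single u.2.1 u.2.2 1).sum

theorem mono_eq (a b c : Fin 9) : (mono a b c : Ten R) = delta a b c - delta b a c + delta b c a
    - delta c b a + delta c a b - delta a c b := by
  ext i j k
  simp only [mono, monoZ, delta, Pi.add_apply, Pi.sub_apply]
  push_cast
  rfl

theorem mono_swap12 (a b c : Fin 9) : (mono b a c : Ten R) = -mono a b c := by
  rw [mono_eq, mono_eq]; abel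

theorem mono_swap23 (a b c : Fin 9) : (mono a c b : Ten R) = -mono a b c := by
  rw [mono_eq, mono_eq]; abel

theorem mono_self12 (a c : Fin 9) : (mono a a c : Ten R) = 0 := by
  rw [mono_eq]; abel

theorem isAlt_mono (a b c : Fin 9) : IsAlt (mono a b c : Ten R) := by
  constructor
  · intro i j k
    rw [mono, mono, ← Int.cast_neg]
    congr 1
    simp only [monoZ, and_left_comm]
    ring
  · intro i j k
    rw [mono, mono, ← Int.cast_neg]
    congr 1
    simp only [monoZ, and_comm]
    ring

theorem isAlt_zero : IsAlt (0 : Ten R) := ⟨by simp, by simp⟩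

theorem IsAlt.sum {ι : Type*} {s : Finset ι} {f : ι → Ten R} (h : ∀ i ∈ s, IsAlt (f i)) :
    IsAlt (∑ i ∈ s, f i) :=
  Finset.sum_induction _ IsAlt (fun _ _ => IsAlt.add) isAlt_zero h

theorem toTen_nil : (toTen [] : Ten R) = 0 := rfl

theorem toTen_cons (m : ℤ × Fin 9 × Fin 9 × Fin 9) (l : TenList) :
    (toTen (m :: l) : Ten R) = (m.1 : R) • mono m.2.1 m.2.2.1 m.2.2.2 + toTen l := by
  simp [toTen]

theorem toTen_append (l m : TenList) : (toTen (l ++ m) : Ten R) = toTen l + toTen m := by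
  simp [toTen]

theorem toMat_cons (u : ℤ × Fin 9 × Fin 9) (X : MatList) :
    (toMat (u :: X) : Mat R) = (u.1 : R) • Matrix.single u.2.1 u.2.2 1 + toMat X := by
  simp [toMat]

theorem isAlt_toTen (l : TenList) : IsAlt (toTen l : Ten R) := by
  induction l with
  | nil => exact isAlt_zero
  | cons m l ih => rw [toTen_cons]; exact ((isAlt_mono _ _ _).smul _).add ih

theorem toTen_apply (l : TenList) (i j k : Fin 9) : (toTen l : Ten R) i j k = evalL l i j k := by
  induction l with
  | nil => simp [toTen_nil, evalL]
  | cons m l ih =>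
    rw [toTen_cons, Pi.add_apply, Pi.add_apply, Pi.add_apply, ih]
    simp [evalL, mono]

theorem der_single_delta (i j a b c : Fin 9) : der (Matrix.single i j (1 : R)) (delta a b c) =
    (if a = j then delta i b c else 0) + (if b = j then delta a i c else 0) +
      (if c = j then delta a b i else 0) := by
  have hA : slotA (Matrix.single i j (1 : R)) (delta a b c) =
      if a = j then delta i b c else 0 := by
    ext p q r
    simp only [slotA_apply, Matrix.single_apply, delta]
    split_ifs with h
    · subst h
      by_cases h1 : p = i <;> by_cases h2 : q = i <;> by_cases h3 : r = i <;>
        simp [ite_and, delta, h1, h2, h3, eq_comm] <;> grind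
    · rw [Finset.sum_eq_zero]; simp
      · intro u _; simp only [ite_and]; split_ifs <;> simp_all
  have hB : slotB (Matrix.single i j (1 : R)) (delta a b c) =
      if b = j then delta a i c else 0 := by
    ext p q r
    simp only [slotB_apply, Matrix.single_apply, delta]
    split_ifs with h
    · subst h
      by_cases h1 : p = i <;> by_cases h2 : q = i <;> by_cases h3 : r = i <;>
        simp [ite_and, delta, h1, h2, h3, eq_comm] <;> grind
    · rw [Finset.sum_eq_zero]; simp
      · intro u _; simp only [ite_and]; split_ifs <;> simp_all
  have hC : slotC (Matrix.single i j (1 : R)) (delta a b c) =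
      if c = j then delta a b i else 0 := by
    ext p q r
    simp only [slotC_apply, Matrix.single_apply, delta]
    split_ifs with h
    · subst h
      by_cases h1 : p = i <;> by_cases h2 : q = i <;> by_cases h3 : r = i <;>
        simp [ite_and, delta, h1, h2, h3, eq_comm] <;> grind
    · rw [Finset.sum_eq_zero]; simp
      · intro u _; simp only [ite_and]; split_ifs <;> simp_all
  rw [der_eq, hA, hB, hC]

theorem der_single_mono (i j a b c : Fin 9) : der (Matrix.single i j (1 : R)) (mono a b c) =
    (if a = j then mono i b c else 0) + (if b = j then mono a i c else 0) +
      (if c = j then mono a b i else 0) := by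
  simp only [mono_eq, map_add, map_sub, der_single_delta]
  split_ifs <;> abel

theorem toTen_derL (X : MatList) (l : TenList) :
    (toTen (derL X l) : Ten R) = der (toMat X) (toTen l) := by
  induction X with
  | nil => simp [derL, toTen_nil, toMat]
  | cons u X ih =>
    rw [toMat_cons, map_add, LinearMap.add_apply, ← ih]
    change toTen ((l.flatMap _) ++ derL X l) = _
    rw [toTen_append]
    congr 1
    clear ih
    induction l with
    | nil => simp [toTen_nil]
    | cons m l ih =>
      rw [List.flatMap_cons, toTen_append, ih, toTen_cons, map_add, map_smul, map_smul,
        LinearMap.smul_apply, LinearMap.smul_apply, der_single_mono]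
      congr 1
      rw [toTen_append, toTen_append]
      split_ifs <;> simp [toTen_cons, toTen_nil, smul_smul, mul_comm, add_assoc]

end ListTensors

theorem IsAlt.eq_sum {x : Ten ℂ} (hx : IsAlt x) :
    x = ∑ a, ∑ b, ∑ c, (x a b c / 6) • (mono a b c : Ten ℂ) := by
  have h : ∀ y : Ten ℂ, ∀ i j k, (∑ a, ∑ b, ∑ c, (y a b c) • (mono a b c : Ten ℂ)) i j k =
      y i j k - y j i k + y k i j - y k j i + y j k i - y i k j := fun y i j k => by
    simp only [mono_eq, Finset.sum_apply, Pi.smul_apply, Pi.add_apply, Pi.sub_apply, delta,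
      smul_eq_mul, mul_add, mul_sub, mul_ite, mul_one, mul_zero, Finset.sum_add_distrib,
      Finset.sum_sub_distrib, ite_and]
    simp
  ext i j k
  rw [h fun a b c => x a b c / 6]
  have h1 := hx.swap12 i j k
  have h2 := hx.swap23 i j k
  have h3 := hx.swap12 i k j
  have h4 := hx.swap23 k i j
  have h5 := hx.swap23 j i k
  simp only [h1, h2, h3, h4, h5]
  ring

/-- Symmetric reduction of a property of index triples to increasing triples. -/
theorem forall_triple {P : Fin 9 → Fin 9 → Fin 9 → Prop} (h12 : ∀ a b c, P a b c → P b a c)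
    (h23 : ∀ a b c, P a b c → P a c b) (hd : ∀ a c, P a a c)
    (h : ∀ a b c, a < b → b < c → P a b c) (a b c : Fin 9) : P a b c := by
  rcases lt_trichotomy a b with h1 | h1 | h1 <;> rcases lt_trichotomy b c with h2 | h2 | h2 <;>
    rcases lt_trichotomy a c with h3 | h3 | h3 <;> try subst_vars
  all_goals
    first
    | exact h _ _ _ ‹_› ‹_›
    | exact hd _ _
    | exact h23 _ _ _ (hd _ _)
    | exact h12 _ _ _ (h23 _ _ _ (hd _ _))
    | exact h23 _ _ _ (h _ _ _ ‹_› ‹_›)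
    | exact h12 _ _ _ (h _ _ _ ‹_› ‹_›)
    | exact h12 _ _ _ (h23 _ _ _ (h _ _ _ ‹_› ‹_›))
    | exact h23 _ _ _ (h12 _ _ _ (h _ _ _ ‹_› ‹_›))
    | exact h12 _ _ _ (h23 _ _ _ (h12 _ _ _ (h _ _ _ ‹_› ‹_›)))

section Reduction

/-- `y` is obtained from `x` by an invertible matrix preserving the line of the first basis
vector. -/
def Reach (x y : Ten ℂ) : Prop :=
  ∃ B : Mat ℂ, B.det ≠ 0 ∧ (∀ i, i ≠ 0 → B i 0 = 0) ∧ y = act B x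

theorem Reach.refl (x : Ten ℂ) : Reach x x :=
  ⟨1, by simp, fun i hi => Matrix.one_apply_ne hi, (act_one x).symm⟩

theorem Reach.trans {x y z : Ten ℂ} (h : Reach x y) (h' : Reach y z) : Reach x z := by
  obtain ⟨B, hB, hB0, rfl⟩ := h
  obtain ⟨C, hC, hC0, rfl⟩ := h'
  refine ⟨C * B, by rw [Matrix.det_mul]; exact mul_ne_zero hC hB, fun i hi => ?_,
    (act_mul C B x).symm⟩
  rw [Matrix.mul_apply]
  refine Finset.sum_eq_zero fun k _ => ?_
  by_cases hk : k = 0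
  · rw [hk, hC0 i hi, zero_mul]
  · rw [hB0 k hk, mul_zero]

theorem Reach.isAlt {x y : Ten ℂ} (h : Reach x y) (hx : IsAlt x) : IsAlt y := by
  obtain ⟨B, -, -, rfl⟩ := h
  exact hx.act B

theorem Reach.isNice {x y : Ten ℂ} (h : Reach x y) (hx : IsNice x) : IsNice y := by
  obtain ⟨B, hB, -, rfl⟩ := h
  exact hx.act (Matrix.mul_nonsing_inv B (isUnit_iff_ne_zero.2 hB))

theorem act_eq_zero {g : Mat ℂ} {x : Ten ℂ} {i j k : Fin 9}
    (h : ∀ a b c, g i a ≠ 0 → g j b ≠ 0 → g k c ≠ 0 → x a b c = 0) : act g x i j k = 0 := by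
  simp only [act_apply, Finset.mul_sum]
  refine Finset.sum_eq_zero fun a _ => Finset.sum_eq_zero fun b _ =>
    Finset.sum_eq_zero fun c _ => ?_
  by_cases h1 : g i a = 0
  · simp [h1]
  by_cases h2 : g j b = 0
  · simp [h2]
  by_cases h3 : g k c = 0
  · simp [h3]
  simp [h a b c h1 h2 h3]

theorem act_transvection_apply {i j b c : Fin 9} (hb : b ≠ i) (hc : c ≠ i) (r : ℂ) (x : Ten ℂ) :
    act (Matrix.transvection i j r) x i b c = x i b c + r * x j b c := by
  have h : ∀ a, a ≠ i → ∀ k, Matrix.transvection i j r a k = if a = k then 1 else 0 :=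
    fun a ha k => by
      simp [Matrix.transvection, Matrix.one_apply, Ne.symm ha]
  simp only [act_apply, h b hb, h c hc]
  simp [Matrix.transvection, Matrix.one_apply, Matrix.single_apply, add_mul,
    Finset.sum_add_distrib]

theorem transvection_apply_ne_zero {i j p q : Fin 9} {r : ℂ}
    (h : Matrix.transvection i j r p q ≠ 0) : q = p ∨ p = i ∧ q = j := by
  by_contra! hc
  apply h
  rw [Matrix.transvection, Matrix.add_apply, Matrix.one_apply_ne (Ne.symm hc.1),
    Matrix.single_apply_of_ne, add_zero]
  rintro ⟨rfl, rfl⟩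
  exact hc.2 rfl rfl

/-- The indices which may be mixed into `p` by a transvection adding row `j` to row `i`. -/
def shearIdx (i j p : Fin 9) : List (Fin 9) := if p = i then [i, j] else [p]

/-- The indices which may be mixed into `p` by an operation on rows `i` and `j`. -/
def planeIdx (i j p : Fin 9) : List (Fin 9) := if p = i ∨ p = j then [i, j] else [p]

theorem exists_shear {x : Ten ℂ} {i j b c : Fin 9} (hij : i ≠ j) (hj : j ≠ 0) (hb : b ≠ i)
    (hc : c ≠ i) (hx : x j b c ≠ 0) : ∃ y, Reach x y ∧ y i b c = 0 ∧ ∀ p q r,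
      (∀ p' ∈ shearIdx i j p, ∀ q' ∈ shearIdx i j q, ∀ r' ∈ shearIdx i j r, x p' q' r' = 0) →
        y p q r = 0 := by
  have hmem : ∀ p q, Matrix.transvection i j (-x i b c / x j b c) p q ≠ 0 →
      q ∈ shearIdx i j p := fun p q h => by
    unfold shearIdx
    rcases transvection_apply_ne_zero h with rfl | ⟨rfl, rfl⟩
    · split_ifs with h1 <;> simp [h1]
    · simp
  refine ⟨act (Matrix.transvection i j (-x i b c / x j b c)) x, ⟨_, ?_, ?_, rfl⟩, ?_, ?_⟩
  · rw [Matrix.det_transvection_of_ne i j hij]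
    exact one_ne_zero
  · intro k hk
    by_contra h
    rcases transvection_apply_ne_zero h with h | ⟨_, h⟩
    · exact hk h.symm
    · exact hj h.symm
  · rw [act_transvection_apply hb hc]
    field_simp
    ring
  · intro p q r h
    exact act_eq_zero fun p' q' r' hp hq hr =>
      h p' (hmem _ _ hp) q' (hmem _ _ hq) r' (hmem _ _ hr)

theorem exists_rotation {x : Ten ℂ} {i j b c : Fin 9} (hij : i ≠ j) (hi : i ≠ 0) (hj : j ≠ 0)
    (hb : b ≠ i) (hc : c ≠ i) (hb' : b ≠ j) (hc' : c ≠ j) : ∃ y, Reach x y ∧ y i b c = 0 ∧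
      ∀ p q r, (∀ p' ∈ planeIdx i j p, ∀ q' ∈ planeIdx i j q, ∀ r' ∈ planeIdx i j r,
        x p' q' r' = 0) → y p q r = 0 := by
  have hsub : ∀ p q, q ∈ shearIdx i j p → q ∈ planeIdx i j p := fun p q h => by
    unfold shearIdx at h
    unfold planeIdx
    by_cases hp : p = i
    · simpa [hp] using h
    · rw [if_neg hp] at h
      by_cases hp' : p = j
      · rw [if_pos (Or.inr hp')]; simp_all
      · rwa [if_neg (by tauto)]
  by_cases hx : x j b c = 0
  · have hact : ∀ p q r, act ((1 : Mat ℂ).submatrix (swap i j) id) x p q r =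
        x (swap i j p) (swap i j q) (swap i j r) := fun p q r => by
      simp [act_apply, Matrix.one_apply]
    have hmem : ∀ p, swap i j p ∈ planeIdx i j p := fun p => by
      unfold planeIdx
      by_cases hp : p = i
      · simp [hp]
      by_cases hp' : p = j
      · simp [hp']
      rw [swap_apply_of_ne_of_ne hp hp', if_neg (by tauto)]
      simp
    refine ⟨act ((1 : Mat ℂ).submatrix (swap i j) id) x, ⟨_, ?_, ?_, rfl⟩, ?_, ?_⟩
    · rw [Matrix.det_permute, Matrix.det_one, mul_one]
      rcases Int.units_eq_one_or (Perm.sign (swap i j)) with h | h <;> simp [h]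
    · intro k hk
      rw [Matrix.submatrix_apply, id, Matrix.one_apply_ne]
      intro h
      apply hk
      have h0 : swap i j 0 = 0 := swap_apply_of_ne_of_ne hi.symm hj.symm
      exact (swap i j).injective (h.trans h0.symm)
    · rw [hact, swap_apply_left, swap_apply_of_ne_of_ne hb hb', swap_apply_of_ne_of_ne hc hc', hx]
    · intro p q r h
      rw [hact]
      exact h _ (hmem p) _ (hmem q) _ (hmem r)
  · obtain ⟨y, h1, h2, h3⟩ := exists_shear hij hj hb hc hx
    exact ⟨y, h1, h2, fun p q r h => h3 p q r fun p' hp q' hq r' hr =>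
      h p' (hsub _ _ hp) q' (hsub _ _ hq) r' (hsub _ _ hr)⟩

/-- The increasing rearrangement of an index triple. -/
def sortTriple (a b c : Fin 9) : Fin 9 × Fin 9 × Fin 9 :=
  (min a (min b c), max (min a b) (min (max a b) c), max a (max b c))

theorem sortTriple_swap12 : ∀ a b c, sortTriple a b c = sortTriple b a c := by decide +kernel

theorem sortTriple_swap23 : ∀ a b c, sortTriple a b c = sortTriple a c b := by decide +kernel

theorem sortTriple_of_lt {a b c : Fin 9} (hab : a < b) (hbc : b < c) :
    sortTriple a b c = (a, b, c) := by
  simp [sortTriple, hab.le, hbc.le, (hab.trans hbc).le]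

/-- The extension of a condition on increasing triples to all triples, true on triples with a
repeated index. -/
def symExt (Z : Fin 9 → Fin 9 → Fin 9 → Bool) (a b c : Fin 9) : Bool :=
  a == b || b == c || a == c ||
    Z (sortTriple a b c).1 (sortTriple a b c).2.1 (sortTriple a b c).2.2

/-- The tensor vanishes on the increasing triples satisfying `Z`. -/
def Supp (Z : Fin 9 → Fin 9 → Fin 9 → Bool) (x : Ten ℂ) : Prop :=
  ∀ a b c, a < b → b < c → Z a b c = true → x a b c = 0

theorem IsAlt.self12 {x : Ten ℂ} (hx : IsAlt x) (a c : Fin 9) : x a a c = 0 := by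
  have := hx.swap12 a a c
  exact self_eq_neg.1 this

theorem Supp.symExt {Z : Fin 9 → Fin 9 → Fin 9 → Bool} {x : Ten ℂ} (h : Supp Z x)
    (hx : IsAlt x) (a b c : Fin 9) (hz : symExt Z a b c = true) : x a b c = 0 := by
  revert hz
  refine forall_triple (P := fun a b c => Trivector.symExt Z a b c = true → x a b c = 0)
    ?_ ?_ ?_ ?_ a b c
  · intro a b c h1 h2
    rw [hx.swap12, h1, neg_zero]
    unfold Trivector.symExt at h2 ⊢
    rw [sortTriple_swap12 a b c]
    rw [← h2, Bool.beq_comm (a := a) (b := b)]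
    grind
  · intro a b c h1 h2
    rw [hx.swap23, h1, neg_zero]
    unfold Trivector.symExt at h2 ⊢
    rw [sortTriple_swap23 a b c]
    rw [← h2, Bool.beq_comm (a := b) (b := c)]
    grind
  · intro a c _
    exact hx.self12 a c
  · intro a b c hab hbc h2
    refine h a b c hab hbc ?_
    rw [Trivector.symExt, sortTriple_of_lt hab hbc] at h2
    simpa [hab.ne, hbc.ne, (hab.trans hbc).ne] using h2

theorem IsAlt.apply_sortTriple {x : Ten ℂ} (hx : IsAlt x) (a b c : Fin 9) (h : x a b c = 0) :
    x (sortTriple a b c).1 (sortTriple a b c).2.1 (sortTriple a b c).2.2 = 0 := by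
  revert h
  refine forall_triple (P := fun a b c => x a b c = 0 →
    x (sortTriple a b c).1 (sortTriple a b c).2.1 (sortTriple a b c).2.2 = 0) ?_ ?_ ?_ ?_ a b c
  · intro a b c h1 h2
    rw [← sortTriple_swap12]
    exact h1 (by rw [hx.swap12, h2, neg_zero])
  · intro a b c h1 h2
    rw [← sortTriple_swap23]
    exact h1 (by rw [hx.swap23, h2, neg_zero])
  · intro a c _
    have h1 : ∀ a c, sortTriple a a c = (min a c, a, max a c) := by decide +kernel
    rw [h1]
    rcases le_total a c with h | h
    · rw [min_eq_left h, max_eq_right h, hx.self12]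
    · rw [min_eq_right h, max_eq_left h]
      exact self_eq_neg.1 (hx.swap23 c a a)
  · intro a b c hab hbc h
    rwa [sortTriple_of_lt hab hbc]

theorem IsNice.ne_zero_of {x : Ten ℂ} (hn : IsNice x) (hx : IsAlt x)
    {Z : Fin 9 → Fin 9 → Fin 9 → Bool} (h : Supp Z x) (i j k : Fin 9) (l : Fin 9 → ℤ)
    (hl : ∑ i, l i = 0) (hl0 : l ≠ 0)
    (hZ : ∀ a b c, a < b → b < c → l a + l b + l c < 0 → Z a b c = true ∨ (a, b, c) = (i, j, k)) :
    x i j k ≠ 0 := by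
  intro h0
  refine not_isNice_of_suppGE l hl hl0 ?_ hn
  refine forall_triple (P := fun a b c => l a + l b + l c < 0 → x a b c = 0) ?_ ?_ ?_ ?_
  · intro a b c h1 h2
    rw [hx.swap12, h1 (by omega), neg_zero]
  · intro a b c h1 h2
    rw [hx.swap23, h1 (by omega), neg_zero]
  · intro a c _
    exact hx.self12 a c
  · intro a b c hab hbc h2
    rcases hZ a b c hab hbc h2 with h3 | h3
    · exact h a b c hab hbc h3
    · simp only [Prod.mk.injEq] at h3
      obtain ⟨rfl, rfl, rfl⟩ := h3
      exact h0

/-- Reachable nice alternating tensors vanishing on the triples satisfying `Z`. -/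
def Reduces (x : Ten ℂ) (Z : Fin 9 → Fin 9 → Fin 9 → Bool) : Prop :=
  ∃ y, Reach x y ∧ IsAlt y ∧ IsNice y ∧ Supp Z y

theorem Reduces.rotate {x : Ten ℂ} {Z : Fin 9 → Fin 9 → Fin 9 → Bool} (h : Reduces x Z)
    (i j b c : Fin 9) {Z' : Fin 9 → Fin 9 → Fin 9 → Bool}
    (hd : i ≠ j ∧ i ≠ 0 ∧ j ≠ 0 ∧ b ≠ i ∧ c ≠ i ∧ b ≠ j ∧ c ≠ j)
    (hZ : ∀ p q r, p < q → q < r → Z' p q r = true → sortTriple i b c = (p, q, r) ∨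
      ∀ p' ∈ planeIdx i j p, ∀ q' ∈ planeIdx i j q, ∀ r' ∈ planeIdx i j r,
        symExt Z p' q' r' = true) : Reduces x Z' := by
  obtain ⟨y, hr, ha, hn, hs⟩ := h
  obtain ⟨h1, h2, h3, h4, h5, h6, h7⟩ := hd
  obtain ⟨z, hz, hz0, hz1⟩ := exists_rotation (x := y) h1 h2 h3 h4 h5 h6 h7
  have hza := hz.isAlt ha
  refine ⟨z, hr.trans hz, hza, hz.isNice hn, fun p q r hpq hqr hp => ?_⟩
  rcases hZ p q r hpq hqr hp with h | h
  · have := hza.apply_sortTriple i b c hz0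
    rwa [h] at this
  · exact hz1 p q r fun p' hp' q' hq' r' hr' => hs.symExt ha _ _ _ (h p' hp' q' hq' r' hr')

theorem Reduces.shear {x : Ten ℂ} {Z : Fin 9 → Fin 9 → Fin 9 → Bool} (h : Reduces x Z)
    (i j b c : Fin 9) {Z' : Fin 9 → Fin 9 → Fin 9 → Bool} (l : Fin 9 → ℤ)
    (hd : i ≠ j ∧ j ≠ 0 ∧ b ≠ i ∧ c ≠ i) (hl : ∑ i, l i = 0) (hl0 : l ≠ 0)
    (hlZ : ∀ p q r, p < q → q < r → l p + l q + l r < 0 →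
      Z p q r = true ∨ (p, q, r) = (j, b, c) ∨ (p, q, r) = sortTriple j b c)
    (hZ : ∀ p q r, p < q → q < r → Z' p q r = true → sortTriple i b c = (p, q, r) ∨
      ∀ p' ∈ shearIdx i j p, ∀ q' ∈ shearIdx i j q, ∀ r' ∈ shearIdx i j r,
        symExt Z p' q' r' = true) : Reduces x Z' := by
  obtain ⟨y, hr, ha, hn, hs⟩ := h
  obtain ⟨h1, h2, h3, h4⟩ := hd
  have hy : y j b c ≠ 0 := fun h0 => by
    refine hn.ne_zero_of ha hs _ _ _ l hl hl0 (fun p q r hpq hqr hp => ?_)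
      (ha.apply_sortTriple j b c h0)
    rcases hlZ p q r hpq hqr hp with h | h | h
    · exact Or.inl h
    · simp only [Prod.mk.injEq] at h
      obtain ⟨rfl, rfl, rfl⟩ := h
      exact Or.inr (sortTriple_of_lt hpq hqr).symm
    · exact Or.inr h
  obtain ⟨z, hz, hz0, hz1⟩ := exists_shear (x := y) h1 h2 h3 h4 hy
  have hza := hz.isAlt ha
  refine ⟨z, hr.trans hz, hza, hz.isNice hn, fun p q r hpq hqr hp => ?_⟩
  rcases hZ p q r hpq hqr hp with h | h
  · have := hza.apply_sortTriple i b c hz0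
    rwa [h] at this
  · exact hz1 p q r fun p' hp' q' hq' r' hr' => hs.symExt ha _ _ _ (h p' hp' q' hq' r' hr')

/-- The weights of the flag: a tensor of nonnegative weight is adapted to the standard flag. -/
def flagWt : Fin 9 → ℤ := ![3, 1, 0, 1, 0, -1, 0, -1, -2]

/-- The weights of the grading refining the standard flag. -/
def gradWt : Fin 9 → ℤ := ![5, 3, 2, 1, 0, -1, -2, -3, -4]

/-- Triples of negative flag weight or in a given list. -/
def flagZ (K : List (Fin 9 × Fin 9 × Fin 9)) (a b c : Fin 9) : Bool :=
  decide (flagWt a + flagWt b + flagWt c < 0) || decide ((a, b, c) ∈ K)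

/-- Triples of negative degree. -/
def gradZ (a b c : Fin 9) : Bool := decide (gradWt a + gradWt b + gradWt c < 0)

theorem reduces_gradZ {x : Ten ℂ} (hx : IsAlt x) (hn : IsNice x) (h : SuppGE flagWt 0 x) :
    Reduces x gradZ := by
  have h0 : Reduces x (flagZ []) := ⟨x, Reach.refl x, hx, hn, fun a b c _ _ hz =>
    h a b c (by simpa [flagZ] using hz)⟩
  have h1 : Reduces x (flagZ [(0, 7, 8)]) := h0.rotate 7 5 0 8 (by decide) (by decide +kernel)
  have h2 : Reduces x (flagZ [(0, 7, 8), (3, 6, 7)]) :=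
    h1.rotate 6 2 3 7 (by decide) (by decide +kernel)
  have h3 : Reduces x (flagZ [(0, 7, 8), (3, 6, 7), (3, 4, 7)]) :=
    h2.rotate 4 2 3 7 (by decide) (by decide +kernel)
  have h4 : Reduces x (flagZ [(0, 7, 8), (3, 6, 7), (1, 6, 7)]) :=
    h3.rotate 6 4 1 7 (by decide) (by decide +kernel)
  have h5 : Reduces x (flagZ [(0, 7, 8), (3, 6, 7), (1, 6, 7), (3, 5, 6)]) :=
    h4.rotate 3 1 5 6 (by decide) (by decide +kernel)
  have h6 : Reduces x (flagZ [(0, 7, 8), (3, 6, 7), (1, 6, 7), (3, 5, 6), (3, 4, 7)]) :=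
    h5.rotate 4 2 3 7 (by decide) (by decide +kernel)
  have h7 : Reduces x (flagZ [(0, 7, 8), (3, 6, 7), (1, 6, 7), (3, 5, 6), (3, 4, 7), (0, 6, 8)]) :=
    h6.shear 6 5 0 8 ![2, 1, 0, 1, 0, -1, 0, -1, -2] (by decide) (by decide) (by decide)
      (by decide +kernel) (by decide +kernel)
  exact h7.shear 3 2 4 6 ![2, 2, -1, 2, -1, -1, -1, -1, -1] (by decide) (by decide) (by decide)
      (by decide +kernel) (by decide +kernel)

end Reduction

section NormalForm

/-- The triples of degree zero. -/
def simpleL : TenList :=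
  [(1, 0, 5, 8), (1, 0, 6, 7), (1, 1, 3, 8), (1, 1, 4, 7), (1, 1, 5, 6), (1, 2, 3, 7),
    (1, 2, 4, 6), (1, 3, 4, 5)]

/-- The part of the slice transverse to the orbit of the principal nilpotent. -/
def tail {R : Type*} [CommRing R] (c : Fin 4 → R) : Ten R :=
  c 0 • mono 0 3 6 + c 1 • mono 0 3 4 + c 2 • mono 0 2 3 + c 3 • mono 0 1 2

/-- The slice of normal forms. -/
def slice {R : Type*} [CommRing R] (c : Fin 4 → R) : Ten R := toTen simpleL + tail c

theorem tail_add (c c' : Fin 4 → ℂ) : tail (c + c') = tail c + tail c' := by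
  simp only [tail, Pi.add_apply]
  module

theorem isAlt_tail (c : Fin 4 → ℂ) : IsAlt (tail c) :=
  ((((isAlt_mono _ _ _).smul _).add ((isAlt_mono _ _ _).smul _)).add
    ((isAlt_mono _ _ _).smul _)).add ((isAlt_mono _ _ _).smul _)

theorem isAlt_slice (c : Fin 4 → ℂ) : IsAlt (slice c) := (isAlt_toTen _).add (isAlt_tail c)

theorem suppGE_mono (l : Fin 9 → ℤ) (a b c : Fin 9) :
    SuppGE l (l a + l b + l c) (mono a b c) := by
  intro i j k h
  have h0 : ∀ a' b' c', l a' + l b' + l c' = l a + l b + l c → ¬(i = a' ∧ j = b' ∧ k = c') := by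
    rintro a' b' c' h' ⟨rfl, rfl, rfl⟩
    omega
  rw [mono, monoZ, if_neg (h0 _ _ _ rfl), if_neg (h0 _ _ _ (by ring)), if_neg (h0 _ _ _ (by ring)),
    if_neg (h0 _ _ _ (by ring)), if_neg (h0 _ _ _ (by ring)), if_neg (h0 _ _ _ (by ring))]
  simp

theorem suppGE_tail (c : Fin 4 → ℂ) : SuppGE gradWt 4 (tail c) :=
  ((((((suppGE_mono _ _ _ _).mono (by decide)).smul _).add
    (((suppGE_mono _ _ _ _).mono (by decide)).smul _)).add
    (((suppGE_mono _ _ _ _).mono (by decide)).smul _)).add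
    (((suppGE_mono _ _ _ _).mono (by decide)).smul _))

theorem suppGE_toTen {l : Fin 9 → ℤ} {p : ℤ} {L : TenList}
    (h : ∀ m ∈ L, p ≤ l m.2.1 + l m.2.2.1 + l m.2.2.2) : SuppGE l p (toTen L) := by
  induction L with
  | nil => intro a b c _; simp [toTen_nil]
  | cons m L ih =>
    rw [toTen_cons]
    exact (((suppGE_mono _ _ _ _).mono (h m (by simp))).smul _).add
      (ih fun m' hm' => h m' (by simp [hm']))

/-- Solutions of `X • e = d • e_a ∧ e_b ∧ e_c - r • (slice direction)`, up to higher degree. -/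
def elimTable : List ((Fin 9 × Fin 9 × Fin 9) × ℤ × ℤ × MatList) :=
  [((0, 4, 8), 2, 0, [(-1, 1, 2), (1, 3, 4), (2, 4, 5), (-1, 6, 7)]),
   ((0, 5, 7), 2, 0, [(-1, 1, 2), (-1, 3, 4), (1, 6, 7), (2, 7, 8)]),
   ((1, 2, 8), 2, 0, [(-1, 1, 2), (2, 2, 3), (-1, 3, 4), (-2, 5, 6), (1, 6, 7), (2, 7, 8)]),
   ((1, 3, 7), 2, 0, [(1, 1, 2), (1, 3, 4), (-1, 6, 7)]),
   ((1, 4, 6), 2, 0, [(1, 1, 2), (-1, 3, 4), (1, 6, 7)]),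
   ((2, 3, 6), 2, 0, [(-1, 1, 2), (1, 3, 4), (1, 6, 7)]),
   ((2, 4, 5), 2, 0, [(1, 1, 2), (1, 3, 4), (2, 5, 6), (-1, 6, 7), (-2, 7, 8)]),
   ((0, 3, 8), 5, 0, [(2, 0, 1), (-1, 1, 3), (-1, 2, 4), (3, 3, 5), (-2, 4, 6), (-1, 5, 7), (-3, 6, 8)]),
   ((0, 4, 7), 5, 0, [(1, 0, 1), (2, 1, 3), (2, 2, 4), (-1, 3, 5), (4, 4, 6), (2, 5, 7), (1, 6, 8)]),
   ((0, 5, 6), 5, 0, [(2, 0, 1), (-1, 1, 3), (-1, 2, 4), (-2, 3, 5), (-2, 4, 6), (-1, 5, 7), (2, 6, 8)]),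
   ((1, 2, 7), 5, 0, [(1, 0, 1), (-3, 1, 3), (2, 2, 4), (-1, 3, 5), (-1, 4, 6), (2, 5, 7), (1, 6, 8)]),
   ((1, 3, 6), 5, 0, [(-2, 0, 1), (1, 1, 3), (1, 2, 4), (2, 3, 5), (2, 4, 6), (1, 5, 7), (3, 6, 8)]),
   ((1, 4, 5), 5, 0, [(1, 0, 1), (2, 1, 3), (2, 2, 4), (-1, 3, 5), (-1, 4, 6), (2, 5, 7), (1, 6, 8)]),
   ((2, 3, 5), 5, 0, [(1, 0, 1), (-3, 1, 3), (-3, 2, 4), (-1, 3, 5), (-1, 4, 6), (2, 5, 7), (1, 6, 8)]),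
   ((0, 2, 8), 2, 0, [(-1, 0, 2), (2, 1, 4), (2, 2, 5), (1, 3, 6), (-1, 4, 7), (3, 5, 8)]),
   ((0, 3, 7), 2, 0, [(1, 0, 2), (1, 3, 6), (1, 4, 7), (1, 5, 8)]),
   ((0, 4, 6), 2, 0, [(1, 0, 2), (-1, 3, 6), (-1, 4, 7), (-1, 5, 8)]),
   ((1, 2, 6), 1, 0, [(-1, 1, 4), (-1, 5, 8)]), ((1, 3, 5), 1, 0, [(1, 5, 8)]),
   ((2, 3, 4), 2, 0, [(1, 0, 2), (-1, 3, 6), (1, 4, 7), (-1, 5, 8)]),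
   ((0, 1, 8), 1, 1, [(1, 1, 5), (1, 3, 7)]),
   ((0, 2, 7), 1, -2, [(-1, 0, 3), (-1, 1, 5), (-2, 3, 7), (-1, 4, 8)]), ((0, 3, 6), 1, 1, []),
   ((0, 4, 5), 1, -1, [(-1, 3, 7), (-1, 4, 8)]),
   ((1, 2, 5), 1, -2, [(-1, 0, 3), (-1, 1, 5), (-1, 2, 6), (-2, 3, 7), (-1, 4, 8)]),
   ((1, 3, 4), 1, -1, [(-1, 3, 7)]),
   ((0, 1, 7), 2, 0, [(-1, 0, 4), (1, 1, 6), (1, 2, 7), (1, 3, 8)]),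
   ((0, 2, 6), 2, 0, [(-1, 0, 4), (-1, 1, 6), (-1, 2, 7), (1, 3, 8)]),
   ((0, 3, 5), 1, 0, [(-1, 3, 8)]),
   ((1, 2, 4), 2, 0, [(1, 0, 4), (1, 1, 6), (-1, 2, 7), (-1, 3, 8)]),
   ((0, 1, 6), 1, 1, [(-1, 0, 5)]), ((0, 2, 5), 1, -1, [(1, 0, 5), (-1, 1, 7), (-1, 2, 8)]),
   ((0, 3, 4), 1, 1, []), ((1, 2, 3), 1, 1, [(-1, 0, 5), (1, 1, 7)]),
   ((0, 1, 5), 1, 0, [(-1, 1, 8)]), ((0, 2, 4), 1, 0, [(1, 0, 6), (1, 1, 8)]),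
   ((0, 1, 4), 1, -1, [(1, 0, 7)]), ((0, 2, 3), 1, 1, []), ((0, 1, 3), 1, 0, [(1, 0, 8)]),
   ((0, 1, 2), 1, 1, [])]

/-- The slice direction in a given degree. -/
def tailL (d : ℤ) : TenList :=
  if d = 4 then [(1, 0, 3, 6)] else if d = 6 then [(1, 0, 3, 4)] else
    if d = 8 then [(1, 0, 2, 3)] else if d = 10 then [(1, 0, 1, 2)] else []

theorem elimTable_spec : ∀ a b c : Fin 9, a < b → b < c →
    ∀ d ∈ [1, 2, 3, 4, 5, 6, 7, 8, 9, (10 : ℤ)], gradWt a + gradWt b + gradWt c = d →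
      let u := (elimTable.lookup (a, b, c)).getD (0, 0, [])
      u.1 ≠ 0 ∧ (∀ v ∈ u.2.2, gradWt v.2.1 - gradWt v.2.2 = d) ∧
        ∀ i j k : Fin 9, i < j → j < k → gradWt i + gradWt j + gradWt k = d →
          u.1 * monoZ a b c i j k =
            evalL (derL u.2.2 simpleL) i j k + u.2.1 * evalL (tailL d) i j k := by
  decide +kernel

theorem toMat_apply_eq_zero {X : MatList} {i j : Fin 9}
    (h : ∀ v ∈ X, ¬(v.2.1 = i ∧ v.2.2 = j)) : (toMat X : Mat ℂ) i j = 0 := by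
  induction X with
  | nil => simp [toMat]
  | cons v X ih =>
    rw [toMat_cons, Matrix.add_apply, ih fun u hu => h u (by simp [hu]), Matrix.smul_apply,
      Matrix.single_apply_of_ne (h := h v (by simp))]
    simp

theorem suppGE_simple : SuppGE gradWt 0 (toTen simpleL) := suppGE_toTen (by decide)

theorem exists_tail_eq (d : ℤ) : ∃ c : Fin 4 → ℂ, tail c = toTen (tailL d) := by
  unfold tailL
  split_ifs
  · exact ⟨![1, 0, 0, 0], by simp [tail, toTen]⟩
  · exact ⟨![0, 1, 0, 0], by simp [tail, toTen]⟩
  · exact ⟨![0, 0, 1, 0], by simp [tail, toTen]⟩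
  · exact ⟨![0, 0, 0, 1], by simp [tail, toTen]⟩
  · exact ⟨0, by simp [tail, toTen]⟩

theorem suppGE_of_sorted {l : Fin 9 → ℤ} {p : ℤ} {x : Ten ℂ} (hx : IsAlt x)
    (h : ∀ a b c, a < b → b < c → l a + l b + l c < p → x a b c = 0) : SuppGE l p x := by
  refine forall_triple (P := fun a b c => l a + l b + l c < p → x a b c = 0) ?_ ?_ ?_ h
  · intro a b c h1 h2
    rw [hx.swap12, h1 (by omega), neg_zero]
  · intro a b c h1 h2
    rw [hx.swap23, h1 (by omega), neg_zero]
  · intro a c _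
    exact hx.self12 a c

theorem suppGE_tailL (d : ℤ) : SuppGE gradWt d (toTen (tailL d)) := by
  refine suppGE_toTen fun m hm => ?_
  unfold tailL at hm
  split_ifs at hm with h1 h2 h3 h4 <;> simp at hm <;> subst hm <;> subst_vars <;> decide

/-- The tensor can be eliminated in degree `d`: up to higher degree it is the sum of a tangent
vector to the orbit of the principal nilpotent and a slice direction. -/
def Elim (d : ℤ) (x : Ten ℂ) : Prop :=
  ∃ X : Mat ℂ, ∃ t : Fin 4 → ℂ, (∀ i j, gradWt i - gradWt j < d → X i j = 0) ∧
    SuppGE gradWt d (tail t) ∧ SuppGE gradWt (d + 1) (x - der X (toTen simpleL) - tail t)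

theorem Elim.neg {d : ℤ} {x : Ten ℂ} (h : Elim d x) : Elim d (-x) := by
  obtain ⟨X, t, h1, h2, h3⟩ := h
  have ht : (tail (-t) : Ten ℂ) = (-1 : ℂ) • tail t := by simp only [tail, Pi.neg_apply]; module
  refine ⟨-X, -t, fun i j hij => by simp [h1 i j hij], ht ▸ h2.smul _, ?_⟩
  rw [ht]
  convert h3.smul (-1) using 1
  simp only [map_neg, LinearMap.neg_apply]
  module

theorem elim_mono {d : ℤ} (hd : d ∈ [1, 2, 3, 4, 5, 6, 7, 8, 9, (10 : ℤ)])
    (a b c : Fin 9) : d ≤ gradWt a + gradWt b + gradWt c → Elim d (mono a b c) := by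
  refine forall_triple
    (P := fun a b c => d ≤ gradWt a + gradWt b + gradWt c → Elim d (mono a b c)) ?_ ?_ ?_ ?_ a b c
  · intro a b c h1 h2
    rw [mono_swap12]
    exact (h1 (by omega)).neg
  · intro a b c h1 h2
    rw [mono_swap23]
    exact (h1 (by omega)).neg
  · intro a c _
    refine ⟨0, 0, by simp, ?_, ?_⟩ <;> intro i j k _ <;> simp [mono_self12, tail]
  · intro a b c hab hbc h
    rcases h.lt_or_eq with h | h
    · refine ⟨0, 0, by simp, ?_, ?_⟩
      · intro i j k _
        simp [tail]
      · have : (tail 0 : Ten ℂ) = 0 := by simp [tail]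
        rw [this, map_zero, LinearMap.zero_apply, sub_zero, sub_zero]
        exact (suppGE_mono _ _ _ _).mono h
    · obtain ⟨h1, h2, h3⟩ := elimTable_spec a b c hab hbc d hd h.symm
      generalize (elimTable.lookup (a, b, c)).getD (0, 0, []) = u at h1 h2 h3
      obtain ⟨t, ht⟩ := exists_tail_eq d
      have h1' : (u.1 : ℂ) ≠ 0 := by exact_mod_cast h1
      have hX : ∀ i j, gradWt i - gradWt j < d → (toMat u.2.2 : Mat ℂ) i j = 0 :=
        fun i j hij => toMat_apply_eq_zero fun v hv => by
          rintro ⟨rfl, rfl⟩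
          rw [h2 v hv] at hij
          exact lt_irrefl _ hij
      have ht' : (tail (((u.2.1 : ℂ) / u.1) • t) : Ten ℂ) =
          ((u.2.1 : ℂ) / u.1) • toTen (tailL d) := by
        rw [← ht]
        simp only [tail, Pi.smul_apply, smul_eq_mul]
        module
      have e0 : (-(u.1 : ℂ)⁻¹ : ℂ) • der (toMat u.2.2) (toTen simpleL : Ten ℂ) =
          - der ((u.1 : ℂ)⁻¹ • toMat u.2.2) (toTen simpleL) := by
        rw [map_smul, LinearMap.smul_apply, neg_smul]
      have s1 : SuppGE gradWt d (mono a b c : Ten ℂ) := (suppGE_mono _ _ _ _).mono h.le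
      have s2 : SuppGE gradWt d (der ((u.1 : ℂ)⁻¹ • toMat u.2.2) (toTen simpleL)) := by
        have := suppGE_simple.der_of (X := (u.1 : ℂ)⁻¹ • toMat u.2.2) (d := d)
          fun i j hij => by simp [hX i j hij]
        exact this.mono (by omega)
      have s3 : SuppGE gradWt d (tail (((u.2.1 : ℂ) / u.1) • t) : Ten ℂ) :=
        ht' ▸ (suppGE_tailL d).smul _
      refine ⟨(u.1 : ℂ)⁻¹ • toMat u.2.2, ((u.2.1 : ℂ) / u.1) • t,
        fun i j hij => by simp [hX i j hij], s3, ?_⟩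
      refine suppGE_of_sorted ?_ fun i j k hij hjk hijk => ?_
      · have := ((isAlt_mono a b c).add (((isAlt_toTen simpleL).der
          ((u.1 : ℂ)⁻¹ • toMat u.2.2)).smul (-1 : ℂ))).add ((isAlt_tail
            (((u.2.1 : ℂ) / u.1) • t)).smul (-1 : ℂ))
        convert this using 1
        module
      · by_cases hlt : gradWt i + gradWt j + gradWt k < d
        · rw [Pi.sub_apply, Pi.sub_apply, Pi.sub_apply, Pi.sub_apply, Pi.sub_apply, Pi.sub_apply,
            s1 i j k hlt, s2 i j k hlt, s3 i j k hlt, sub_zero, sub_zero]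
        have h4 : ((u.1 * monoZ a b c i j k : ℤ) : ℂ) = ((evalL (derL u.2.2 simpleL) i j k +
          u.2.1 * evalL (tailL d) i j k : ℤ) : ℂ) := by rw [h3 i j k hij hjk (by omega)]
        push_cast at h4
        rw [← toTen_apply, ← toTen_apply, toTen_derL] at h4
        rw [ht', map_smul]
        simp only [Pi.sub_apply, LinearMap.smul_apply, Pi.smul_apply, smul_eq_mul, mono]
        field_simp
        linear_combination h4

theorem exists_elim {d : ℤ} (hd : d ∈ [1, 2, 3, 4, 5, 6, 7, 8, 9, (10 : ℤ)]) {r : Ten ℂ}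
    (hr : IsAlt r) (hs : SuppGE gradWt d r) : ∃ X : Mat ℂ, ∃ t : Fin 4 → ℂ,
      (∀ i j, gradWt i - gradWt j < d → X i j = 0) ∧
      SuppGE gradWt (d + 1) (r - der X (toTen simpleL) - tail t) := by
  have h : ∀ a b c, ∃ X : Mat ℂ, ∃ t : Fin 4 → ℂ,
      (∀ i j, gradWt i - gradWt j < d → X i j = 0) ∧ SuppGE gradWt (d + 1)
        ((r a b c / 6) • mono a b c - der X (toTen simpleL) - tail t) := fun a b c => by
    by_cases h0 : d ≤ gradWt a + gradWt b + gradWt c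
    · obtain ⟨X, t, h1, -, h2⟩ := elim_mono hd a b c h0
      refine ⟨(r a b c / 6) • X, (r a b c / 6) • t, fun i j hij => by simp [h1 i j hij], ?_⟩
      convert h2.smul (r a b c / 6) using 1
      simp only [map_smul, LinearMap.smul_apply, tail, Pi.smul_apply, smul_eq_mul]
      module
    · refine ⟨0, 0, by simp, ?_⟩
      rw [hs a b c (by omega)]
      intro i j k _
      simp [tail]
  choose X t hX hXt using h
  refine ⟨∑ a, ∑ b, ∑ c, X a b c, ∑ a, ∑ b, ∑ c, t a b c, fun i j hij => ?_, ?_⟩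
  · simp only [Matrix.sum_apply]
    simp [hX _ _ _ i j hij]
  · have hts : ∀ {ι : Type} (s : Finset ι) (f : ι → Fin 4 → ℂ),
        (tail (∑ i ∈ s, f i) : Ten ℂ) = ∑ i ∈ s, tail (f i) := fun s f => by
      classical
      induction s using Finset.induction_on with
      | empty => simp [tail]
      | insert a s ha ih => rw [Finset.sum_insert ha, Finset.sum_insert ha, tail_add, ih]
    conv in r - _ => rw [hr.eq_sum]
    simp only [hts, map_sum, LinearMap.sum_apply, ← Finset.sum_sub_distrib]
    exact SuppGE.sum fun a _ => SuppGE.sum fun b _ => SuppGE.sum fun c _ => hXt a b c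

end NormalForm

section Slice

theorem SuppGE.slots_of {l : Fin 9 → ℤ} {p d : ℤ} {x : Ten ℂ} (hx : SuppGE l p x) {X : Mat ℂ}
    (hX : ∀ i j, l i - l j < d → X i j = 0) :
    SuppGE l (p + d) (slotA X x) ∧ SuppGE l (p + d) (slotB X x) ∧ SuppGE l (p + d) (slotC X x) := by
  refine ⟨fun a b c h => ?_, fun a b c h => ?_, fun a b c h => ?_⟩ <;>
    simp only [slotA_apply, slotB_apply, slotC_apply] <;>
    refine Finset.sum_eq_zero fun u _ => ?_
  · by_cases hu : l a - l u < d
    · simp [hX _ _ hu]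
    · simp [hx u b c (by omega)]
  · by_cases hu : l b - l u < d
    · simp [hX _ _ hu]
    · simp [hx a u c (by omega)]
  · by_cases hu : l c - l u < d
    · simp [hX _ _ hu]
    · simp [hx a b u (by omega)]

theorem SuppGE.act_one_sub {l : Fin 9 → ℤ} {p d : ℤ} {x : Ten ℂ} (hx : SuppGE l p x) {X : Mat ℂ}
    (hd : 0 ≤ d) (hX : ∀ i j, l i - l j < d → X i j = 0) :
    SuppGE l (p + 2 * d) (act (1 - X) x - x + der X x) := by
  have e : act (1 - X) x - x + der X x = slotA X (slotB X x) + slotA X (slotC X x) +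
      slotB X (slotC X x) + (-1 : ℂ) • slotA X (slotB X (slotC X x)) := by
    simp only [act_eq, der_eq, map_sub, LinearMap.sub_apply, slotA_one, slotB_one, slotC_one]
    module
  obtain ⟨-, hB, hC⟩ := hx.slots_of hX
  obtain ⟨h1, -, -⟩ := hB.slots_of hX
  obtain ⟨h2, h3, -⟩ := hC.slots_of hX
  obtain ⟨h4, -, -⟩ := h3.slots_of hX
  rw [e]
  exact (((h1.mono (by omega)).add (h2.mono (by omega))).add (h3.mono (by omega))).add
    ((h4.smul _).mono (by omega))

theorem IsAlt.eq_zero_of_suppGE {r : Ten ℂ} (hr : IsAlt r) (hs : SuppGE gradWt 11 r) : r = 0 := by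
  have hw : ∀ a b c, a < b → b < c → gradWt a + gradWt b + gradWt c < 11 := by decide
  funext a b c
  refine forall_triple (P := fun a b c => r a b c = 0) ?_ ?_ ?_ ?_ a b c
  · intro a b c h
    rw [hr.swap12, h, neg_zero]
  · intro a b c h
    rw [hr.swap23, h, neg_zero]
  · exact hr.self12
  · intro a b c hab hbc
    exact hs a b c (hw a b c hab hbc)

theorem IsAlt.sub {x y : Ten ℂ} (hx : IsAlt x) (hy : IsAlt y) : IsAlt (x - y) := by
  convert hx.add (hy.smul (-1)) using 1
  module

theorem exists_act_eq_slice (n : ℕ) (hn : n ≤ 10) (c : Fin 4 → ℂ) {r : Ten ℂ} (hr : IsAlt r)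
    (hs : SuppGE gradWt (11 - n) r) : ∃ B : Mat ℂ, B.det = 1 ∧ (∀ i, i ≠ 0 → B i 0 = 0) ∧
      ∃ c', act B (slice c + r) = slice c' := by
  induction n generalizing c r with
  | zero =>
    refine ⟨1, Matrix.det_one, fun i hi => Matrix.one_apply_ne hi, c, ?_⟩
    rw [hr.eq_zero_of_suppGE (by simpa using hs), add_zero, act_one]
  | succ n ih =>
    have hs' : SuppGE gradWt (10 - n : ℤ) r := by
      convert hs using 1; push_cast; ring
    have hd : (10 - n : ℤ) ∈ [1, 2, 3, 4, 5, 6, 7, 8, 9, (10 : ℤ)] := by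
      simp only [List.mem_cons, List.not_mem_nil, or_false]
      omega
    obtain ⟨X, t, hX, ht⟩ := exists_elim hd hr hs'
    have hmono : ∀ i j : Fin 9, j ≤ i → gradWt i - gradWt j ≤ 0 := by decide
    have hX0 : ∀ i j : Fin 9, j ≤ i → X i j = 0 := fun i j hij =>
      hX i j (by have := hmono i j hij; omega)
    have hsl : SuppGE gradWt 0 (slice c + r) :=
      (suppGE_simple.add ((suppGE_tail c).mono (by omega))).add (hs'.mono (by omega))
    have hrem : SuppGE gradWt (11 - n) (act (1 - X) (slice c + r) - slice (c + t)) := by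
      have e : act (1 - X) (slice c + r) - slice (c + t) =
          (act (1 - X) (slice c + r) - (slice c + r) + der X (slice c + r)) +
          (r - der X (toTen simpleL) - tail t) + (-1 : ℂ) • der X (tail c) +
          (-1 : ℂ) • der X r := by
        simp only [slice, tail_add, map_add]
        module
      rw [e]
      refine (((hsl.act_one_sub (by omega) hX).mono (by omega)).add (ht.mono (by omega))).add
        ((((suppGE_tail c).der_of hX).smul _).mono (by omega)) |>.add
        (((hs'.der_of hX).smul _).mono (by omega))
    obtain ⟨B, hB, hB0, c', hc'⟩ := ih (by omega) (c + t)
      ((((isAlt_slice c).add hr).act (1 - X)).sub (isAlt_slice (c + t))) hrem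
    rw [add_sub_cancel] at hc'
    refine ⟨B * (1 - X), ?_, fun i hi => ?_, c', by rw [act_mul, hc']⟩
    · rw [Matrix.det_mul, hB, one_mul, Matrix.det_of_isUpperTriangular]
      · simp [hX0]
      · intro i j hij
        have hij' : j < i := hij
        simp [hX0 i j hij'.le, Matrix.one_apply_ne hij'.ne']
    · rw [Matrix.mul_apply]
      refine Finset.sum_eq_zero fun k _ => ?_
      by_cases hk : k = 0
      · rw [hk, hB0 i hi, zero_mul]
      · rw [Matrix.sub_apply, hX0 k 0 (Fin.zero_le k), Matrix.one_apply_ne hk, sub_zero, mul_zero]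

theorem IsNice.simple_ne_zero {y : Ten ℂ} (hn : IsNice y) (hy : IsAlt y) (hs : Supp gradZ y) :
    ∀ m ∈ simpleL, y m.2.1 m.2.2.1 m.2.2.2 ≠ 0 := by
  simp only [simpleL, List.forall_mem_cons]
  refine ⟨hn.ne_zero_of hy hs _ _ _ ![9, 6, 3, 3, 0, -3, -3, -6, -9] ?_ ?_ ?_,
    hn.ne_zero_of hy hs _ _ _ ![3, 3, 3, 0, 0, 0, -3, -3, -3] ?_ ?_ ?_,
    hn.ne_zero_of hy hs _ _ _ ![6, 3, 3, 0, 0, 0, -3, -3, -6] ?_ ?_ ?_,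
    hn.ne_zero_of hy hs _ _ _ ![5, 2, 2, 2, -1, -1, -1, -4, -4] ?_ ?_ ?_,
    hn.ne_zero_of hy hs _ _ _ ![4, 1, 1, 1, 1, -2, -2, -2, -2] ?_ ?_ ?_,
    hn.ne_zero_of hy hs _ _ _ ![7, 4, 1, 1, 1, -2, -2, -5, -5] ?_ ?_ ?_,
    hn.ne_zero_of hy hs _ _ _ ![8, 5, 2, 2, -1, -1, -4, -4, -7] ?_ ?_ ?_,
    hn.ne_zero_of hy hs _ _ _ ![2, 2, 2, -1, -1, -1, -1, -1, -1] ?_ ?_ ?_, by simp⟩ <;>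
    decide +kernel

theorem exists_torus (u : Fin 9 → Fin 9 → Fin 9 → ℂ)
    (hu : ∀ m ∈ simpleL, u m.2.1 m.2.2.1 m.2.2.2 ≠ 0) : ∃ t : Fin 9 → ℂ, (∀ i, t i ≠ 0) ∧
      ∀ m ∈ simpleL, t m.2.1 * t m.2.2.1 * t m.2.2.2 = u m.2.1 m.2.2.1 m.2.2.2 := by
  simp only [simpleL, List.forall_mem_cons] at hu ⊢
  obtain ⟨h058, h067, h138, h147, h156, h237, h246, h345, -⟩ := hu
  generalize u 0 5 8 = y058, u 0 6 7 = y067, u 1 3 8 = y138, u 1 4 7 = y147, u 1 5 6 = y156,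
    u 2 3 7 = y237, u 2 4 6 = y246, u 3 4 5 = y345 at *
  obtain ⟨α, hα⟩ : ∃ α, α = y138 * y067 / (y156 * y058) := ⟨_, rfl⟩
  have hα0 : α ≠ 0 := by rw [hα]; positivity
  obtain ⟨t2, ht2⟩ : ∃ t2, t2 = y237 / α := ⟨_, rfl⟩
  have ht20 : t2 ≠ 0 := by rw [ht2]; positivity
  obtain ⟨β, hβ⟩ : ∃ β, β = y147 / (y156 * y345) := ⟨_, rfl⟩
  have hβ0 : β ≠ 0 := by rw [hβ]; positivity
  obtain ⟨γ, hγ⟩ : ∃ γ, γ = y246 / (t2 * y345) := ⟨_, rfl⟩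
  have hγ0 : γ ≠ 0 := by rw [hγ]; positivity
  obtain ⟨t3, ht3⟩ := IsAlgClosed.exists_pow_nat_eq (α / (γ * β)) (n := 3) (by norm_num)
  have ht30 : t3 ≠ 0 := by
    rintro rfl
    have : α / (γ * β) ≠ 0 := by positivity
    exact this (by rw [← ht3]; ring)
  have hα' : α = t3 ^ 3 * (γ * β) := by rw [ht3]; field_simp
  have e237 : y237 = t2 * α := by rw [ht2]; field_simp
  have e147 : y147 = β * (y156 * y345) := by rw [hβ]; field_simp
  have e246 : y246 = γ * (t2 * y345) := by rw [hγ]; field_simp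
  have e138 : y138 = α * (y156 * y058) / y067 := by rw [hα]; field_simp
  clear hα hβ hγ ht2 ht3
  refine ⟨![y067 / ((t3 * γ) * (t3 ^ 2 * γ * β)), y156 / (t3 * γ), t2, t3, y345 / t3, 1, t3 * γ,
    t3 ^ 2 * γ * β, y058 / (y067 / ((t3 * γ) * (t3 ^ 2 * γ * β)))], ?_, ?_⟩
  · intro i
    fin_cases i <;> simp [*]
  · simp only [Matrix.cons_val]
    subst e237 e147 e246 e138 hα'
    refine ⟨?_, ?_, ?_, ?_, ?_, ?_, ?_, ?_, by simp⟩ <;> field_simp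

theorem act_diagonal (t : Fin 9 → ℂ) (x : Ten ℂ) (i j k : Fin 9) :
    act (Matrix.diagonal t) x i j k = t i * t j * t k * x i j k := by
  simp [act_apply, Matrix.diagonal_apply, mul_assoc]

theorem simple_spec : ∀ a b c : Fin 9, a < b → b < c → gradWt a + gradWt b + gradWt c = 0 →
    evalL simpleL a b c = 1 ∧ simpleL.contains (1, a, b, c) = true := by
  decide +kernel

/-- A nice tensor adapted to the standard flag can be moved to the slice, preserving the first
line of the flag and with prescribed determinant. -/
theorem exists_normal_form {x : Ten ℂ} (hx : IsAlt x) (hn : IsNice x) (h : SuppGE flagWt 0 x)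
    {δ : ℂ} (hδ : δ ≠ 0) :
    ∃ B : Mat ℂ, B.det = δ ∧ (∀ i, i ≠ 0 → B i 0 = 0) ∧ ∃ c, act B x = slice c := by
  obtain ⟨y, ⟨B, hB, hB0, rfl⟩, hy, hyn, hys⟩ := reduces_gradZ hx hn h
  have hne := hyn.simple_ne_zero hy hys
  set y := act B x with hydef
  obtain ⟨t, ht0, ht⟩ := exists_torus (fun a b c => (y a b c)⁻¹)
    fun m hm => inv_ne_zero (hne m hm)
  obtain ⟨w, hw⟩ : ∃ w, w = δ / (B.det * ∏ i, t i) := ⟨_, rfl⟩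
  have hprod : ∏ i, t i ≠ 0 := Finset.prod_ne_zero_iff.2 fun i _ => ht0 i
  have hw0 : w ≠ 0 := by rw [hw]; positivity
  let D : Mat ℂ := Matrix.diagonal fun i => t i * w ^ gradWt i
  have hD : D.det = (∏ i, t i) * w := by
    rw [Matrix.det_diagonal, Finset.prod_mul_distrib]
    congr 1
    have : ∀ s : Finset (Fin 9), ∏ i ∈ s, w ^ gradWt i = w ^ ∑ i ∈ s, gradWt i := fun s => by
      induction s using Finset.induction_on with
      | empty => simp
      | insert a s ha ih => rw [Finset.prod_insert ha, Finset.sum_insert ha, ih, zpow_add₀ hw0]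
    rw [this, show ∑ i, gradWt i = 1 by decide, zpow_one]
  have hz : IsAlt (act D y) := hy.act D
  have hr : SuppGE gradWt (11 - (10 : ℕ)) (act D y - slice 0) := by
    have hsl : (slice 0 : Ten ℂ) = toTen simpleL := by simp [slice, tail]
    refine suppGE_of_sorted (hz.sub (isAlt_slice 0)) fun a b c hab hbc habc => ?_
    rw [hsl, Pi.sub_apply, Pi.sub_apply, Pi.sub_apply, toTen_apply, act_diagonal]
    rcases lt_or_eq_of_le (show gradWt a + gradWt b + gradWt c ≤ 0 by norm_num at habc; omega)
      with h0 | h0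
    · have h1 := suppGE_simple a b c h0
      rw [toTen_apply] at h1
      rw [h1, hys a b c hab hbc (by simpa [gradZ] using h0)]
      ring
    · obtain ⟨h1, h2⟩ := simple_spec a b c hab hbc h0
      rw [List.contains_iff_mem] at h2
      have h3 := ht _ h2
      have h4 := hne _ h2
      have h5 : w ^ gradWt a * w ^ gradWt b * w ^ gradWt c = 1 := by
        rw [← zpow_add₀ hw0, ← zpow_add₀ hw0, h0, zpow_zero]
      simp only at h3 h4
      rw [h1, show t a * w ^ gradWt a * (t b * w ^ gradWt b) * (t c * w ^ gradWt c) =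
        t a * t b * t c * (w ^ gradWt a * w ^ gradWt b * w ^ gradWt c) by ring, h3, h5, mul_one,
        inv_mul_cancel₀ h4]
      simp
  obtain ⟨C, hC, hC0, c', hc'⟩ := exists_act_eq_slice 10 le_rfl 0 (hz.sub (isAlt_slice 0)) hr
  rw [add_sub_cancel] at hc'
  refine ⟨C * (D * B), ?_, fun i hi => ?_, c', ?_⟩
  · rw [Matrix.det_mul, Matrix.det_mul, hC, hD, hw]
    field_simp
  · have hDB : ∀ k, k ≠ 0 → (D * B) k 0 = 0 := fun k hk => by
      rw [Matrix.diagonal_mul, hB0 k hk, mul_zero]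
    rw [Matrix.mul_apply]
    refine Finset.sum_eq_zero fun k _ => ?_
    by_cases hk : k = 0
    · rw [hk, hC0 i hi, zero_mul]
    · rw [hDB k hk, mul_zero]
  · rw [act_mul, act_mul, hc']

end Slice

section PsiLists

variable {R : Type*} [CommRing R]

theorem psi_of_perm (τ : Perm (Fin 9)) (hτ : Perm.sign τ = -1) {α β γ α' β' γ' : Ten R}
    (h : ∀ σ : Fin 9 → Fin 9, α' (σ 0) (σ 1) (σ 2) * β' (σ 3) (σ 4) (σ 5) *
        γ' (σ 6) (σ 7) (σ 8) = α (σ (τ 0)) (σ (τ 1)) (σ (τ 2)) * β (σ (τ 3)) (σ (τ 4)) (σ (τ 5)) *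
        γ (σ (τ 6)) (σ (τ 7)) (σ (τ 8))) : psi α' β' γ' = -psi α β γ := by
  rw [psi_apply α', psi_apply α, ← Equiv.sum_comp (Equiv.mulRight τ) fun σ : Perm (Fin 9) =>
    ((Perm.sign σ : ℤ) : R) * (α (σ 0) (σ 1) (σ 2) * β (σ 3) (σ 4) (σ 5) * γ (σ 6) (σ 7) (σ 8)),
    ← Finset.sum_neg_distrib]
  refine Finset.sum_congr rfl fun σ _ => ?_
  rw [h]
  simp [hτ]

theorem psi_swap12 (α β γ : Ten R) : psi (fun i j k => α j i k) β γ = -psi α β γ := by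
  let τ : Perm (Fin 9) := swap 0 1
  refine psi_of_perm τ (by decide) fun σ => ?_
  rw [show τ 0 = 1 by decide,
      show τ 1 = 0 by decide,
      show τ 2 = 2 by decide,
      show τ 3 = 3 by decide,
      show τ 4 = 4 by decide,
      show τ 5 = 5 by decide,
      show τ 6 = 6 by decide,
      show τ 7 = 7 by decide,
      show τ 8 = 8 by decide]

theorem psi_swap23 (α β γ : Ten R) : psi (fun i j k => α i k j) β γ = -psi α β γ := by
  let τ : Perm (Fin 9) := swap 1 2
  refine psi_of_perm τ (by decide) fun σ => ?_
  rw [show τ 0 = 0 by decide,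
      show τ 1 = 2 by decide,
      show τ 2 = 1 by decide,
      show τ 3 = 3 by decide,
      show τ 4 = 4 by decide,
      show τ 5 = 5 by decide,
      show τ 6 = 6 by decide,
      show τ 7 = 7 by decide,
      show τ 8 = 8 by decide]

theorem psi_swap_right (α β γ : Ten R) : psi α γ β = -psi α β γ := by
  let τ : Perm (Fin 9) := swap 3 6 * swap 4 7 * swap 5 8
  refine psi_of_perm τ (by decide) fun σ => ?_
  rw [show τ 0 = 0 by decide,
      show τ 1 = 1 by decide,
      show τ 2 = 2 by decide,
      show τ 3 = 6 by decide,
      show τ 4 = 7 by decide,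
      show τ 5 = 8 by decide,
      show τ 6 = 3 by decide,
      show τ 7 = 4 by decide,
      show τ 8 = 5 by decide]
  ring

theorem psi_mono_left (a b c : Fin 9) (β γ : Ten R) :
    psi (mono a b c) β γ = 6 * psi (delta a b c) β γ := by
  have h12 : ∀ a b c, psi (delta b a c) β γ = -psi (delta a b c) β γ := fun a b c => by
    rw [← psi_swap12]
    congr 3
    ext i j k
    simp only [delta]
    congr 1
    exact propext (by tauto)
  have h23 : ∀ a b c, psi (delta a c b) β γ = -psi (delta a b c) β γ := fun a b c => by
    rw [← psi_swap23]
    congr 3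
    ext i j k
    simp only [delta]
    congr 1
    exact propext (by tauto)
  have e1 := h12 a b c
  have e2 : psi (delta a c b) β γ = _ := h23 a b c
  have e3 : psi (delta b c a) β γ = _ := h23 b a c
  have e4 : psi (delta c a b) β γ = _ := h12 a c b
  have e5 : psi (delta c b a) β γ = _ := h12 b c a
  rw [mono_eq]
  simp only [map_add, map_sub, LinearMap.add_apply, LinearMap.sub_apply]
  linear_combination -3 * e1 - 2 * e2 + 2 * e3 + e4 - e5

/-- The sign of the rearrangement sorting a list, zero if the list has a repeated entry. -/
def sgnL : List (Fin 9) → ℤ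
  | [] => 1
  | a :: l => l.foldr (fun b s => (if a < b then 1 else if b < a then -1 else 0) * s) 1 * sgnL l

theorem sgnL_ofFn {n : ℕ} (t : Fin n → Fin 9) : sgnL (List.ofFn t) =
    ∏ i, ∏ j ∈ Finset.Ioi i, if t i < t j then 1 else if t j < t i then -1 else 0 := by
  induction n with
  | zero => simp [sgnL]
  | succ n ih =>
    rw [List.ofFn_succ, sgnL, ih, Fin.prod_univ_succ, Fin.prod_Ioi_zero]
    simp only [Fin.prod_Ioi_succ]
    congr 1
    rw [← List.prod_ofFn, List.prod_eq_foldr, ← List.foldr_map, List.map_ofFn]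
    rfl

theorem det_submatrix_one (t : Fin 9 → Fin 9) :
    ((1 : Mat R).submatrix id t).det = sgnL (List.ofFn t) := by
  rw [sgnL_ofFn]
  by_cases ht : Function.Injective t
  · obtain ⟨σ, rfl⟩ : ∃ σ : Perm (Fin 9), t = σ :=
      ⟨Equiv.ofBijective t (Finite.injective_iff_bijective.1 ht), rfl⟩
    rw [Matrix.det_permute', Matrix.det_one, mul_one, Perm.sign_eq_prod_prod_Ioi]
    push_cast
    refine Finset.prod_congr rfl fun i _ => Finset.prod_congr rfl fun j hj => ?_
    have hij : σ i ≠ σ j := fun h => (Finset.mem_Ioi.1 hj).ne (σ.injective h)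
    rcases lt_or_gt_of_ne hij with h | h
    · simp [h]
    · simp [h, h.not_gt]
  · rw [Function.Injective] at ht
    push Not at ht
    obtain ⟨i, j, h, hij⟩ := ht
    rw [Matrix.det_zero_of_column_eq hij (fun k => by
      rw [Matrix.submatrix_apply, Matrix.submatrix_apply, h])]
    wlog hlt : i < j generalizing i j
    · exact this j i h.symm hij.symm (lt_of_le_of_ne (not_lt.1 hlt) hij.symm)
    rw [Finset.prod_eq_zero (Finset.mem_univ i), Int.cast_zero]
    exact Finset.prod_eq_zero (Finset.mem_Ioi.2 hlt) (by simp [h])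

theorem psi_mono (a b c d e f p q r : Fin 9) :
    psi (mono a b c : Ten R) (mono d e f) (mono p q r) =
      216 * (sgnL [a, b, c, d, e, f, p, q, r] : R) := by
  have h : psi (delta a b c : Ten R) (delta d e f) (delta p q r) =
      (sgnL [a, b, c, d, e, f, p, q, r] : R) := by
    have h := psi_rankOne (1 : Mat R) ![a, b, c, d, e, f, p, q, r]
    rw [det_submatrix_one] at h
    rw [delta_eq, delta_eq, delta_eq]
    exact h
  rw [psi_mono_left, psi_swap, psi_mono_left, psi_swap_right, psi_swap, psi_swap_right,
    psi_mono_left, psi_swap, psi_swap_right, psi_swap, psi_swap, h]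
  ring

/-- Whether two index triples are disjoint. -/
def disjT (m n : Fin 9 × Fin 9 × Fin 9) : Bool :=
  m.1 != n.1 && m.1 != n.2.1 && m.1 != n.2.2 && m.2.1 != n.1 && m.2.1 != n.2.1 &&
    m.2.1 != n.2.2 && m.2.2 != n.1 && m.2.2 != n.2.1 && m.2.2 != n.2.2

/-- The trilinear form on lists, up to a factor `216`. -/
def psiL (l m n : TenList) : ℤ :=
  (l.map fun u => (m.map fun v => if disjT u.2 v.2 then (n.map fun w =>
    if disjT u.2 w.2 && disjT v.2 w.2 then u.1 * (v.1 * (w.1 *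
      sgnL [u.2.1, u.2.2.1, u.2.2.2, v.2.1, v.2.2.1, v.2.2.2, w.2.1, w.2.2.1, w.2.2.2]))
    else 0).sum else 0).sum).sum

theorem sgnL_eq_zero {a b c d e f p q r : Fin 9}
    (h : ¬(disjT (a, b, c) (d, e, f) = true ∧ disjT (a, b, c) (p, q, r) = true ∧
      disjT (d, e, f) (p, q, r) = true)) : sgnL [a, b, c, d, e, f, p, q, r] = 0 := by
  by_contra h0
  apply h
  have hne : ∀ x y : Fin 9, (if x < y then (1 : ℤ) else if y < x then -1 else 0) = 0 ↔ x = y :=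
    fun x y => by
      rcases lt_trichotomy x y with h | h | h
      · simp [h, h.ne]
      · simp [h]
      · simp [h, h.not_gt, h.ne']
  simp only [sgnL, List.foldr, mul_eq_zero, hne, one_ne_zero, or_false, not_or] at h0
  simp only [disjT, Bool.and_eq_true, bne_iff_ne]
  tauto

theorem psi_toTen (l m n : TenList) :
    psi (toTen l : Ten R) (toTen m) (toTen n) = 216 * (psiL l m n : R) := by
  have h3 : ∀ (u v : ℤ × Fin 9 × Fin 9 × Fin 9), psi (mono u.2.1 u.2.2.1 u.2.2.2 : Ten R)
      (mono v.2.1 v.2.2.1 v.2.2.2) (toTen n) * (u.1 * v.1 : R) = 216 *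
      ((if disjT u.2 v.2 then (n.map fun w =>
        if disjT u.2 w.2 && disjT v.2 w.2 then u.1 * (v.1 * (w.1 *
        sgnL [u.2.1, u.2.2.1, u.2.2.2, v.2.1, v.2.2.1, v.2.2.2, w.2.1, w.2.2.1, w.2.2.2]))
        else 0).sum else 0 : ℤ) : R) := fun u v => by
    induction n with
    | nil => simp [toTen_nil]
    | cons w n ih =>
      rw [toTen_cons, map_add, add_mul, ih, map_smul, psi_mono, List.map_cons, List.sum_cons,
        smul_eq_mul]
      by_cases h : disjT u.2 v.2 = true
      · rw [if_pos h, if_pos h, Int.cast_add, mul_add]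
        congr 1
        split_ifs with h'
        · push_cast
          ring
        · rw [sgnL_eq_zero (fun hh => h' (by simp [hh.2.1, hh.2.2]))]
          simp
      · rw [if_neg h, if_neg h, sgnL_eq_zero (fun hh => h hh.1)]
        simp
  have h2 : ∀ u : ℤ × Fin 9 × Fin 9 × Fin 9, psi (mono u.2.1 u.2.2.1 u.2.2.2 : Ten R)
      (toTen m) (toTen n) * (u.1 : R) = 216 * (psiL [u] m n : R) := fun u => by
    simp only [psiL, List.map_cons, List.map_nil, List.sum_cons, List.sum_nil, add_zero]
    induction m with
    | nil => simp [toTen_nil]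
    | cons v m ih =>
      rw [toTen_cons, map_add, LinearMap.add_apply, add_mul, ih, List.map_cons, List.sum_cons,
        Int.cast_add, mul_add, ← h3, map_smul, LinearMap.smul_apply, smul_eq_mul]
      ring
  induction l with
  | nil => simp [toTen_nil, psiL]
  | cons u l ih =>
    have hc : psiL (u :: l) m n = psiL [u] m n + psiL l m n := by
      simp only [psiL, List.map_cons, List.map_nil, List.sum_cons, List.sum_nil, add_zero]
    rw [toTen_cons, map_add, LinearMap.add_apply, LinearMap.add_apply, ih, hc, Int.cast_add,
      mul_add, ← h2, map_smul, LinearMap.smul_apply, LinearMap.smul_apply, smul_eq_mul]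
    ring

end PsiLists

section Invariants

variable {R : Type*} [CommRing R]

/-- The matrix of `tee x`. -/
def teeM (x : Ten R) : Matrix (Fin 9 × Fin 9) (Fin 9 × Fin 9) R :=
  Matrix.of fun p q =>
    psi x (der (Matrix.single q.1 q.2 1) x) (der (Matrix.single p.2 p.1 1) x)

/-- The traces of the powers of `tee x`. -/
def inv (k : ℕ) (x : Ten R) : R := Matrix.trace (teeM x ^ k)

theorem toMatrix_tee (x : Ten R) :
    LinearMap.toMatrix (Matrix.stdBasis R (Fin 9) (Fin 9)) (Matrix.stdBasis R (Fin 9) (Fin 9))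
      (tee x) = teeM x := by
  ext p q
  rw [LinearMap.toMatrix_apply, Matrix.stdBasis_eq_single, Matrix.stdBasis]
  rfl

theorem inv_eq_trace (k : ℕ) (x : Ten R) : inv k x = LinearMap.trace R (Mat R) (tee x ^ k) := by
  rw [LinearMap.trace_eq_matrix_trace R (Matrix.stdBasis R (Fin 9) (Fin 9)),
    ← LinearMap.toMatrix_pow, toMatrix_tee, inv]

theorem inv_act {g h : Mat R} (gh : g * h = 1) (hg : h * g = 1) (k : ℕ) (x : Ten R) :
    inv k (act g x) = g.det ^ k * inv k x := by
  let e : Mat R ≃ₗ[R] Mat R := LinearEquiv.ofLinearMap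
    (LinearMap.mulLeft R g ∘ₗ LinearMap.mulRight R h)
    (LinearMap.mulLeft R h ∘ₗ LinearMap.mulRight R g)
    (by ext1 X; simp [mul_assoc, ← mul_assoc g, gh])
    (by ext1 X; simp [mul_assoc, ← mul_assoc h, hg])
  have he : tee (act g x) = g.det • e.conj (tee x) := by
    refine LinearMap.ext fun Y => ?_
    have h1 := tee_act gh hg x (h * Y * g)
    have h2 : g * (h * Y * g) * h = Y := by
      rw [mul_assoc h, ← mul_assoc g, gh, one_mul, mul_assoc, gh, mul_one]
    rw [h2] at h1
    rw [h1, LinearMap.smul_apply, LinearEquiv.conj_apply_apply]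
    simp [e, mul_assoc]
  have hp : tee (act g x) ^ k = g.det ^ k • e.conj (tee x ^ k) := by
    rw [he, smul_pow]
    congr 1
    induction k with
    | zero => simp [Module.End.one_eq_id, LinearEquiv.conj_id]
    | succ k ih => rw [pow_succ, ih, pow_succ, Module.End.mul_eq_comp, Module.End.mul_eq_comp,
        LinearEquiv.conj_comp]
  rw [inv_eq_trace, inv_eq_trace, hp, map_smul, LinearMap.trace_conj', smul_eq_mul]

variable {S : Type*} [CommRing S]

/-- Transporting a tensor along a ring homomorphism. -/
def mapTen (φ : R →+* S) (x : Ten R) : Ten S := fun i j k => φ (x i j k)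

theorem psi_mapTen (φ : R →+* S) (α β γ : Ten R) :
    psi (mapTen φ α) (mapTen φ β) (mapTen φ γ) = φ (psi α β γ) := by
  simp only [psi_apply, map_sum, map_mul, map_intCast, mapTen]

theorem der_single_mapTen (φ : R →+* S) (k l : Fin 9) (x : Ten R) :
    der (Matrix.single k l 1) (mapTen φ x) = mapTen φ (der (Matrix.single k l 1) x) := by
  ext a b c
  simp only [der_eq, Pi.add_apply, slotA_apply, slotB_apply, slotC_apply, mapTen, map_add,
    map_sum, map_mul, Matrix.single_apply, apply_ite φ, map_one, map_zero]

theorem teeM_mapTen (φ : R →+* S) (x : Ten R) : teeM (mapTen φ x) = (teeM x).map φ := by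
  ext p q
  simp only [teeM, Matrix.of_apply, Matrix.map_apply, der_single_mapTen, psi_mapTen]

theorem inv_mapTen (φ : R →+* S) (k : ℕ) (x : Ten R) : inv k (mapTen φ x) = φ (inv k x) := by
  rw [inv, inv, teeM_mapTen, ← RingHom.mapMatrix_apply, ← map_pow, RingHom.mapMatrix_apply,
    Matrix.trace, Matrix.trace, map_sum]
  rfl

theorem mapTen_mono (φ : R →+* S) (a b c : Fin 9) : mapTen φ (mono a b c) = mono a b c := by
  ext i j k
  simp [mapTen, mono]

theorem mapTen_slice (φ : R →+* S) (c : Fin 4 → R) :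
    mapTen φ (slice c) = slice fun i => φ (c i) := by
  have hadd : ∀ x y : Ten R, mapTen φ (x + y) = mapTen φ x + mapTen φ y := fun x y => by
    ext; simp [mapTen]
  have hsmul : ∀ (r : R) (x : Ten R), mapTen φ (r • x) = φ r • mapTen φ x := fun r x => by
    ext; simp [mapTen]
  have hT : ∀ L : TenList, mapTen φ (toTen L) = toTen L := fun L => by
    induction L with
    | nil => ext; simp [mapTen, toTen_nil]
    | cons m L ih => rw [toTen_cons, toTen_cons, hadd, hsmul, ih, mapTen_mono, map_intCast]
  simp only [slice, tail, hadd, hsmul, hT, mapTen_mono]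

/-- The invariants of the slice as polynomials. -/
def invPoly (k : ℕ) : MvPolynomial (Fin 4) ℂ := inv k (slice MvPolynomial.X)

theorem eval_invPoly (k : ℕ) (c : Fin 4 → ℂ) :
    MvPolynomial.eval c (invPoly k) = inv k (slice c) := by
  rw [invPoly, ← inv_mapTen, mapTen_slice]
  simp

/-- The weights of the coordinates of the slice. -/
def sliceWt : Fin 4 → ℕ := ![4, 6, 8, 10]

theorem act_torus_slice {z : ℂ} (hz : z ≠ 0) (c : Fin 4 → ℂ) :
    act (Matrix.diagonal fun i => z ^ gradWt i) (slice c) =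
      slice fun i => z ^ sliceWt i * c i := by
  have h : ∀ a b d : Fin 9, act (Matrix.diagonal fun i => z ^ gradWt i) (mono a b d) =
      z ^ (gradWt a + gradWt b + gradWt d) • mono a b d := fun a b d => by
    ext i j k
    rw [act_diagonal, Pi.smul_apply, Pi.smul_apply, Pi.smul_apply, smul_eq_mul]
    by_cases hm : gradWt i + gradWt j + gradWt k = gradWt a + gradWt b + gradWt d
    · rw [← hm, zpow_add₀ hz, zpow_add₀ hz]
    · rcases lt_or_gt_of_ne hm with h | h
      · rw [suppGE_mono gradWt a b d i j k h, mul_zero, mul_zero]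
      · have h' := suppGE_mono (-gradWt) a b d i j k (by simp only [Pi.neg_apply]; omega)
        rw [h', mul_zero, mul_zero]
  have h0 : ∀ L : TenList, (∀ m ∈ L, gradWt m.2.1 + gradWt m.2.2.1 + gradWt m.2.2.2 = 0) →
      act (Matrix.diagonal fun i => z ^ gradWt i) (toTen L) = toTen L := fun L hL => by
    induction L with
    | nil => simp [toTen_nil]
    | cons m L ih =>
      rw [toTen_cons, map_add, map_smul, h, hL m (by simp), zpow_zero, one_smul,
        ih fun m' hm' => hL m' (by simp [hm'])]
  simp only [slice, tail, map_add, map_smul, h]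
  rw [h0 simpleL (by decide), show gradWt 0 + gradWt 3 + gradWt 6 = (4 : ℕ) by decide,
    show gradWt 0 + gradWt 3 + gradWt 4 = (6 : ℕ) by decide,
    show gradWt 0 + gradWt 2 + gradWt 3 = (8 : ℕ) by decide,
    show gradWt 0 + gradWt 1 + gradWt 2 = (10 : ℕ) by decide]
  simp only [zpow_natCast, smul_smul, sliceWt, Matrix.cons_val]
  simp only [mul_comm]

theorem inv_torus_slice (k : ℕ) {z : ℂ} (hz : z ≠ 0) (c : Fin 4 → ℂ) :
    inv k (slice fun i => z ^ sliceWt i * c i) = z ^ k * inv k (slice c) := by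
  have hd : ∀ s t : Fin 9 → ℂ, (∀ i, s i * t i = 1) →
      Matrix.diagonal s * Matrix.diagonal t = 1 := fun s t h => by
    rw [Matrix.diagonal_mul_diagonal, ← Matrix.diagonal_one]
    exact congrArg _ (funext h)
  rw [← act_torus_slice hz, inv_act (h := Matrix.diagonal fun i => (z ^ gradWt i)⁻¹)
    (hd _ _ fun i => mul_inv_cancel₀ (zpow_ne_zero _ hz))
    (hd _ _ fun i => inv_mul_cancel₀ (zpow_ne_zero _ hz)), Matrix.det_diagonal]
  congr 2
  simp only [Fin.prod_univ_succ, gradWt]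
  simp
  field_simp

theorem coeff_bind_scale {σ : Type*} (r : σ → ℂ) (p : MvPolynomial σ ℂ) (m : σ →₀ ℕ) :
    (MvPolynomial.bind₁ (fun i => MvPolynomial.C (r i) * MvPolynomial.X i) p).coeff m =
      (m.prod fun i n => r i ^ n) * p.coeff m := by
  classical
  induction p using MvPolynomial.induction_on' with
  | monomial u a =>
    have h : MvPolynomial.bind₁ (fun i => MvPolynomial.C (r i) * MvPolynomial.X i)
        (MvPolynomial.monomial u a) = MvPolynomial.C (u.prod fun i n => r i ^ n) *
          MvPolynomial.monomial u a := by
      rw [MvPolynomial.bind₁_monomial, MvPolynomial.monomial_eq]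
      simp only [mul_pow, Finsupp.prod, Finset.prod_mul_distrib, map_prod, map_pow]
      ring
    rw [h, MvPolynomial.coeff_C_mul, MvPolynomial.coeff_monomial]
    split_ifs with hu
    · rw [hu]
    · simp
  | add p q hp hq => rw [map_add, MvPolynomial.coeff_add, hp, hq, MvPolynomial.coeff_add, mul_add]

theorem weight_eq_of_coeff_ne_zero {k : ℕ} {m : Fin 4 →₀ ℕ} (hm : (invPoly k).coeff m ≠ 0) :
    ∑ i, sliceWt i * m i = k := by
  have h : MvPolynomial.bind₁ (fun i => MvPolynomial.C ((2 : ℂ) ^ sliceWt i) * MvPolynomial.X i)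
      (invPoly k) = MvPolynomial.C (2 ^ k) * invPoly k := by
    refine MvPolynomial.funext fun c => ?_
    rw [map_mul, MvPolynomial.eval_C, eval_invPoly, ← inv_torus_slice k two_ne_zero,
      ← eval_invPoly, ← MvPolynomial.coe_aeval_eq_eval, RingHom.coe_coe, MvPolynomial.aeval_bind₁]
    simp
  have h1 := congrArg (MvPolynomial.coeff m) h
  rw [coeff_bind_scale, MvPolynomial.coeff_C_mul] at h1
  have h2 := mul_right_cancel₀ hm h1
  rw [Finsupp.prod_fintype _ _ (by simp)] at h2
  simp only [← pow_mul] at h2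
  rw [Finset.prod_pow_eq_pow_sum] at h2
  exact Nat.pow_right_injective le_rfl (by exact_mod_cast h2)

theorem coeff_mul_sub (i : Fin 4) {c c' : Fin 4 → ℂ} (h : ∀ j < i, c j = c' j) :
    (invPoly (sliceWt i)).coeff (Finsupp.single i 1) * (c i - c' i) =
      inv (sliceWt i) (slice c) - inv (sliceWt i) (slice c') := by
  rw [← eval_invPoly, ← eval_invPoly, MvPolynomial.eval_eq', MvPolynomial.eval_eq',
    ← Finset.sum_sub_distrib]
  rw [Finset.sum_eq_single (Finsupp.single i 1)]
  · rw [← mul_sub, Fintype.prod_eq_single i, Fintype.prod_eq_single i]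
    · simp
    · intro j hj; simp [hj.symm]
    · intro j hj; simp [hj.symm]
  · intro m hm hmi
    rw [← mul_sub]
    have hw := weight_eq_of_coeff_ne_zero (MvPolynomial.mem_support_iff.1 hm)
    have hz : ∀ j, m j ≠ 0 → j < i := by
      intro j hj
      by_contra hlt
      apply hmi
      have h4 : sliceWt 0 * m 0 + sliceWt 1 * m 1 + sliceWt 2 * m 2 + sliceWt 3 * m 3 =
          sliceWt i := by rw [← hw, Fin.sum_univ_four]
      simp only [sliceWt, Matrix.cons_val] at h4
      ext k
      rw [Finsupp.single_apply]
      fin_cases i <;> fin_cases j <;> fin_cases k <;> simp at h4 hj hlt ⊢ <;> omega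
    rw [sub_eq_zero.2 (Finset.prod_congr rfl fun j _ => ?_), mul_zero]
    by_cases hj : m j = 0
    · simp [hj]
    · rw [h j (hz j hj)]
  · intro hm
    rw [MvPolynomial.notMem_support_iff.1 hm]
    simp

theorem inv_slice_zero (i : Fin 4) : inv (sliceWt i) (slice (0 : Fin 4 → ℂ)) = 0 := by
  rw [← eval_invPoly, MvPolynomial.eval_zero, MvPolynomial.constantCoeff_eq]
  by_contra h
  have := weight_eq_of_coeff_ne_zero h
  revert this
  fin_cases i <;> simp [sliceWt]

theorem eq_of_act_slice {c c' : Fin 4 → ℂ} {g h : Mat ℂ} (gh : g * h = 1) (hg : h * g = 1)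
    (hdet : g.det = 1) (hact : act g (slice c) = slice c')
    (hne : ∀ i, inv (sliceWt i) (slice (Pi.single i (1 : ℂ))) ≠ 0) : c = c' := by
  have key : ∀ i, (∀ j < i, c j = c' j) → c i = c' i := fun i hi => by
    have h1 := coeff_mul_sub i hi
    rw [← hact, inv_act gh hg, hdet, one_pow, one_mul, sub_self] at h1
    have h2 := coeff_mul_sub i (c := Pi.single i 1) (c' := 0) fun j hj => by simp [hj.ne]
    rw [inv_slice_zero, sub_zero, Pi.single_eq_same, Pi.zero_apply, sub_zero, mul_one] at h2
    rw [h2] at h1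
    exact sub_eq_zero.1 ((mul_eq_zero.1 h1).resolve_left (hne i))
  funext i
  induction i using WellFoundedLT.induction with
  | ind i ih => exact key i ih

end Invariants

section TraceTables

def opTable0 : List (List (List (ℕ × ℤ))) :=
  [[[(2, 2), (19, 2), (29, -2), (39, 2), (49, 1), (59, -1), (69, 2), (79, 1)], [(11, -6), (31, -3), (41, -3), (61, -3), (71, -3)], [(1, 2), (32, 3), (62, 3)], [(2, -2), (13, -3), (23, 3), (33, -6), (43, 3), (53, 3)], [(3, 2), (14, -3), (34, 3), (44, -6)], [(4, 1), (35, 3)], [(5, -1), (16, -3), (26, 3)], [(6, 2), (17, -3)], [(7, 1)]],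
   [[(11, -2), (18, -2), (31, -3), (47, 3), (57, -3), (61, -3), (67, 3)], [(2, -2), (29, 1), (39, -1), (49, 1), (59, 2), (69, -1), (79, 1)], [(0, -2), (20, 2), (30, 1), (40, 1), (50, -2), (60, 1), (70, 1), (80, -2)], [(4, -3), (11, 1), (21, 1), (35, -6), (51, 3), (71, 3)], [(12, -1), (22, 1), (52, -3), (62, 3)], [(2, 3), (13, 1), (23, -2), (33, 3), (43, -3)], [(3, -3), (7, -3), (14, 2), (24, 1), (44, 3)], [(4, 3), (15, -1), (25, 1), (35, 3)], [(16, 1), (26, -2)]],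
   [[(0, -2), (10, 2), (27, 2), (30, -1), (40, 2), (46, -3), (50, -1), (60, -1), (66, 3), (70, 2), (76, -3), (80, -1)], [(1, 2), (9, 6), (28, -1), (32, 3), (48, 3), (58, 3), (62, 3), (68, -3), (78, 3)], [(19, -2), (39, -1), (49, -2), (59, -1), (69, -1), (79, -2)], [(0, 2), (3, -1), (10, -1), (14, 3), (30, -2), (34, -6), (40, -1), (44, 3), (50, -1), (60, 2), (70, 2), (80, -1)], [(4, 2), (21, -1), (31, -1), (35, 3), (51, -3), (71, -3)], [(1, -3), (5, -1), (12, 3), (22, -2), (32, -1), (42, -3), (52, 6), (62, -3)], [(6, -1), (13, 3), (17, 3), (23, -1), (33, 2), (53, -3)], [(3, 3), (7, 2), (14, -3), (24, -1), (34, 2), (44, -3)], [(4, -3), (8, -1), (15, 3), (25, -2), (35, -1)]],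
   [[(29, 1), (36, -2), (55, 3), (65, -3)], [(37, 1), (47, -3)], [(28, -1), (38, 1)], [(2, 1), (19, -1), (29, 2), (49, -2), (59, 2), (69, -1), (79, 1)], [(0, -2), (10, 1), (20, 1), (40, 2), (50, -2), (60, 1), (70, 1), (80, -2)], [(11, -3), (31, -2), (41, -2), (61, -3)], [(1, 3), (32, 2), (42, 1), (52, -3), (62, 6)], [(2, -3), (33, -1), (43, 1)], [(34, 1), (44, -2)]],
   [[(28, 3), (38, -2), (45, -1), (64, -3), (74, 3)], [(27, 3), (46, -1), (56, -3)], [(37, -1), (47, 2)], [(1, 3), (9, 3), (32, 6), (38, 1), (48, 2), (62, 3), (68, -3), (78, 3)], [(2, -2), (19, -1), (29, 1), (39, -2), (59, -1), (69, -1), (79, -2)], [(0, -1), (10, -1), (20, 2), (30, 2), (50, -2), (60, -1), (70, 2), (80, -1)], [(11, -3), (35, 3), (41, -1), (51, -1), (71, -3)], [(1, -3), (32, -3), (42, -1), (52, 2), (62, -3)], [(2, 3), (33, 3), (43, -2), (53, -1)]],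
   [[(47, 1), (54, 1)], [(29, -3), (36, 3), (55, -2), (65, 3)], [(27, -3), (46, 2), (56, 1)], [(11, -3), (18, -3), (31, -6), (47, 1), (57, -2), (61, -3), (67, 3), (71, -3)], [(9, 3), (48, 2), (58, 1), (62, 3)], [(2, 1), (19, 2), (29, 1), (39, 2), (49, 2), (69, 2), (79, 1)], [(0, 1), (10, -2), (20, 1), (30, -2), (34, -3), (40, 1), (44, 3), (60, 2), (70, 1), (80, -2)], [(11, 3), (31, 3), (35, -3), (51, 2), (61, 1), (71, 6)], [(52, 1), (62, -2)]],
   [[(56, 1), (63, -2)], [(64, 1), (74, -3)], [(55, -1), (65, 1)], [(27, 6), (46, -3), (56, -2), (66, 1), (76, -3)], [(47, 3), (57, -1), (67, 1)], [(28, -3), (38, 3), (58, 1), (68, -2)], [(2, 1), (19, -1), (29, -2), (39, -1), (49, 1), (59, -2), (79, -2)], [(0, -2), (10, 1), (20, 1), (30, 1), (40, 1), (50, -2), (70, 2), (80, -2)], [(11, -3), (31, -3), (61, -2), (71, -2)]],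
   [[(55, 3), (65, -2), (72, -1)], [(54, 3), (73, -1)], [(64, -1), (74, 2)], [(29, 6), (36, -3), (59, 3), (65, -2), (75, -1)], [(27, -3), (46, 3), (66, -1), (76, 2)], [(37, 3), (47, -6), (57, 3), (67, -2), (77, -1)], [(1, 3), (9, 3), (32, 3), (48, 3), (62, 6), (68, -1), (78, 2)], [(2, -2), (19, -1), (29, -2), (39, -1), (49, -2), (59, -1), (69, -2)], [(0, -1), (10, -1), (20, 2), (30, -1), (40, 2), (50, -1), (60, 2), (80, -2)]],
   [[(74, 1)], [(56, -3), (63, 3)], [(54, -3), (73, 2)], [(28, 6), (38, -3), (45, -3), (58, -3), (64, -3), (68, 3), (74, 1)], [(29, -3), (36, 6), (55, -3), (59, -3), (65, 3), (75, 2)], [(27, -3), (56, 3), (76, 1)], [(11, -3), (18, -3), (31, -3), (37, -3), (41, -3), (47, 3), (57, -6), (61, -6), (67, 3), (77, 2)], [(9, 3), (28, -3), (32, 3), (38, 3), (58, 3), (68, -6), (78, 2)], [(2, 1), (19, 2), (29, 1), (39, 2), (49, 1), (59, 2), (69, 2), (79, 2)]]]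

def opTable1 : List (List (List (ℕ × ℤ))) :=
  [[[(19, 2), (29, -2), (35, 1), (39, 2), (49, 1), (59, -1), (69, 2), (79, 1)], [(11, -6), (31, -3), (41, -3), (61, -3), (71, -3)], [(1, 2), (32, 3), (62, 3)], [(2, -2), (8, 1), (13, -3), (23, 3), (33, -6), (43, 3), (53, 3)], [(3, 2), (14, -3), (34, 3), (44, -6)], [(4, 1), (35, 3)], [(5, -1), (16, -3), (26, 3)], [(6, 2), (17, -3)], [(7, 1)]],
   [[(2, 6), (18, -2), (33, 3), (43, -3), (47, 3), (57, -3), (67, 3)], [(29, 1), (35, -2), (39, -1), (49, 1), (59, 2), (69, -1), (79, 1)], [(0, -2), (20, 2), (30, 1), (40, 1), (50, -2), (60, 1), (70, 1), (80, -2)], [(6, 3), (11, 1), (17, -2), (21, 1), (51, 3), (71, 3)], [(7, -3), (12, -1), (22, 1), (52, -3), (62, 3)], [(2, 3), (13, 1), (23, -2), (33, 3), (43, -3)], [(3, -3), (14, 2), (24, 1), (44, 3)], [(4, 3), (15, -1), (25, 1), (35, 3)], [(16, 1), (26, -2)]],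
   [[(1, -6), (27, 2), (32, -3), (42, -3), (46, -3), (52, 3), (62, -3), (66, 3), (76, -3)], [(9, 6), (28, -1), (34, -3), (44, 3), (48, 3), (58, 3), (68, -3), (78, 3)], [(19, -2), (35, 1), (39, -1), (49, -2), (59, -1), (69, -1), (79, -2)], [(0, 2), (5, -3), (10, -1), (16, -3), (26, 1), (30, -2), (40, -1), (50, -1), (60, 2), (70, 2), (80, -1)], [(6, -3), (17, 3), (21, -1), (31, -1), (51, -3), (71, -3)], [(1, -3), (7, 3), (12, 3), (22, -2), (32, -1), (42, -3), (52, 6), (62, -3)], [(8, -3), (13, 3), (23, -1), (33, 2), (53, -3)], [(3, 3), (14, -3), (24, -1), (34, 2), (44, -3)], [(4, -3), (15, 3), (25, -2), (35, -1)]],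
   [[(36, -2), (55, 3), (65, -3)], [(37, 1), (47, -3)], [(28, -1), (38, 1)], [(19, -1), (29, 2), (35, 2), (49, -2), (59, 2), (69, -1), (79, 1)], [(0, -2), (10, 1), (20, 1), (40, 2), (50, -2), (60, 1), (70, 1), (80, -2)], [(11, -3), (31, -2), (41, -2), (61, -3)], [(1, 3), (32, 2), (42, 1), (52, -3), (62, 6)], [(2, -3), (33, -1), (43, 1)], [(34, 1), (44, -2)]],
   [[(45, -1), (64, -3), (74, 3)], [(27, 3), (46, -1), (56, -3)], [(37, -1), (47, 2)], [(9, 3), (38, 1), (44, 1), (48, 2), (68, -3), (78, 3)], [(19, -1), (29, 1), (35, 1), (39, -2), (59, -1), (69, -1), (79, -2)], [(0, -1), (10, -1), (20, 2), (30, 2), (50, -2), (60, -1), (70, 2), (80, -1)], [(11, -3), (41, -1), (51, -1), (71, -3)], [(1, -3), (32, -3), (42, -1), (52, 2), (62, -3)], [(2, 3), (33, 3), (43, -2), (53, -1)]],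
   [[(29, 3), (54, 1)], [(36, 3), (55, -2), (65, 3)], [(27, -3), (46, 2), (56, 1)], [(2, 3), (18, -3), (33, 6), (43, -3), (47, 1), (53, -2), (57, -2), (67, 3)], [(9, 3), (34, -3), (44, 6), (48, 2), (58, 1)], [(19, 2), (29, 1), (35, -2), (39, 2), (49, 2), (69, 2), (79, 1)], [(0, 1), (10, -2), (20, 1), (30, -2), (40, 1), (60, 2), (70, 1), (80, -2)], [(11, 3), (31, 3), (51, 2), (61, 1), (71, 6)], [(52, 1), (62, -2)]],
   [[(28, -3), (38, 3), (63, -2)], [(64, 1), (74, -3)], [(55, -1), (65, 1)], [(1, -3), (27, 6), (32, -6), (46, -3), (56, -2), (62, -2), (66, 1), (76, -3)], [(2, 3), (47, 3), (57, -1), (67, 1)], [(28, -3), (38, 3), (58, 1), (68, -2)], [(19, -1), (29, -2), (35, -2), (39, -1), (49, 1), (59, -2), (79, -2)], [(0, -2), (10, 1), (20, 1), (30, 1), (40, 1), (50, -2), (70, 2), (80, -2)], [(11, -3), (31, -3), (61, -2), (71, -2)]],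
   [[(37, 3), (47, -3), (72, -1)], [(29, 3), (54, 3), (73, -1)], [(64, -1), (74, 2)], [(11, 3), (36, -3), (41, 3), (65, -2), (71, 1), (75, -1)], [(1, 3), (27, -3), (32, 3), (46, 3), (62, 3), (66, -1), (76, 2)], [(2, -3), (37, 3), (47, -6), (57, 3), (67, -2), (77, -1)], [(9, 3), (44, 3), (48, 3), (68, -1), (78, 2)], [(19, -1), (29, -2), (35, 1), (39, -1), (49, -2), (59, -1), (69, -2)], [(0, -1), (10, -1), (20, 2), (30, -1), (40, 2), (50, -1), (60, 2), (80, -2)]],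
   [[(27, -1), (56, 3)], [(28, 2), (38, -3), (63, 3)], [(29, -1), (54, -3), (73, 2)], [(0, -1), (10, 2), (20, -1), (30, -2), (40, -1), (45, -3), (50, 2), (60, 2), (64, -3), (70, -1), (74, 1)], [(11, -3), (31, -1), (36, 6), (41, -6), (55, -3), (61, -3), (65, 3), (75, 2)], [(27, -3), (32, 2), (56, 3), (76, 1)], [(2, 3), (18, -3), (33, 2), (37, -3), (43, -3), (47, 3), (57, -6), (67, 3), (77, 2)], [(9, 3), (28, -3), (34, -1), (38, 3), (58, 3), (68, -6), (78, 2)], [(19, 2), (29, 1), (39, 2), (49, 1), (59, 2), (69, 2), (79, 2)]]]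

def opTable2 : List (List (List (ℕ × ℤ))) :=
  [[[(6, 2), (17, -2), (19, 2), (29, -2), (39, 2), (49, 1), (59, -1), (69, 2), (79, 1)], [(8, -2), (11, -6), (31, -3), (41, -3), (61, -3), (71, -3)], [(1, 2), (32, 3), (62, 3)], [(2, -2), (13, -3), (23, 3), (33, -6), (43, 3), (53, 3)], [(3, 2), (14, -3), (34, 3), (44, -6)], [(4, 1), (35, 3)], [(5, -1), (16, -3), (26, 3)], [(6, 2), (17, -3)], [(7, 1)]],
   [[(4, 6), (15, -2), (18, -2), (25, 3), (35, 3), (47, 3), (57, -3), (67, 3)], [(6, -2), (17, 2), (29, 1), (39, -1), (49, 1), (59, 2), (69, -1), (79, 1)], [(0, -2), (7, 3), (20, 2), (30, 1), (40, 1), (50, -2), (60, 1), (70, 1), (80, -2)], [(8, 3), (11, 1), (21, 1), (51, 3), (71, 3)], [(12, -1), (22, 1), (52, -3), (62, 3)], [(2, 3), (13, 1), (23, -2), (33, 3), (43, -3)], [(3, -3), (14, 2), (24, 1), (44, 3)], [(4, 3), (15, -1), (25, 1), (35, 3)], [(16, 1), (26, -2)]],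
   [[(24, 1), (27, 2), (46, -3), (66, 3), (76, -3)], [(9, 6), (26, -2), (28, -1), (48, 3), (58, 3), (68, -3), (78, 3)], [(6, 1), (17, -2), (19, -2), (39, -1), (49, -2), (59, -1), (69, -1), (79, -2)], [(0, 2), (10, -1), (30, -2), (40, -1), (50, -1), (60, 2), (70, 2), (80, -1)], [(21, -1), (31, -1), (51, -3), (71, -3)], [(1, -3), (12, 3), (22, -2), (32, -1), (42, -3), (52, 6), (62, -3)], [(13, 3), (23, -1), (33, 2), (53, -3)], [(3, 3), (14, -3), (24, -1), (34, 2), (44, -3)], [(4, -3), (15, 3), (25, -2), (35, -1)]],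
   [[(33, 1), (36, -2), (55, 3), (65, -3)], [(35, -2), (37, 1), (47, -3)], [(28, -1), (38, 1)], [(6, 1), (17, -2), (19, -1), (29, 2), (49, -2), (59, 2), (69, -1), (79, 1)], [(0, -2), (10, 1), (20, 1), (40, 2), (50, -2), (60, 1), (70, 1), (80, -2)], [(11, -3), (31, -2), (41, -2), (61, -3)], [(1, 3), (32, 2), (42, 1), (52, -3), (62, 6)], [(2, -3), (33, -1), (43, 1)], [(34, 1), (44, -2)]],
   [[(1, -6), (32, -3), (42, -2), (45, -1), (52, 3), (62, -3), (64, -3), (74, 3)], [(27, 3), (34, -3), (44, 1), (46, -1), (56, -3)], [(37, -1), (47, 2)], [(5, -3), (9, 3), (16, -3), (38, 1), (48, 2), (68, -3), (78, 3)], [(6, -2), (17, 1), (19, -1), (29, 1), (39, -2), (59, -1), (69, -1), (79, -2)], [(0, -1), (7, 3), (10, -1), (20, 2), (30, 2), (50, -2), (60, -1), (70, 2), (80, -1)], [(8, -3), (11, -3), (41, -1), (51, -1), (71, -3)], [(1, -3), (32, -3), (42, -1), (52, 2), (62, -3)], [(2, 3), (33, 3), (43, -2), (53, -1)]],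
   [[(31, 3), (51, 1), (54, 1), (71, 3)], [(33, -3), (36, 3), (53, 1), (55, -2), (65, 3)], [(27, -3), (34, 3), (44, -3), (46, 2), (56, 1)], [(4, 3), (15, -3), (18, -3), (25, 3), (47, 1), (57, -2), (67, 3)], [(9, 3), (26, -3), (48, 2), (58, 1)], [(6, 1), (17, 1), (19, 2), (29, 1), (39, 2), (49, 2), (69, 2), (79, 1)], [(0, 1), (10, -2), (20, 1), (30, -2), (40, 1), (60, 2), (70, 1), (80, -2)], [(8, 3), (11, 3), (31, 3), (51, 2), (61, 1), (71, 6)], [(52, 1), (62, -2)]],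
   [[(0, -2), (10, 2), (20, -1), (30, -1), (40, 2), (50, -1), (63, -2), (70, 2), (80, -1)], [(1, 2), (32, 3), (62, 1), (64, 1), (74, -3)], [(2, -1), (55, -1), (65, 1)], [(3, -1), (14, 3), (27, 6), (34, -6), (44, 3), (46, -3), (56, -2), (66, 1), (76, -3)], [(4, 2), (35, 3), (47, 3), (57, -1), (67, 1)], [(5, -1), (28, -3), (38, 3), (58, 1), (68, -2)], [(17, 1), (19, -1), (29, -2), (39, -1), (49, 1), (59, -2), (79, -2)], [(0, -2), (7, 2), (10, 1), (20, 1), (30, 1), (40, 1), (50, -2), (70, 2), (80, -2)], [(8, -1), (11, -3), (31, -3), (61, -2), (71, -2)]],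
   [[(19, -3), (49, -3), (69, -2), (72, -1)], [(31, 3), (54, 3), (71, 1), (73, -1)], [(1, -3), (32, -3), (62, -3), (64, -1), (74, 2)], [(13, 3), (23, -3), (33, 6), (36, -3), (53, -3), (65, -2), (75, -1)], [(27, -3), (46, 3), (66, -1), (76, 2)], [(4, -3), (35, -3), (37, 3), (47, -6), (57, 3), (67, -2), (77, -1)], [(9, 3), (26, -3), (48, 3), (68, -1), (78, 2)], [(6, -2), (17, 1), (19, -1), (29, -2), (39, -1), (49, -2), (59, -1), (69, -2)], [(0, -1), (10, -1), (20, 2), (30, -1), (40, 2), (50, -1), (60, 2), (80, -2)]],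
   [[(9, 2), (28, -3), (58, 3), (68, -3), (78, 1)], [(0, 2), (10, -2), (20, 2), (30, 2), (40, -1), (50, -1), (60, -1), (63, 3), (70, -1)], [(11, 2), (41, 3), (54, -3), (61, 3), (73, 2)], [(1, -3), (12, 2), (42, -3), (45, -3), (52, 3), (64, -3), (74, 1)], [(13, -1), (23, 3), (33, -3), (36, 6), (55, -3), (65, 3), (75, 2)], [(14, -1), (27, -3), (34, 3), (56, 3), (76, 1)], [(4, 3), (15, -1), (18, -3), (25, 3), (37, -3), (47, 3), (57, -6), (67, 3), (77, 2)], [(5, -3), (9, 3), (16, -1), (28, -3), (38, 3), (58, 3), (68, -6), (78, 2)], [(6, 1), (19, 2), (29, 1), (39, 2), (49, 1), (59, 2), (69, 2), (79, 2)]]]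

def opTable3 : List (List (List (ℕ × ℤ))) :=
  [[[(8, -2), (19, 2), (29, -2), (39, 2), (49, 1), (59, -1), (69, 2), (79, 1)], [(11, -6), (31, -3), (41, -3), (61, -3), (71, -3)], [(1, 2), (32, 3), (62, 3)], [(2, -2), (13, -3), (23, 3), (33, -6), (43, 3), (53, 3)], [(3, 2), (14, -3), (34, 3), (44, -6)], [(4, 1), (35, 3)], [(5, -1), (16, -3), (26, 3)], [(6, 2), (17, -3)], [(7, 1)]],
   [[(17, -1), (18, -2), (47, 3), (57, -3), (67, 3)], [(8, -1), (29, 1), (39, -1), (49, 1), (59, 2), (69, -1), (79, 1)], [(0, -2), (20, 2), (30, 1), (40, 1), (50, -2), (60, 1), (70, 1), (80, -2)], [(11, 1), (21, 1), (51, 3), (71, 3)], [(12, -1), (22, 1), (52, -3), (62, 3)], [(2, 3), (13, 1), (23, -2), (33, 3), (43, -3)], [(3, -3), (14, 2), (24, 1), (44, 3)], [(4, 3), (15, -1), (25, 1), (35, 3)], [(16, 1), (26, -2)]],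
   [[(26, -1), (27, 2), (46, -3), (66, 3), (76, -3)], [(9, 6), (28, -1), (48, 3), (58, 3), (68, -3), (78, 3)], [(8, -1), (19, -2), (39, -1), (49, -2), (59, -1), (69, -1), (79, -2)], [(0, 2), (10, -1), (30, -2), (40, -1), (50, -1), (60, 2), (70, 2), (80, -1)], [(21, -1), (31, -1), (51, -3), (71, -3)], [(1, -3), (12, 3), (22, -2), (32, -1), (42, -3), (52, 6), (62, -3)], [(13, 3), (23, -1), (33, 2), (53, -3)], [(3, 3), (14, -3), (24, -1), (34, 2), (44, -3)], [(4, -3), (15, 3), (25, -2), (35, -1)]],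
   [[(4, 6), (15, -3), (25, 3), (35, 2), (36, -2), (55, 3), (65, -3)], [(6, -3), (17, 6), (37, 1), (47, -3)], [(7, 3), (28, -1), (38, 1)], [(8, 2), (19, -1), (29, 2), (49, -2), (59, 2), (69, -1), (79, 1)], [(0, -2), (10, 1), (20, 1), (40, 2), (50, -2), (60, 1), (70, 1), (80, -2)], [(11, -3), (31, -2), (41, -2), (61, -3)], [(1, 3), (32, 2), (42, 1), (52, -3), (62, 6)], [(2, -3), (33, -1), (43, 1)], [(34, 1), (44, -2)]],
   [[(3, -6), (14, 3), (24, 3), (44, 2), (45, -1), (64, -3), (74, 3)], [(5, 3), (16, 6), (26, -3), (27, 3), (46, -1), (56, -3)], [(6, 3), (17, -3), (37, -1), (47, 2)], [(9, 3), (38, 1), (48, 2), (68, -3), (78, 3)], [(8, 2), (19, -1), (29, 1), (39, -2), (59, -1), (69, -1), (79, -2)], [(0, -1), (10, -1), (20, 2), (30, 2), (50, -2), (60, -1), (70, 2), (80, -1)], [(11, -3), (41, -1), (51, -1), (71, -3)], [(1, -3), (32, -3), (42, -1), (52, 2), (62, -3)], [(2, 3), (33, 3), (43, -2), (53, -1)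]],
   [[(13, -3), (53, 2), (54, 1)], [(4, -3), (15, 6), (25, -3), (36, 3), (55, -2), (65, 3)], [(16, -3), (26, 6), (27, -3), (46, 2), (56, 1)], [(18, -3), (47, 1), (57, -2), (67, 3)], [(9, 3), (48, 2), (58, 1)], [(8, 2), (19, 2), (29, 1), (39, 2), (49, 2), (69, 2), (79, 1)], [(0, 1), (10, -2), (20, 1), (30, -2), (40, 1), (60, 2), (70, 1), (80, -2)], [(11, 3), (31, 3), (51, 2), (61, 1), (71, 6)], [(52, 1), (62, -2)]],
   [[(12, 3), (22, -3), (52, 3), (62, -1), (63, -2)], [(3, 3), (14, -6), (34, 3), (44, -3), (64, 1), (74, -3)], [(4, -3), (35, -3), (55, -1), (65, 1)], [(16, 3), (26, -3), (27, 6), (46, -3), (56, -2), (66, 1), (76, -3)], [(17, -3), (47, 3), (57, -1), (67, 1)], [(7, 3), (28, -3), (38, 3), (58, 1), (68, -2)], [(8, -1), (19, -1), (29, -2), (39, -1), (49, 1), (59, -2), (79, -2)], [(0, -2), (10, 1), (20, 1), (30, 1), (40, 1), (50, -2), (70, 2), (80, -2)], [(11, -3), (31, -3), (61, -2), (71, 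-2)]],
   [[(21, -3), (51, -3), (71, -1), (72, -1)], [(13, -6), (23, 3), (33, -3), (53, 3), (54, 3), (73, -1)], [(3, -3), (14, 3), (44, 3), (64, -1), (74, 2)], [(15, -3), (36, -3), (65, -2), (75, -1)], [(26, 3), (27, -3), (46, 3), (66, -1), (76, 2)], [(6, -3), (17, 3), (37, 3), (47, -6), (57, 3), (67, -2), (77, -1)], [(9, 3), (48, 3), (68, -1), (78, 2)], [(8, -1), (19, -1), (29, -2), (39, -1), (49, -2), (59, -1), (69, -2)], [(0, -1), (10, -1), (20, 2), (30, -1), (40, 2), (50, -1), (60, 2), (80, -2)]],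
   [[(0, 2), (10, 1), (20, 1), (30, -2), (40, -2), (50, -2), (60, 1), (70, 1)], [(1, 1), (12, -6), (22, 3), (42, 3), (52, -3), (63, 3)], [(2, 1), (13, 3), (23, -6), (33, 3), (43, -3), (54, -3), (73, 2)], [(3, -2), (24, 3), (45, -3), (64, -3), (74, 1)], [(4, -2), (15, 3), (25, -3), (36, 6), (55, -3), (65, 3), (75, 2)], [(5, -2), (16, -3), (27, -3), (56, 3), (76, 1)], [(6, 1), (18, -3), (37, -3), (47, 3), (57, -6), (67, 3), (77, 2)], [(7, 1), (9, 3), (28, -3), (38, 3), (58, 3), (68, -6), (78, 2)], [(19, 2), (29, 1), (39, 2), (49, 1), (59, 2), (69, 2), (79, 2)]]]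

/-- The tables of `tee` at the coordinate vectors of the slice, divided by `216`. -/
def opTable : Fin 4 → List (List (List (ℕ × ℤ))) := ![opTable0, opTable1, opTable2, opTable3]

/-- The coordinate vectors of the slice as lists. -/
def sliceL (i : Fin 4) : TenList :=
  (1, ![(0, 3, 6), (0, 3, 4), (0, 2, 3), (0, 1, 2)] i) :: simpleL

theorem slice_single {R : Type*} [CommRing R] (i : Fin 4) :
    slice (Pi.single i (1 : R)) = toTen (sliceL i) := by
  rw [slice, sliceL, toTen_cons, add_comm, tail]
  congr 1
  fin_cases i <;> simp

/-- Lists of index triples with indices in `ℕ`, for efficient evaluation. -/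
abbrev NTenList := List (ℤ × ℕ × ℕ × ℕ)

/-- Forgetting the bound on the indices. -/
def toNat (L : TenList) : NTenList := L.map fun m => (m.1, m.2.1.val, m.2.2.1.val, m.2.2.2.val)

/-- The counterpart of `derL` for a single elementary matrix. -/
def derN (k l : ℕ) (L : NTenList) : NTenList :=
  L.flatMap fun m =>
    (bif m.2.1.beq l then [(m.1, k, m.2.2.1, m.2.2.2)] else []) ++
    ((bif m.2.2.1.beq l then [(m.1, m.2.1, k, m.2.2.2)] else []) ++
    (bif m.2.2.2.beq l then [(m.1, m.2.1, m.2.2.1, k)] else []))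

/-- Whether an index is distinct from all entries of a triple. -/
def freshN (a : ℕ) (n : ℕ × ℕ × ℕ) : Bool :=
  bif a.beq n.1 then false else bif a.beq n.2.1 then false else !(a.beq n.2.2)

/-- The counterpart of `disjT`. -/
def disjN (m n : ℕ × ℕ × ℕ) : Bool :=
  bif freshN m.1 n then bif freshN m.2.1 n then freshN m.2.2 n else false else false

/-- The counterpart of `sgnL`. -/
def sgnN : List ℕ → ℤ
  | [] => 1
  | a :: l => l.foldr (fun b s => (bif a.blt b then 1 else bif b.blt a then -1 else 0) * s) 1 *
      sgnN l

/-- The counterpart of `psiL`. -/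
def psiN (l m n : NTenList) : ℤ :=
  (l.map fun u => (m.map fun v => bif disjN u.2 v.2 then (n.map fun w =>
    bif disjN u.2 w.2 && disjN v.2 w.2 then u.1 * (v.1 * (w.1 *
      sgnN [u.2.1, u.2.2.1, u.2.2.2, v.2.1, v.2.2.1, v.2.2.2, w.2.1, w.2.2.1, w.2.2.2]))
    else 0).sum else 0).sum).sum

theorem beq_val (a b : Fin 9) : a.val.beq b.val = decide (a = b) := by
  rw [Bool.eq_iff_iff, Nat.beq_eq, decide_eq_true_iff, Fin.ext_iff]

theorem derN_toNat (k l : Fin 9) (L : TenList) :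
    derN k l (toNat L) = toNat (derL [(1, k, l)] L) := by
  simp only [derN, toNat, derL, List.flatMap_cons, List.flatMap_nil, List.append_nil,
    List.flatMap_map, List.map_flatMap, one_mul, beq_val]
  refine List.flatMap_congr fun m _ => ?_
  simp only [Bool.cond_decide, List.map_append, apply_ite (List.map _), List.map_cons,
    List.map_nil]

theorem disjN_val (m n : Fin 9 × Fin 9 × Fin 9) :
    disjN (m.1, m.2.1, m.2.2) (n.1, n.2.1, n.2.2) = disjT m n := by
  simp only [disjN, freshN, disjT, beq_val, bne, beq_eq_decide]
  generalize decide (m.1 = n.1) = b1, decide (m.1 = n.2.1) = b2, decide (m.1 = n.2.2) = b3,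
    decide (m.2.1 = n.1) = b4, decide (m.2.1 = n.2.1) = b5, decide (m.2.1 = n.2.2) = b6,
    decide (m.2.2 = n.1) = b7, decide (m.2.2 = n.2.1) = b8, decide (m.2.2 = n.2.2) = b9
  revert b1 b2 b3 b4 b5 b6 b7 b8 b9
  decide

theorem sgnN_val (l : List (Fin 9)) : sgnN (l.map Fin.val) = sgnL l := by
  induction l with
  | nil => rfl
  | cons a l ih =>
    rw [List.map_cons, sgnN, ih, sgnL, List.foldr_map]
    congr 3
    funext b s
    simp [Nat.blt_eq, Bool.cond_eq_ite]

theorem psiN_toNat (l m n : TenList) : psiN (toNat l) (toNat m) (toNat n) = psiL l m n := by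
  simp only [psiN, psiL, toNat, List.map_map, Function.comp_def, disjN_val]
  have h := fun a b c d e f p q r : Fin 9 => sgnN_val [a, b, c, d, e, f, p, q, r]
  simp only [List.map_cons, List.map_nil] at h
  simp only [h, Bool.cond_eq_ite]

/-- An entry of a sparse vector. -/
def entryAt (v : List (ℕ × ℤ)) (p : ℕ) : ℤ := (v.map fun e => if e.1 = p then e.2 else 0).sum

/-- A column of a sparse matrix. -/
def column (tab : List (List (List (ℕ × ℤ)))) (p : ℕ) : List (ℕ × ℤ) :=
  (tab.getD (p / 9) []).getD (p % 9) []

/-- The values of `gradWt` at natural numbers. -/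
def gradN (i : ℕ) : ℤ := [5, 3, 2, 1, 0, -1, -2, -3, -4].getD i 0

/-- The comparison of a table with the trilinear form, in the relevant degrees. -/
def checkTable (d : ℤ) (L : NTenList) (tab : List (List (List (ℕ × ℤ)))) : Bool :=
  (List.range 9).all fun k => (List.range 9).all fun l => (List.range 9).all fun i =>
    (List.range 9).all fun j =>
      bif (gradN k - gradN l + gradN j - gradN i - 1) % d == 0 then
        psiN (derN k l L) (derN j i L) L == entryAt (column tab (9 * k + l)) (9 * i + j)
      else entryAt (column tab (9 * k + l)) (9 * i + j) == 0

end TraceTables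

section TraceTablesCheck

theorem checkTable0 : checkTable 4 [(1, 0, 3, 6), (1, 0, 5, 8), (1, 0, 6, 7), (1, 1, 3, 8),
      (1, 1, 4, 7), (1, 1, 5, 6), (1, 2, 3, 7), (1, 2, 4, 6), (1, 3, 4, 5)]
    opTable0 = true := by decide +kernel

theorem checkTable1 : checkTable 6 [(1, 0, 3, 4), (1, 0, 5, 8), (1, 0, 6, 7), (1, 1, 3, 8),
      (1, 1, 4, 7), (1, 1, 5, 6), (1, 2, 3, 7), (1, 2, 4, 6), (1, 3, 4, 5)]
    opTable1 = true := by decide +kernel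

theorem checkTable2 : checkTable 8 [(1, 0, 2, 3), (1, 0, 5, 8), (1, 0, 6, 7), (1, 1, 3, 8),
      (1, 1, 4, 7), (1, 1, 5, 6), (1, 2, 3, 7), (1, 2, 4, 6), (1, 3, 4, 5)]
    opTable2 = true := by decide +kernel

theorem checkTable3 : checkTable 10 [(1, 0, 1, 2), (1, 0, 5, 8), (1, 0, 6, 7), (1, 1, 3, 8),
      (1, 1, 4, 7), (1, 1, 5, 6), (1, 2, 3, 7), (1, 2, 4, 6), (1, 3, 4, 5)]
    opTable3 = true := by decide +kernel

theorem checkTable_opTable : ∀ i : Fin 4,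
    checkTable (sliceWt i) (toNat (sliceL i)) (opTable i) = true := by
  have h : ∀ i : Fin 4, toNat (sliceL i) = (1, ![(0, 3, 6), (0, 3, 4), (0, 2, 3), (0, 1, 2)] i) ::
      [(1, 0, 5, 8), (1, 0, 6, 7), (1, 1, 3, 8),
      (1, 1, 4, 7), (1, 1, 5, 6), (1, 2, 3, 7), (1, 2, 4, 6), (1, 3, 4, 5)] := by decide
  have hw : ∀ i : Fin 4, (sliceWt i : ℤ) = ![4, 6, 8, 10] i := by decide
  intro i
  rw [h, hw, opTable]
  fin_cases i
  · exact checkTable0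
  · exact checkTable1
  · exact checkTable2
  · exact checkTable3

end TraceTablesCheck

section TraceNonzero

variable {R : Type*} [CommRing R]

/-- A tensor supported in one degree modulo `d`. -/
def SuppMod (d r : ℤ) (x : Ten R) : Prop :=
  ∀ a b c, ¬d ∣ gradWt a + gradWt b + gradWt c - r → x a b c = 0

theorem SuppMod.psi_eq_zero {d p q r : ℤ} {α β γ : Ten R} (hα : SuppMod d p α)
    (hβ : SuppMod d q β) (hγ : SuppMod d r γ) (h : ¬d ∣ 1 - (p + q + r)) : psi α β γ = 0 := by
  refine Trivector.psi_eq_zero fun σ => ?_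
  have hs : ∑ i, gradWt (σ i) = 1 := by
    rw [Equiv.sum_comp σ gradWt]
    decide
  rw [Fin.sum_univ_succ, Fin.sum_univ_eight] at hs
  simp only [Fin.succ_zero_eq_one, Fin.succ_one_eq_two, show Fin.succ (2 : Fin 8) = 3 from rfl,
    show Fin.succ (3 : Fin 8) = 4 from rfl, show Fin.succ (4 : Fin 8) = 5 from rfl,
    show Fin.succ (5 : Fin 8) = 6 from rfl, show Fin.succ (6 : Fin 8) = 7 from rfl,
    show Fin.succ (7 : Fin 8) = 8 from rfl] at hs
  by_cases h1 : d ∣ gradWt (σ 0) + gradWt (σ 1) + gradWt (σ 2) - p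
  · by_cases h2 : d ∣ gradWt (σ 3) + gradWt (σ 4) + gradWt (σ 5) - q
    · have h3 : ¬d ∣ gradWt (σ 6) + gradWt (σ 7) + gradWt (σ 8) - r := fun h3 => h (by
        have := dvd_add (dvd_add h1 h2) h3
        rw [← hs]
        exact this.trans (dvd_of_eq (by ring)))
      simp [hγ _ _ _ h3]
    · simp [hβ _ _ _ h2]
  · simp [hα _ _ _ h1]

theorem SuppMod.der_single {d r : ℤ} {x : Ten R} (hx : SuppMod d r x) (k l : Fin 9) :
    SuppMod d (r + gradWt k - gradWt l) (der (Matrix.single k l 1) x) := by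
  intro a b c h
  simp only [der_eq, Pi.add_apply, slotA_apply, slotB_apply, slotC_apply, Matrix.single_apply,
    ite_and, ite_mul, one_mul, zero_mul]
  have h1 : k = a → x l b c = 0 := fun e => hx _ _ _ fun hd => h (by
    subst e; convert hd using 1; ring)
  have h2 : k = b → x a l c = 0 := fun e => hx _ _ _ fun hd => h (by
    subst e; convert hd using 1; ring)
  have h3 : k = c → x a b l = 0 := fun e => hx _ _ _ fun hd => h (by
    subst e; convert hd using 1; ring)
  split_ifs with e1 e2 e3 e3 e2 e3 e3 <;> simp_all

theorem suppMod_toTen {d : ℤ} {L : TenList}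
    (h : ∀ m ∈ L, d ∣ gradWt m.2.1 + gradWt m.2.2.1 + gradWt m.2.2.2) :
    SuppMod d 0 (toTen L : Ten R) := by
  intro a b c hd
  induction L with
  | nil => simp [toTen_nil]
  | cons m L ih =>
    rw [toTen_cons]
    have hm : (mono m.2.1 m.2.2.1 m.2.2.2 : Ten ℂ) a b c = 0 := by
      by_cases he : gradWt a + gradWt b + gradWt c =
          gradWt m.2.1 + gradWt m.2.2.1 + gradWt m.2.2.2
      · exact absurd (h m (by simp)) (by rwa [← he, ← sub_zero (gradWt a + _ + _)])
      · rcases lt_or_gt_of_ne he with h | h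
        · exact suppGE_mono gradWt _ _ _ a b c h
        · exact suppGE_mono (-gradWt) _ _ _ a b c (by simp only [Pi.neg_apply]; omega)
    have hm' : monoZ m.2.1 m.2.2.1 m.2.2.2 a b c = 0 := Int.cast_eq_zero.1 hm
    simp [ih fun m' hm' => h m' (by simp [hm']), mono, hm']

theorem sliceL_dvd : ∀ i : Fin 4, ∀ m ∈ sliceL i,
    (sliceWt i : ℤ) ∣ gradWt m.2.1 + gradWt m.2.2.1 + gradWt m.2.2.2 := by
  decide

/-- The integer matrix described by a table. -/
def tableM (tab : List (List (List (ℕ × ℤ)))) : Matrix (Fin 9 × Fin 9) (Fin 9 × Fin 9) ℤ :=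
  Matrix.of fun p q => entryAt (column tab (9 * q.1 + q.2)) (9 * p.1 + p.2)

theorem gradN_val : ∀ i : Fin 9, gradN i = gradWt i := by decide

theorem teeM_toTen (L : TenList) (p q : Fin 9 × Fin 9) :
    teeM (toTen L : Ten R) p q =
      216 * (psiL (derL [(1, q.1, q.2)] L) (derL [(1, p.2, p.1)] L) L : R) := by
  have h : ∀ k l : Fin 9, (toMat [(1, k, l)] : Mat R) = Matrix.single k l 1 := fun k l => by
    simp [toMat]
  rw [← psi_toTen, toTen_derL, toTen_derL, h, h, teeM, Matrix.of_apply,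
    psi_swap _ (toTen L), psi_swap_right _ _ (toTen L), neg_neg]

theorem teeM_slice (i : Fin 4) :
    teeM (slice (Pi.single i (1 : R))) = (216 : R) • (tableM (opTable i)).map Int.cast := by
  ext p q
  have h := checkTable_opTable i
  simp only [checkTable, List.all_eq_true, List.mem_range] at h
  have h := h q.1 q.1.2 q.2 q.2.2 p.1 p.1.2 p.2 p.2.2
  rw [Matrix.smul_apply, Matrix.map_apply, tableM, Matrix.of_apply, slice_single, smul_eq_mul]
  by_cases hd : (gradWt q.1 - gradWt q.2 + gradWt p.2 - gradWt p.1 - 1) % sliceWt i = 0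
  · rw [gradN_val, gradN_val, gradN_val, gradN_val, beq_iff_eq.2 hd, cond_true, beq_iff_eq,
      derN_toNat, derN_toNat, psiN_toNat] at h
    rw [teeM_toTen, h]
  · rw [gradN_val, gradN_val, gradN_val, gradN_val, beq_eq_false_iff_ne.2 hd, cond_false,
      beq_iff_eq] at h
    rw [h, Int.cast_zero, mul_zero, teeM, Matrix.of_apply]
    have hs : SuppMod (R := R) (sliceWt i) 0 (toTen (sliceL i)) := suppMod_toTen (sliceL_dvd i)
    refine hs.psi_eq_zero (hs.der_single _ _) (hs.der_single _ _) fun hdvd => hd ?_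
    refine Int.emod_eq_zero_of_dvd (Int.dvd_neg.1 ?_)
    convert hdvd using 1
    ring

end TraceNonzero

section TracePowers

/-- For a matrix that shifts a cyclic grading, the powers have constant partial traces. -/
theorem trace_pow_of_graded {n R : Type*} [Fintype n] [DecidableEq n] [CommRing R] {d : ℕ}
    [NeZero d] (M : Matrix n n R) (deg : n → ZMod d) (h : ∀ p q, M p q ≠ 0 → deg q = deg p + 1) :
    (M ^ d).trace = d * ∑ p, if deg p = 0 then (M ^ d) p p else 0 := by
  let P : ZMod d → Matrix n n R := fun r => Matrix.diagonal fun p => if deg p = r then 1 else 0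
  let f : ZMod d → R := fun r => ∑ p, if deg p = r then (M ^ d) p p else 0
  have hf : ∀ r, f r = (P r * M ^ d).trace := fun r => by
    simp only [f, P, Matrix.trace, Matrix.diag, Matrix.diagonal_mul, ite_mul, one_mul, zero_mul]
  have hP : ∀ r, P r * M = M * P (r + 1) := fun r => by
    ext p q
    simp only [P, Matrix.diagonal_mul, Matrix.mul_diagonal]
    by_cases hM : M p q = 0
    · simp [hM]
    · simp [h p q hM, mul_comm]
  have hs : ∀ r, f (r + 1) = f r := fun r => by
    obtain ⟨k, hk⟩ := Nat.exists_eq_succ_of_ne_zero (NeZero.ne d)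
    have hk' : M ^ d = M ^ k * M := by rw [hk, Nat.succ_eq_add_one, pow_succ]
    rw [hf, hf, hk', (Commute.pow_self M k).eq, ← mul_assoc (P r), hP, mul_assoc,
      Matrix.trace_mul_comm M, mul_assoc, (Commute.pow_self M k).eq]
  have hc : ∀ k : ℕ, f k = f 0 := fun k => by
    induction k with
    | zero => simp
    | succ k ih => rw [Nat.cast_succ, hs, ih]
  have hc' : ∀ r, f r = f 0 := fun r => by rw [← ZMod.natCast_zmod_val r, hc]
  have : (M ^ d).trace = ∑ r, f r := by
    simp only [f]
    rw [Finset.sum_comm]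
    simp [Matrix.trace]
  rw [this, Finset.sum_congr rfl fun r _ => hc' r, Finset.sum_const, Finset.card_univ, ZMod.card,
    nsmul_eq_mul]

/-- Addition of a value to an entry of a sparse vector. -/
def insertAt (k : ℕ) (v : ℤ) : List (ℕ × ℤ) → List (ℕ × ℤ)
  | [] => [(k, v)]
  | e :: l => bif k.beq e.1 then (k, v + e.2) :: l else e :: insertAt k v l

theorem entryAt_insertAt (k : ℕ) (v : ℤ) (l : List (ℕ × ℤ)) (p : ℕ) :
    entryAt (insertAt k v l) p = (if k = p then v else 0) + entryAt l p := by
  induction l with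
  | nil => simp [insertAt, entryAt]
  | cons e l ih =>
    by_cases h : k = e.1
    · rw [insertAt, show k.beq e.1 = true by rwa [Nat.beq_eq], cond_true]
      simp only [entryAt, List.map_cons, List.sum_cons, ← h]
      split_ifs <;> ring
    · rw [insertAt, show k.beq e.1 = false by rwa [Bool.eq_false_iff, Ne, Nat.beq_eq], cond_false]
      simp only [entryAt, List.map_cons, List.sum_cons] at ih ⊢
      rw [ih]
      ring

/-- Addition of a multiple of a sparse vector. -/
def addMul (c : ℤ) (w acc : List (ℕ × ℤ)) : List (ℕ × ℤ) :=
  w.foldr (fun f acc => insertAt f.1 (f.2 * c) acc) acc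

theorem entryAt_addMul (c : ℤ) (w acc : List (ℕ × ℤ)) (p : ℕ) :
    entryAt (addMul c w acc) p = c * entryAt w p + entryAt acc p := by
  induction w with
  | nil => simp [addMul, entryAt]
  | cons e l ih =>
    rw [addMul, List.foldr_cons, entryAt_insertAt, ← addMul, ih]
    simp only [entryAt, List.map_cons, List.sum_cons]
    split_ifs <;> ring

/-- Application of a sparse matrix to a sparse vector. -/
def applyTable (tab : List (List (List (ℕ × ℤ)))) (v : List (ℕ × ℤ)) : List (ℕ × ℤ) :=
  v.foldr (fun e acc => addMul e.2 (column tab e.1) acc) []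

/-- The vector described by a sparse vector. -/
def vec (v : List (ℕ × ℤ)) (p : Fin 9 × Fin 9) : ℤ := entryAt v (9 * p.1 + p.2)

theorem vec_applyTable {tab : List (List (List (ℕ × ℤ)))} (ht : tab.length = 9)
    (v : List (ℕ × ℤ)) : vec (applyTable tab v) = (tableM tab).mulVec (vec v) := by
  induction v with
  | nil => ext p; simp [vec, applyTable, entryAt, Matrix.mulVec, dotProduct]
  | cons e v ih =>
    ext p
    have h1 : vec (applyTable tab (e :: v)) p =
        e.2 * entryAt (column tab e.1) (9 * p.1 + p.2) + vec (applyTable tab v) p := by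
      rw [vec, applyTable, List.foldr_cons, entryAt_addMul]
      rfl
    have h2 : vec (e :: v) = (fun q => if e.1 = 9 * q.1.val + q.2 then e.2 else 0) + vec v := by
      ext q
      simp [vec, entryAt]
    rw [h1, ih, h2, Matrix.mulVec_add, Pi.add_apply]
    congr 1
    simp only [Matrix.mulVec, dotProduct, tableM, Matrix.of_apply]
    by_cases he : e.1 < 81
    · rw [Finset.sum_eq_single
        ((⟨e.1 / 9, by omega⟩, ⟨e.1 % 9, by omega⟩) : Fin 9 × Fin 9)]
      · simp [Nat.div_add_mod, mul_comm]
      · intro q _ hq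
        rw [if_neg, mul_zero]
        intro h
        refine hq (Prod.ext (Fin.ext ?_) (Fin.ext ?_))
        · simp only
          have := q.1.2
          have := q.2.2
          omega
        · simp only
          have := q.1.2
          have := q.2.2
          omega
      · simp
    · have h3 : column tab e.1 = [] := by
        rw [column, List.getD_eq_default _ _ (by omega : tab.length ≤ e.1 / 9)]
        rfl
      rw [h3, Finset.sum_eq_zero]
      · simp [entryAt]
      · intro q _
        rw [if_neg (by have := q.1.2; have := q.2.2; omega), mul_zero]

theorem vec_iterate {tab : List (List (List (ℕ × ℤ)))} (ht : tab.length = 9) (k : ℕ)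
    (q : Fin 9 × Fin 9) : vec ((applyTable tab)^[k] [(9 * q.1 + q.2, 1)]) =
      fun p => ((tableM tab) ^ k) p q := by
  induction k with
  | zero =>
    ext p
    have : (9 * q.1.val + q.2 = 9 * p.1 + p.2) ↔ p = q := by
      rw [Prod.ext_iff, Fin.ext_iff, Fin.ext_iff]
      have := q.1.2
      have := q.2.2
      have := p.1.2
      have := p.2.2
      omega
    simp [vec, entryAt, Matrix.one_apply, this]
  | succ k ih =>
    rw [Function.iterate_succ_apply', vec_applyTable ht, ih, pow_succ']
    ext p
    rw [Matrix.mul_apply]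
    rfl

/-- The partial trace of a power of a sparse matrix. -/
def traceN (d : ℕ) (tab : List (List (List (ℕ × ℤ)))) : ℤ :=
  ((List.finRange 9).map fun a : Fin 9 => ((List.finRange 9).map fun b : Fin 9 =>
    bif (gradN a - gradN b) % d == 0 then
      entryAt ((applyTable tab)^[d] [(9 * a + b, 1)]) (9 * a + b) else 0).sum).sum

theorem traceN_ne_zero : ∀ i : Fin 4, traceN (sliceWt i) (opTable i) ≠ 0 := by
  decide +kernel

theorem length_opTable : ∀ i, (opTable i).length = 9 := by decide

theorem gradWt_of_tableM_ne_zero {i : Fin 4} {p q : Fin 9 × Fin 9}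
    (h : tableM (opTable i) p q ≠ 0) :
    ((gradWt q.1 - gradWt q.2 : ℤ) : ZMod (sliceWt i)) =
      ((gradWt p.1 - gradWt p.2 : ℤ) : ZMod (sliceWt i)) + 1 := by
  have hc := checkTable_opTable i
  simp only [checkTable, List.all_eq_true, List.mem_range] at hc
  have hc := hc q.1 q.1.2 q.2 q.2.2 p.1 p.1.2 p.2 p.2.2
  by_cases hd : (gradWt q.1 - gradWt q.2 + gradWt p.2 - gradWt p.1 - 1) % sliceWt i = 0
  · have := (ZMod.intCast_zmod_eq_zero_iff_dvd _ (sliceWt i)).2 (Int.dvd_of_emod_eq_zero hd)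
    push_cast at this ⊢
    linear_combination this
  · rw [gradN_val, gradN_val, gradN_val, gradN_val, beq_eq_false_iff_ne.2 hd, cond_false,
      beq_iff_eq] at hc
    exact absurd hc h

theorem inv_slice_single_ne_zero (i : Fin 4) :
    inv (sliceWt i) (slice (Pi.single i (1 : ℂ))) ≠ 0 := by
  have : NeZero (sliceWt i) := ⟨by revert i; decide⟩
  have ht : ((tableM (opTable i)) ^ sliceWt i).trace ≠ 0 := by
    rw [trace_pow_of_graded (d := sliceWt i) _
      (fun p => ((gradWt p.1 - gradWt p.2 : ℤ) : ZMod (sliceWt i)))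
      fun p q => gradWt_of_tableM_ne_zero]
    refine mul_ne_zero (Nat.cast_ne_zero.2 (NeZero.ne _)) ?_
    convert traceN_ne_zero i
    rw [traceN, Fintype.sum_prod_type, Fin.sum_univ_def]
    simp only [Fin.sum_univ_def]
    refine congrArg _ (List.map_congr_left fun a _ => congrArg List.sum
      (List.map_congr_left fun b _ => ?_))
    have h1 : ((gradWt a - gradWt b : ℤ) : ZMod (sliceWt i)) = 0 ↔
        (gradN a - gradN b) % sliceWt i = 0 := by
      rw [ZMod.intCast_zmod_eq_zero_iff_dvd, gradN_val, gradN_val, Int.dvd_iff_emod_eq_zero]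
    have h2 := congrFun (vec_iterate (length_opTable i) (sliceWt i) (a, b)) (a, b)
    simp only [vec] at h2
    simp only [h1, ← h2, Bool.cond_eq_ite, beq_iff_eq]
  have hm : (tableM (opTable i)).map (Int.cast : ℤ → ℂ) =
      (Int.castRingHom ℂ).mapMatrix (tableM (opTable i)) := rfl
  rw [inv, teeM_slice, smul_pow, Matrix.trace_smul, hm, ← map_pow, smul_eq_mul]
  refine mul_ne_zero (pow_ne_zero _ (by norm_num)) ?_
  rw [RingHom.mapMatrix_apply, ← AddMonoidHom.map_trace (Int.castRingHom ℂ)]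
  exact Int.cast_ne_zero.2 ht

end TracePowers

section Heisenberg

/-- Addition on `Fin 9`, identified with `(ℤ/3)²` through ternary digits. -/
def tAdd (x a : Fin 9) : Fin 9 :=
  ⟨3 * ((x.val / 3 + a.val / 3) % 3) + (x.val % 3 + a.val % 3) % 3, by omega⟩

/-- Negation for `tAdd`. -/
def tNeg (a : Fin 9) : Fin 9 := tAdd a a

/-- The scalar product of ternary digits. -/
def tDot (b x : Fin 9) : ℕ := (b.val / 3) * (x.val / 3) + (b.val % 3) * (x.val % 3)

theorem tAdd_zero : ∀ x, tAdd x 0 = x := by decide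
theorem tAdd_tNeg : ∀ x a, tAdd (tAdd x a) (tNeg a) = x := by decide
theorem tAdd_tNeg' : ∀ x a, tAdd (tAdd x (tNeg a)) a = x := by decide
theorem tAdd_assoc : ∀ x a b, tAdd (tAdd x a) b = tAdd x (tAdd a b) := by decide +kernel
theorem tAdd_comm : ∀ x a, tAdd x a = tAdd a x := by decide
theorem tDot_tAdd : ∀ b x a, tDot b (tAdd x a) % 3 = (tDot b x + tDot b a) % 3 := by decide +kernel
theorem tAdd_tDot : ∀ b c x, tDot (tAdd b c) x % 3 = (tDot b x + tDot c x) % 3 := by decide +kernel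

variable {R : Type*} [CommRing R]

/-- The matrices of the Heisenberg group, up to scalars. -/
def heis (ζ : R) (a b : Fin 9) : Mat R :=
  Matrix.of fun y x => if y = tAdd x a then ζ ^ tDot b x else 0

theorem heis_apply (ζ : R) (a b y x : Fin 9) :
    heis ζ a b y x = if y = tAdd x a then ζ ^ tDot b x else 0 := rfl

theorem pow_eq_of_mod {ζ : R} (h : ζ ^ 3 = 1) {m n : ℕ} (hmn : m % 3 = n % 3) :
    ζ ^ m = ζ ^ n := by
  rw [pow_eq_pow_mod m h, hmn, ← pow_eq_pow_mod n h]

theorem heis_mul {ζ : R} (h : ζ ^ 3 = 1) (a b c d : Fin 9) :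
    heis ζ a b * heis ζ c d = ζ ^ tDot b c • heis ζ (tAdd a c) (tAdd b d) := by
  ext y x
  rw [Matrix.mul_apply, Finset.sum_eq_single (tAdd x c)]
  · simp only [heis_apply, Matrix.smul_apply, if_true, smul_eq_mul, tAdd_assoc, tAdd_comm c a,
      ite_mul, zero_mul, mul_ite, mul_zero, ← pow_add]
    refine if_congr Iff.rfl (pow_eq_of_mod h ?_) rfl
    have := tDot_tAdd b x c
    have := tAdd_tDot b d x
    omega
  · intro z _ hz
    rw [heis_apply ζ c d, if_neg hz, mul_zero]
  · simp

theorem heis_zero (ζ : R) : heis ζ 0 0 = 1 := by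
  ext y x
  simp [heis_apply, tAdd_zero, Matrix.one_apply, tDot]

theorem heis_ne_zero [Nontrivial R] {ζ : R} (a b : Fin 9) : heis ζ a b ≠ 0 := fun h => by
  have := congrFun (congrFun h (tAdd 0 a)) 0
  simp [heis_apply, tDot] at this

/-- The inverse of a Heisenberg matrix. -/
def heisInv (ζ : R) (a b : Fin 9) : Mat R := ζ ^ tDot b a • heis ζ (tNeg a) (tNeg b)

theorem heis_mul_heisInv {ζ : R} (h : ζ ^ 3 = 1) (a b : Fin 9) :
    heis ζ a b * heisInv ζ a b = 1 := by
  have h1 : ∀ a, tAdd a (tNeg a) = 0 := by decide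
  have h2 : ∀ a b, (tDot b a + tDot b (tNeg a)) % 3 = 0 % 3 := by decide
  rw [heisInv, mul_smul_comm, heis_mul h, smul_smul, ← pow_add, pow_eq_of_mod h (h2 a b), h1, h1,
    heis_zero, pow_zero, one_smul]

theorem heis_comm {ζ : R} (h : ζ ^ 3 = 1) (a b c d : Fin 9) :
    heis ζ a b * heis ζ c d = ζ ^ (tDot b c + 2 * tDot d a) • (heis ζ c d * heis ζ a b) := by
  rw [heis_mul h, heis_mul h, smul_smul, tAdd_comm a c, tAdd_comm b d, ← pow_add]
  congr 1
  exact pow_eq_of_mod h (by omega)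

theorem heis_pow_three {ζ : R} (h : ζ ^ 3 = 1) (a b : Fin 9) : heis ζ a b ^ 3 = 1 := by
  have h1 : ∀ a, tAdd (tAdd a a) a = 0 := by decide
  have h2 : ∀ a b, (tDot b a + tDot (tAdd b b) a) % 3 = 0 % 3 := by decide
  rw [pow_succ, pow_two, heis_mul h, smul_mul_assoc, heis_mul h, smul_smul, ← pow_add,
    pow_eq_of_mod h (h2 a b), h1, h1, heis_zero, pow_zero, one_smul]

theorem det_heis {ζ : R} (h : ζ ^ 3 = 1) (a b : Fin 9) : (heis ζ a b).det = 1 := by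
  let τ : Perm (Fin 9) := ⟨fun y => tAdd y (tNeg a), fun x => tAdd x a, fun y => tAdd_tNeg' y a,
    fun x => tAdd_tNeg x a⟩
  have hτ : Perm.sign τ = 1 := by
    revert a
    decide +kernel
  have hH : heis ζ a b = (Matrix.diagonal fun x => ζ ^ tDot b x).submatrix τ id := by
    ext y x
    rw [heis_apply, Matrix.submatrix_apply, Matrix.diagonal_apply]
    have : y = tAdd x a ↔ τ y = id x := by
      constructor
      · rintro rfl
        exact tAdd_tNeg x a
      · intro h
        rw [← tAdd_tNeg' y a]
        exact congrArg (fun z => tAdd z a) h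
    by_cases hy : y = tAdd x a
    · rw [if_pos hy, if_pos (this.1 hy), this.1 hy]
      rfl
    · rw [if_neg hy, if_neg fun h => hy (this.2 h)]
  have h3 : ∀ b, (∑ x, tDot b x) % 3 = 0 % 3 := by decide
  rw [hH, Matrix.det_permute, hτ, Matrix.det_diagonal, Finset.prod_pow_eq_pow_sum,
    pow_eq_of_mod h (h3 b)]
  simp

/-- The parallel classes of lines in the affine plane over the field with three elements. -/
def lineClass : Fin 4 → TenList :=
  ![[(1, 0, 1, 2), (1, 3, 4, 5), (1, 6, 7, 8)], [(1, 0, 3, 6), (1, 1, 4, 7), (1, 2, 5, 8)],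
    [(1, 0, 4, 8), (1, 1, 5, 6), (1, 2, 3, 7)], [(1, 0, 5, 7), (1, 1, 3, 8), (1, 2, 4, 6)]]

/-- The tensors of the Cartan subspace. -/
def cartan (a : Fin 4 → R) : Ten R := ∑ r, a r • toTen (lineClass r)

theorem isAlt_cartan (a : Fin 4 → R) : IsAlt (cartan a) :=
  IsAlt.sum fun _ _ => (isAlt_toTen _).smul _

theorem mono_rot (a b c : Fin 9) : (mono b c a : Ten R) = mono a b c := by
  rw [mono_swap23, mono_swap12, neg_neg]

/-- Rotation of a triple so that it starts with its least entry. -/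
def rotate (m : ℤ × Fin 9 × Fin 9 × Fin 9) : ℤ × Fin 9 × Fin 9 × Fin 9 :=
  if m.2.1 < m.2.2.1 ∧ m.2.1 < m.2.2.2 then m
  else if m.2.2.1 < m.2.2.2 then (m.1, m.2.2.1, m.2.2.2, m.2.1)
  else (m.1, m.2.2.2, m.2.1, m.2.2.1)

theorem toTen_perm {l m : TenList} (h : l.Perm m) : (toTen l : Ten R) = toTen m :=
  (h.map _).sum_eq

theorem toTen_rotate (l : TenList) : (toTen (l.map rotate) : Ten R) = toTen l := by
  induction l with
  | nil => rfl
  | cons m l ih =>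
    rw [List.map_cons, toTen_cons, toTen_cons, ih, rotate]
    split_ifs
    · rfl
    · rw [mono_rot]
    · rw [mono_rot m.2.2.1, mono_rot]

theorem act_heis_mono (ζ : R) (a b p q r : Fin 9) :
    act (heis ζ a b) (mono p q r) =
      ζ ^ (tDot b p + tDot b q + tDot b r) • mono (tAdd p a) (tAdd q a) (tAdd r a) := by
  have hd : ∀ p q r : Fin 9, act (heis ζ a b) (delta p q r) =
      ζ ^ (tDot b p + tDot b q + tDot b r) • delta (tAdd p a) (tAdd q a) (tAdd r a) := by
    intro p q r
    ext i j k
    simp only [act_delta, heis_apply, delta, Pi.smul_apply, smul_eq_mul, ite_and, pow_add]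
    split_ifs <;> simp
    ring
  simp only [mono_eq, map_add, map_sub, hd, smul_add, smul_sub]
  rw [show tDot b q + tDot b p + tDot b r = tDot b p + tDot b q + tDot b r by ring,
    show tDot b q + tDot b r + tDot b p = tDot b p + tDot b q + tDot b r by ring,
    show tDot b r + tDot b q + tDot b p = tDot b p + tDot b q + tDot b r by ring,
    show tDot b r + tDot b p + tDot b q = tDot b p + tDot b q + tDot b r by ring,
    show tDot b p + tDot b r + tDot b q = tDot b p + tDot b q + tDot b r by ring]

/-- Translation of triples. -/
def shiftL (a : Fin 9) (l : TenList) : TenList :=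
  l.map fun m => (m.1, tAdd m.2.1 a, tAdd m.2.2.1 a, tAdd m.2.2.2 a)

theorem act_heis_toTen {ζ : R} (h : ζ ^ 3 = 1) (a b : Fin 9) (l : TenList)
    (hl : ∀ m ∈ l, (tDot b m.2.1 + tDot b m.2.2.1 + tDot b m.2.2.2) % 3 = 0 % 3) :
    act (heis ζ a b) (toTen l) = toTen (shiftL a l) := by
  induction l with
  | nil => simp [toTen_nil, shiftL]
  | cons m l ih =>
    rw [toTen_cons, map_add, ih fun m hm => hl m (List.mem_cons_of_mem _ hm), map_smul,
      act_heis_mono, pow_eq_of_mod h (hl m List.mem_cons_self), pow_zero, one_smul, shiftL,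
      shiftL, List.map_cons, toTen_cons]

theorem act_heis_cartan {ζ : R} (h : ζ ^ 3 = 1) (a b : Fin 9) (c : Fin 4 → R) :
    act (heis ζ a b) (cartan c) = cartan c := by
  have h1 : ∀ b, ∀ r, ∀ m ∈ lineClass r,
      (tDot b m.2.1 + tDot b m.2.2.1 + tDot b m.2.2.2) % 3 = 0 % 3 := by decide
  have h2 : ∀ a, ∀ r, ((shiftL a (lineClass r)).map rotate).Perm (lineClass r) := by decide
  rw [cartan, map_sum]
  refine Finset.sum_congr rfl fun r _ => ?_
  rw [map_smul, act_heis_toTen h a b _ (h1 b r), ← toTen_rotate, toTen_perm (h2 a r)]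

end Heisenberg

section Eigenvalues

theorem exists_smul_of_eigenvector {ι M : Type*} [Fintype ι] [AddCommGroup M] [Module ℂ M]
    [FiniteDimensional ℂ M] (T : M →ₗ[ℂ] M) {e : ι → M} {μ : ι → ℂ} (hμ : Function.Injective μ)
    (he : ∀ i, e i ≠ 0) (hT : ∀ i, T (e i) = μ i • e i)
    (hc : Fintype.card ι = Module.finrank ℂ M) {i : ι} {x : M} (hx : T x = μ i • x) :
    ∃ c : ℂ, x = c • e i := by
  classical
  rcases isEmpty_or_nonempty ι with h | h
  · exact (h.false i).elim
  have hli : LinearIndependent ℂ e := Module.End.eigenvectors_linearIndependent' T μ hμ e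
    fun j => ⟨Module.End.mem_eigenspace_iff.2 (hT j), he j⟩
  let b := basisOfLinearIndependentOfCardEqFinrank hli hc
  have hb : ∀ j, b j = e j := fun j => by simp [b]
  have h1 : ∀ j, j ≠ i → b.repr x j = 0 := fun j hj => by
    have h2 : b.repr (T x) j = μ j * b.repr x j := by
      conv_lhs => rw [← b.sum_repr x]
      simp only [map_sum, map_smul, hb, hT]
      simp only [← hb, b.repr_self, Finsupp.coe_finsetSum, Finset.sum_apply,
        Finsupp.smul_apply, Finsupp.single_apply, smul_eq_mul]
      rw [Finset.sum_eq_single j (fun k _ hk => by simp [hk]) (by simp)]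
      simp [mul_comm]
    rw [hx, map_smul, Finsupp.smul_apply, smul_eq_mul] at h2
    have h3 : (μ i - μ j) * b.repr x j = 0 := by linear_combination h2
    exact (mul_eq_zero.1 h3).resolve_left (sub_ne_zero.2 fun h => hj (hμ h).symm)
  refine ⟨b.repr x i, ?_⟩
  conv_lhs => rw [← b.sum_repr x]
  rw [Finset.sum_eq_single i (fun k _ hk => by simp [h1 k hk]) (by simp), hb]

variable {R : Type*} [CommRing R]

/-- The eigenvalues of `tee` at Heisenberg-invariant tensors. -/
def lam (ζ : R) (x : Ten R) (v : Fin 9 × Fin 9) : R :=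
  ∑ y, ζ ^ tDot v.2 y * teeM x (v.1, 0) (tAdd y v.1, y)

theorem heis_eq_sum (ζ : R) (a b : Fin 9) :
    heis ζ a b = ∑ y, ζ ^ tDot b y • Matrix.single (tAdd y a) y (1 : R) := by
  ext p q
  rw [Matrix.sum_apply, Finset.sum_eq_single q]
  · simp [heis_apply, Matrix.single_apply, eq_comm]
  · intro y _ hy
    simp [hy]
  · simp

theorem tee_heis_apply (ζ : R) (x : Ten R) (a b : Fin 9) :
    tee x (heis ζ a b) a 0 = lam ζ x (a, b) := by
  rw [heis_eq_sum, map_sum, Matrix.sum_apply]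
  refine Finset.sum_congr rfl fun y _ => ?_
  rw [map_smul, Matrix.smul_apply, smul_eq_mul, tee_apply, teeM, Matrix.of_apply]

theorem lam_mapTen {S : Type*} [CommRing S] (φ : R →+* S) (ζ : R) (x : Ten R)
    (v : Fin 9 × Fin 9) : lam (φ ζ) (mapTen φ x) v = φ (lam ζ x v) := by
  simp only [lam, map_sum, map_mul, map_pow, teeM_mapTen, Matrix.map_apply]

theorem mapTen_cartan {S : Type*} [CommRing S] (φ : R →+* S) (a : Fin 4 → R) :
    mapTen φ (cartan a) = cartan fun i => φ (a i) := by
  ext i j k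
  simp only [cartan, mapTen, Finset.sum_apply, Pi.smul_apply, smul_eq_mul, toTen_apply, map_sum,
    map_mul, map_intCast]

/-- A matrix that transforms under the Heisenberg group like a Heisenberg matrix is proportional
to it. -/
theorem eq_smul_heis {ζ : ℂ} (hζ : IsPrimitiveRoot ζ 3) {a b : Fin 9} {Y : Mat ℂ}
    (hY : ∀ c d, heis ζ c d * Y = ζ ^ (tDot d a + 2 * tDot b c) • (Y * heis ζ c d)) :
    Y = Y a 0 • heis ζ a b := by
  have h3 : ζ ^ 3 = 1 := hζ.pow_eq_one
  have e1 : ∀ c d y x, ζ ^ tDot d y * Y y x =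
      ζ ^ (tDot d a + 2 * tDot b c + tDot d x) * Y (tAdd y c) (tAdd x c) := by
    intro c d y x
    have h := congrFun (congrFun (hY c d) (tAdd y c)) x
    rw [Matrix.mul_apply, Matrix.smul_apply, Matrix.mul_apply, Finset.sum_eq_single y,
      Finset.sum_eq_single (tAdd x c)] at h
    · simp only [heis_apply, if_true, smul_eq_mul] at h
      rw [h, pow_add _ _ (tDot d x)]
      ring
    · intro z _ hz
      rw [heis_apply, if_neg hz, mul_zero]
    · simp
    · intro z _ hz
      rw [heis_apply, if_neg, zero_mul]
      intro h
      refine hz ?_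
      rw [← tAdd_tNeg z c, ← h, tAdd_tNeg]
    · simp
  ext y x
  rw [Matrix.smul_apply, heis_apply, smul_eq_mul]
  split_ifs with hy
  · subst hy
    have h := e1 x 0 a 0
    have h0 : ∀ x, tDot 0 x = 0 := by decide
    have h0' : ∀ x, tAdd 0 x = x := by decide
    simp only [h0, h0', tAdd_comm a, pow_zero, one_mul, zero_add, add_zero] at h
    rw [h, mul_right_comm, ← pow_add, pow_eq_of_mod h3 (n := 0) (by omega), pow_zero, one_mul]
  · by_contra hne
    rw [mul_zero] at hne
    refine hy ?_
    have hd : ∀ d, tDot d y % 3 = (tDot d a + tDot d x) % 3 := fun d => by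
      have h := e1 0 d y x
      have h0 : ∀ b, tDot b 0 = 0 := by decide
      rw [tAdd_zero, tAdd_zero, h0, mul_zero, add_zero] at h
      have h := mul_right_cancel₀ hne h
      have h := (hζ.isOfFinOrder (by norm_num)).pow_eq_pow_iff_modEq.1 h
      rwa [← hζ.eq_orderOf] at h
    have h1 := hd 1
    have h3 := hd 3
    revert h1 h3
    clear hne hd e1 hY hy
    revert y x a
    decide +kernel

theorem tee_heis {ζ : ℂ} (hζ : IsPrimitiveRoot ζ 3) {x : Ten ℂ}
    (hx : ∀ a b, act (heis ζ a b) x = x) (v : Fin 9 × Fin 9) :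
    tee x (heis ζ v.1 v.2) = lam ζ x v • heis ζ v.1 v.2 := by
  have h3 : ζ ^ 3 = 1 := hζ.pow_eq_one
  rw [show v = (v.1, v.2) from rfl, ← tee_heis_apply]
  refine eq_smul_heis hζ fun c d => ?_
  have h1 := heis_mul_heisInv h3 c d
  have h2 : heisInv ζ c d * heis ζ c d = 1 := mul_eq_one_comm.1 h1
  have h4 := tee_act h1 h2 x (heis ζ v.1 v.2)
  rw [hx, det_heis h3, one_smul, heis_comm h3, smul_mul_assoc, mul_assoc, h1, mul_one,
    map_smul] at h4
  rw [← smul_mul_assoc, h4, mul_assoc, h2, mul_one]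

/-- The Heisenberg-invariant tensors with distinct eigenvalues. -/
structure IsRegular (ζ : ℂ) (x : Ten ℂ) : Prop where
  act_heis : ∀ a b, act (heis ζ a b) x = x
  lam_injective : Function.Injective (lam ζ x)

theorem IsRegular.exists_smul {ζ : ℂ} (hζ : IsPrimitiveRoot ζ 3) {x : Ten ℂ}
    (hx : IsRegular ζ x) {v : Fin 9 × Fin 9} {X : Mat ℂ} (hX : tee x X = lam ζ x v • X) :
    ∃ c : ℂ, X = c • heis ζ v.1 v.2 := by
  have hc : Fintype.card (Fin 9 × Fin 9) = Module.finrank ℂ (Mat ℂ) := by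
    rw [Module.finrank_matrix, Module.finrank_self, Fintype.card_prod, mul_one]
  have he : ∀ v : Fin 9 × Fin 9, heis ζ v.1 v.2 ≠ 0 := fun v => heis_ne_zero _ _
  exact exists_smul_of_eigenvector (tee x) hx.lam_injective he (tee_heis hζ hx.act_heis) hc hX

theorem psi_self_left {α β : Ten ℂ} : psi α α β = 0 := by
  have := psi_swap α α β
  linear_combination this / 2

theorem IsRegular.isNice {ζ : ℂ} (hζ : IsPrimitiveRoot ζ 3) {x : Ten ℂ}
    (hx : IsRegular ζ x) : IsNice x := by
  have h0 : lam ζ x (0, 0) = 0 := by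
    rw [← tee_heis_apply, heis_zero, tee_apply, der_one, map_smul, LinearMap.smul_apply,
      psi_self_left, smul_zero]
  intro X hX
  have h1 : tee x X = 0 := Matrix.ext_iff_trace_mul_right.2 fun Y => by
    rw [trace_tee_mul, hX, zero_mul, Matrix.trace_zero]
  obtain ⟨c, hc⟩ := hx.exists_smul hζ (v := (0, 0)) (X := X) (by rw [h1, h0, zero_smul])
  exact ⟨c, by rw [hc, heis_zero]⟩

end Eigenvalues

section RegularStabilizer

theorem eq_smul_one_of_commute {ζ : ℂ} (hζ : IsPrimitiveRoot ζ 3) {f : Mat ℂ}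
    (hf : ∀ c d, (c = 0 ∨ d = 0) → (c = 0 ∨ c = 1 ∨ c = 3) → (d = 0 ∨ d = 1 ∨ d = 3) →
      heis ζ c d * f = f * heis ζ c d) : f = f 0 0 • 1 := by
  have e1 : ∀ c d, (c = 0 ∨ d = 0) → (c = 0 ∨ c = 1 ∨ c = 3) → (d = 0 ∨ d = 1 ∨ d = 3) →
      ∀ y x, ζ ^ tDot d y * f y x = ζ ^ tDot d x * f (tAdd y c) (tAdd x c) := by
    intro c d h1 h2 h3 y x
    have h := congrFun (congrFun (hf c d h1 h2 h3) (tAdd y c)) x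
    rw [Matrix.mul_apply, Matrix.mul_apply, Finset.sum_eq_single y,
      Finset.sum_eq_single (tAdd x c)] at h
    · simp only [heis_apply, if_true] at h
      rw [h, mul_comm]
    · intro z _ hz
      rw [heis_apply, if_neg hz, mul_zero]
    · simp
    · intro z _ hz
      rw [heis_apply, if_neg, zero_mul]
      intro h
      refine hz ?_
      rw [← tAdd_tNeg z c, ← h, tAdd_tNeg]
    · simp
  have hs : ∀ c, c = 1 ∨ c = 3 → ∀ y, f (tAdd y c) (tAdd y c) = f y y := fun c hc y => by
    have h := e1 c 0 (Or.inr rfl) (Or.inr hc) (Or.inl rfl) y y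
    have h0 : ∀ x, tDot 0 x = 0 := by decide
    simpa [h0] using h.symm
  have h1 := fun y => hs 1 (Or.inl rfl) y
  have h3 := fun y => hs 3 (Or.inr rfl) y
  ext y x
  rw [Matrix.smul_apply, Matrix.one_apply, smul_eq_mul, mul_ite, mul_one, mul_zero]
  split_ifs with hyx
  · subst hyx
    have g1 : f 1 1 = f 0 0 := h1 0
    have g2 : f 2 2 = f 1 1 := h1 1
    have g3 : f 3 3 = f 0 0 := h3 0
    have g4 : f 4 4 = f 3 3 := h1 3
    have g5 : f 5 5 = f 4 4 := h1 4
    have g6 : f 6 6 = f 3 3 := h3 3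
    have g7 : f 7 7 = f 6 6 := h1 6
    have g8 : f 8 8 = f 7 7 := h1 7
    fin_cases y <;> simp_all
  · by_contra hne
    have hd : ∀ d, d = 1 ∨ d = 3 → tDot d y % 3 = tDot d x % 3 := fun d hd => by
      have h := e1 0 d (Or.inl rfl) (Or.inl rfl) (Or.inr hd) y x
      rw [tAdd_zero, tAdd_zero] at h
      have h := mul_right_cancel₀ hne h
      have h := (hζ.isOfFinOrder (by norm_num)).pow_eq_pow_iff_modEq.1 h
      rwa [← hζ.eq_orderOf] at h
    have h1 := hd 1 (Or.inl rfl)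
    have h3 := hd 3 (Or.inr rfl)
    have key : ∀ y x, tDot 1 y % 3 = tDot 1 x % 3 → tDot 3 y % 3 = tDot 3 x % 3 → y = x := by
      decide
    exact hyx (key y x h1 h3)

theorem IsRegular.eq_smul_heis {ζ : ℂ} (hζ : IsPrimitiveRoot ζ 3) {x : Ten ℂ}
    (hx : IsRegular ζ x) {g : Mat ℂ} (hdet : g.det = 1) (hg : act g x = x) :
    ∃ (v : Fin 9 × Fin 9) (c : ℂ), g = c • heis ζ v.1 v.2 := by
  have h3 : ζ ^ 3 = 1 := hζ.pow_eq_one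
  obtain ⟨h, gh⟩ : ∃ h, g * h = 1 := ⟨g⁻¹, Matrix.mul_nonsing_inv _ (by simp [hdet])⟩
  have hgi : h * g = 1 := mul_eq_one_comm.1 gh
  have hc : ∀ a b, ∃ k : Fin 3, g * heis ζ a b = ζ ^ k.val • (heis ζ a b * g) := fun a b => by
    have h1 := tee_act gh hgi x (heis ζ a b)
    rw [hg, hdet, one_smul, tee_heis hζ hx.act_heis (a, b), mul_smul_comm, smul_mul_assoc] at h1
    obtain ⟨c, hc⟩ := hx.exists_smul hζ h1
    have h2 : (g * heis ζ a b * h) ^ 3 = 1 := by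
      have e : ∀ A : Mat ℂ, (g * A * h) ^ 3 = g * A ^ 3 * h := fun A => by
        have : (g * A * h) ^ 3 = g * A * (h * g) * A * (h * g) * A * h := by noncomm_ring
        rw [this, hgi]
        noncomm_ring
      rw [e, heis_pow_three h3, mul_one, gh]
    rw [hc, smul_pow, heis_pow_three h3] at h2
    have h4 : c ^ 3 = 1 := by simpa using congrFun (congrFun h2 0) 0
    obtain ⟨k, hk, hkc⟩ := hζ.eq_pow_of_pow_eq_one h4
    refine ⟨⟨k, hk⟩, ?_⟩
    rw [hkc, ← smul_mul_assoc, ← hc, mul_assoc, hgi, mul_one]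
  obtain ⟨k1, hk1⟩ := hc 0 1
  obtain ⟨k2, hk2⟩ := hc 0 3
  obtain ⟨k3, hk3⟩ := hc 1 0
  obtain ⟨k4, hk4⟩ := hc 3 0
  obtain ⟨c, d, e1, e2, e3, e4⟩ : ∃ c d : Fin 9,
      (k1.val + (tDot d 0 + 2 * tDot 1 c)) % 3 = 0 % 3 ∧
      (k2.val + (tDot d 0 + 2 * tDot 3 c)) % 3 = 0 % 3 ∧
      (k3.val + (tDot d 1 + 2 * tDot 0 c)) % 3 = 0 % 3 ∧
      (k4.val + (tDot d 3 + 2 * tDot 0 c)) % 3 = 0 % 3 := by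
    have hC : ∀ k1 k2 : Fin 3, ∃ c : Fin 9, (k1.val + 2 * tDot 1 c) % 3 = 0 ∧
        (k2.val + 2 * tDot 3 c) % 3 = 0 := by decide
    have hD : ∀ k1 k2 : Fin 3, ∃ d : Fin 9, (k1.val + tDot d 1) % 3 = 0 ∧
        (k2.val + tDot d 3) % 3 = 0 := by decide
    have h0 : ∀ x, tDot 0 x = 0 := by decide
    have h0' : ∀ x, tDot x 0 = 0 := by decide
    obtain ⟨c, c1, c2⟩ := hC k1 k2
    obtain ⟨d, d1, d2⟩ := hD k3 k4
    refine ⟨c, d, ?_, ?_, ?_, ?_⟩ <;> simp [h0, h0', c1, c2, d1, d2]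
  have hcomm : ∀ a b (k : Fin 3), g * heis ζ a b = ζ ^ k.val • (heis ζ a b * g) →
      (k.val + (tDot d a + 2 * tDot b c)) % 3 = 0 % 3 →
      heis ζ a b * (heis ζ c d * g) = heis ζ c d * g * heis ζ a b := fun a b k h1 h2 => by
    rw [mul_assoc, h1, mul_smul_comm, ← mul_assoc (heis ζ c d), heis_comm h3, smul_mul_assoc,
      smul_smul, ← pow_add, pow_eq_of_mod h3 h2, pow_zero, one_smul, mul_assoc]
  have hf := eq_smul_one_of_commute hζ (f := heis ζ c d * g) (by
    rintro a b (rfl | rfl) ha hb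
    · rcases hb with rfl | rfl | rfl
      · rw [heis_zero, one_mul, mul_one]
      · exact hcomm _ _ _ hk1 e1
      · exact hcomm _ _ _ hk2 e2
    · rcases ha with rfl | rfl | rfl
      · rw [heis_zero, one_mul, mul_one]
      · exact hcomm _ _ _ hk3 e3
      · exact hcomm _ _ _ hk4 e4)
  refine ⟨(tNeg c, tNeg d), (heis ζ c d * g) 0 0 * ζ ^ tDot d c, ?_⟩
  have h5 : heisInv ζ c d * heis ζ c d = 1 := mul_eq_one_comm.1 (heis_mul_heisInv h3 c d)
  calc g = heisInv ζ c d * (heis ζ c d * g) := by rw [← mul_assoc, h5, one_mul]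
    _ = _ := by
      rw [hf]
      simp [heisInv, smul_smul]

end RegularStabilizer

section RegularExample

/-- A regular element of the Cartan subspace. -/
def cartanL : TenList :=
  [(5, 0, 1, 2), (5, 3, 4, 5), (5, 6, 7, 8), (-12, 0, 3, 6), (-12, 1, 4, 7), (-12, 2, 5, 8),
    (-1, 0, 4, 8), (-1, 1, 5, 6), (-1, 2, 3, 7), (2, 0, 5, 7), (2, 1, 3, 8), (2, 2, 4, 6)]

/-- The values of the trilinear form that determine the eigenvalues of `cartanL`. -/
def teeTable : Fin 9 → Fin 9 → ℤ :=
  ![![0, -1721, 1721, -116, -1861, 1602, 116, -1602, 1861],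
    ![-1721, 144, 0, 6, -144, -432, -12, -36, 864],
    ![1721, 0, -144, 12, -864, 36, -6, 432, 144],
    ![-116, 6, 12, -60, -60, -15, 0, 75, 150],
    ![-1861, -144, -864, -60, -720, -2160, -150, -900, 0],
    ![1602, -432, 36, -15, -2160, 360, -75, 0, 900],
    ![116, -12, -6, 0, -150, -75, 60, 15, 60],
    ![-1602, -36, 432, 75, -900, 0, 15, -360, 2160],
    ![1861, 864, 144, 150, 0, 900, 60, 2160, 720]]

theorem psiN_cartanL : ∀ a y : Fin 9, psiN (derN (tAdd y a) y (toNat cartanL))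
    (derN 0 a (toNat cartanL)) (toNat cartanL) = teeTable a y := by
  decide +kernel

/-- The coefficients of the eigenvalues of `cartanL` with respect to `1, ζ`. -/
def lamCoeff (v : Fin 9 × Fin 9) : ℤ × ℤ :=
  ∑ y, teeTable v.1 y • (![(1, 0), (0, 1), (-1, -1)] : Fin 3 → ℤ × ℤ) (Fin.ofNat 3 (tDot v.2 y))

theorem lamCoeff_injective : Function.Injective lamCoeff := by
  decide +kernel

theorem lam_cartanL {ζ : ℂ} (hζ : 1 + ζ + ζ ^ 2 = 0) (v : Fin 9 × Fin 9) :
    lam ζ (toTen cartanL) v = 216 * ((lamCoeff v).1 + (lamCoeff v).2 * ζ) := by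
  have h3 : ζ ^ 3 = 1 := by linear_combination (ζ - 1) * hζ
  have hp : ∀ n : ℕ, ζ ^ n =
      (((![(1, 0), (0, 1), (-1, -1)] : Fin 3 → ℤ × ℤ) (Fin.ofNat 3 n)).1 : ℂ) +
      ((![(1, 0), (0, 1), (-1, -1)] : Fin 3 → ℤ × ℤ) (Fin.ofNat 3 n)).2 * ζ := fun n => by
    have : ∀ k : Fin 3, ζ ^ k.val =
        (((![(1, 0), (0, 1), (-1, -1)] : Fin 3 → ℤ × ℤ) k).1 : ℂ) +
        ((![(1, 0), (0, 1), (-1, -1)] : Fin 3 → ℤ × ℤ) k).2 * ζ := fun k => by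
      fin_cases k
      · simp
      · simp
      · simp
        linear_combination hζ
    rw [← this]
    exact pow_eq_of_mod h3 (by simp)
  rw [lam, lamCoeff, Prod.fst_sum, Prod.snd_sum, Int.cast_sum, Int.cast_sum, Finset.sum_mul,
    ← Finset.sum_add_distrib, Finset.mul_sum]
  refine Finset.sum_congr rfl fun y _ => ?_
  rw [hp, teeM_toTen, ← psiN_toNat, ← derN_toNat, ← derN_toNat]
  rw [show ((0 : Fin 9) : ℕ) = 0 from rfl, psiN_cartanL, Prod.smul_fst, Prod.smul_snd, smul_eq_mul,
    smul_eq_mul, Int.cast_mul, Int.cast_mul]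
  ring

theorem exists_lam_injective {ζ : ℂ} (hζ : IsPrimitiveRoot ζ 3) (him : ζ.im ≠ 0) :
    ∃ a : Fin 4 → ℂ, Function.Injective (lam ζ (cartan a)) := by
  refine ⟨![5, -12, -1, 2], fun v w h => lamCoeff_injective ?_⟩
  have h1 : (cartan ![5, -12, -1, 2] : Ten ℂ) = toTen cartanL := by
    simp only [cartan, Fin.sum_univ_four, lineClass, cartanL, toTen]
    simp
    module
  have h0 : 1 + ζ + ζ ^ 2 = 0 := by
    have := hζ.geom_sum_eq_zero (by norm_num)
    simpa [Finset.sum_range_succ] using this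
  rw [h1, lam_cartanL h0, lam_cartanL h0] at h
  have h := mul_left_cancel₀ (by norm_num) h
  have h3 : (lamCoeff v).2 = (lamCoeff w).2 := by
    simpa [him] using congrArg Complex.im h
  rw [h3] at h
  exact Prod.ext (by exact_mod_cast add_right_cancel h) h3

end RegularExample

section Rigidity

/-- The row space of the given coordinates is stable. -/
def Stab (h : Mat ℂ) (A : Finset (Fin 9)) : Prop := ∀ i ∈ A, ∀ j ∉ A, h i j = 0

theorem Stab.mul {g h : Mat ℂ} {A : Finset (Fin 9)} (hg : Stab g A) (hh : Stab h A) :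
    Stab (g * h) A := fun i hi j hj => by
  rw [Matrix.mul_apply]
  refine Finset.sum_eq_zero fun k _ => ?_
  by_cases hk : k ∈ A
  · rw [hh k hk j hj, mul_zero]
  · rw [hg i hi k hk, zero_mul]

theorem Stab.smul {h : Mat ℂ} {A : Finset (Fin 9)} (hh : Stab h A) (z : ℂ) : Stab (z • h) A :=
  fun i hi j hj => by rw [Matrix.smul_apply, hh i hi j hj, smul_zero]

theorem Stab.inter {h : Mat ℂ} {A B : Finset (Fin 9)} (hA : Stab h A) (hB : Stab h B) :
    Stab h (A ∩ B) := fun i hi j hj => by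
  rw [Finset.mem_inter] at hi hj
  by_cases hj' : j ∈ A
  · exact hB i hi.2 j fun h => hj ⟨hj', h⟩
  · exact hA i hi.1 j hj'

theorem sum_mul_of_act_eq {x : Ten ℂ} {h k : Mat ℂ} (kh : k * h = 1) (hx : act h x = x)
    (s a b : Fin 9) :
    ∑ i, h s i * x i a b = ∑ a', k a a' * ∑ b', k b b' * x s a' b' := by
  have h1 : slotA h x = slotB k (slotC k x) := by
    conv_rhs => rw [← hx, act_eq, slotC_slotA, slotC_slotB, slotB_slotA, slotB_mul, slotC_mul, kh,
      slotB_one, slotC_one]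
  exact congrFun (congrFun (congrFun h1 s) a) b

/-- Positions at which the tail of the slice vanishes. -/
def TailFree (i j k : Fin 9) : Prop :=
  monoZ 0 3 6 i j k = 0 ∧ monoZ 0 3 4 i j k = 0 ∧ monoZ 0 2 3 i j k = 0 ∧ monoZ 0 1 2 i j k = 0

instance (i j k : Fin 9) : Decidable (TailFree i j k) := by
  unfold TailFree
  infer_instance

theorem TailFree.slice_apply {i j k : Fin 9} (h : TailFree i j k) (c : Fin 4 → ℂ) :
    slice c i j k = evalL simpleL i j k := by
  simp [slice, tail, toTen_apply, mono, h.1, h.2.1, h.2.2.1, h.2.2.2]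

/-- Positions at which all slice elements vanish. -/
def SliceZero (i j k : Fin 9) : Prop := TailFree i j k ∧ evalL simpleL i j k = 0

instance (i j k : Fin 9) : Decidable (SliceZero i j k) := by
  unfold SliceZero
  infer_instance

theorem SliceZero.eq_zero {i j k : Fin 9} (h : SliceZero i j k) (c : Fin 4 → ℂ) :
    slice c i j k = 0 := by
  rw [h.1.slice_apply, h.2, Int.cast_zero]

/-- Stability of the annihilator of two stable subspaces. -/
theorem Stab.annihilator {c : Fin 4 → ℂ} {h k : Mat ℂ} (kh : k * h = 1)
    (hx : act h (slice c) = slice c) {Q A B : Finset (Fin 9)} (hQ : Stab h Q) (hA : Stab k A)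
    (hB : Stab k B) (S : Finset (Fin 9)) (hS : S ⊆ Q)
    (h1 : ∀ s ∈ S, ∀ a ∈ A, ∀ b ∈ B, SliceZero s a b)
    (h2 : ∀ j ∈ Q, j ∉ S → ∃ a ∈ A, ∃ b ∈ B, (TailFree j a b ∧ evalL simpleL j a b ≠ 0) ∧
      ∀ i ∈ Q, i ≠ j → SliceZero i a b) : Stab h S := by
  intro s hs j hj
  by_cases hjQ : j ∈ Q
  · obtain ⟨a, ha, b, hb, hne, hz⟩ := h2 j hjQ hj
    have e := sum_mul_of_act_eq kh hx s a b
    rw [Finset.sum_eq_single j] at e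
    · rw [Finset.sum_eq_zero] at e
      · refine (mul_eq_zero.1 e).resolve_right ?_
        rw [hne.1.slice_apply]
        exact Int.cast_ne_zero.2 hne.2
      · intro a' _
        by_cases ha' : a' ∈ A
        · rw [Finset.sum_eq_zero, mul_zero]
          intro b' _
          by_cases hb' : b' ∈ B
          · rw [(h1 s hs a' ha' b' hb').eq_zero, mul_zero]
          · rw [hB b hb b' hb', zero_mul]
        · rw [hA a ha a' ha', zero_mul]
    · intro i _ hij
      by_cases hi : i ∈ Q
      · rw [(hz i hi hij).eq_zero, mul_zero]
      · rw [hQ s (hS hs) i hi, zero_mul]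
    · simp
  · exact hQ s (hS hs) j hjQ

theorem slice_eight (c : Fin 4 → ℂ) (a b : Fin 9) : slice c 8 a b = evalL simpleL 8 a b := by
  have h : ∀ a b : Fin 9, TailFree 8 a b := by decide
  exact (h a b).slice_apply c

theorem row_eight {c : Fin 4 → ℂ} {h k : Mat ℂ} (kh : k * h = 1)
    (hx : act h (slice c) = slice c) (h0 : ∀ i, i ≠ 0 → h i 0 = 0)
    (k0 : ∀ i, i ≠ 0 → k i 0 = 0) : Stab h {8} := by
  let D : Fin 9 → Fin 9 → ℂ := fun a b => k a 1 * k b 3 - k a 3 * k b 1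
  have hD : ∀ a b j (e : ℤ), a ≠ 0 → b ≠ 0 →
      (∀ i, i ≠ 0 → evalL simpleL i a b = if i = j then e else 0) → j ≠ 0 → D a b = e * h 8 j := by
    intro a b j e ha hb hE hj
    have hf : ∀ i a b : Fin 9, i ≠ 0 → a ≠ 0 → b ≠ 0 → TailFree i a b := by decide
    have e1 := sum_mul_of_act_eq kh hx 8 a b
    rw [Finset.sum_eq_single j] at e1
    · rw [(hf j a b hj ha hb).slice_apply, hE j hj, if_pos rfl] at e1
      simp only [slice_eight] at e1
      have h8 : ∀ a b : Fin 9, evalL simpleL 8 a b = if a = 1 then (if b = 3 then 1 else 0) else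
          if a = 3 then (if b = 1 then -1 else 0) else
          if a = 0 then (if b = 5 then 1 else 0) else
          if a = 5 then (if b = 0 then -1 else 0) else 0 := by decide
      rw [mul_comm (e : ℂ), e1]
      simp [h8, Fin.sum_univ_succ, k0 a ha, k0 b hb, D]
      ring
    · intro i _ hij
      by_cases hi : i = 0
      · rw [hi, h0 8 (by decide), zero_mul]
      · rw [(hf i a b hi ha hb).slice_apply, hE i hi, if_neg hij, Int.cast_zero, mul_zero]
    · simp
  have pl : ∀ a b c d, D a b * D c d - D a c * D b d + D a d * D b c = 0 := fun a b c d => by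
    simp only [D]
    ring
  have d12 : D 1 2 = 0 := by simpa using hD 1 2 1 0 (by decide) (by decide) (by decide) (by decide)
  have d13 := hD 1 3 8 1 (by decide) (by decide) (by decide) (by decide)
  have d14 := hD 1 4 7 1 (by decide) (by decide) (by decide) (by decide)
  have d15 := hD 1 5 6 1 (by decide) (by decide) (by decide) (by decide)
  have d16 := hD 1 6 5 (-1) (by decide) (by decide) (by decide) (by decide)
  have d17 := hD 1 7 4 (-1) (by decide) (by decide) (by decide) (by decide)
  have d18 := hD 1 8 3 (-1) (by decide) (by decide) (by decide) (by decide)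
  have d23 := hD 2 3 7 1 (by decide) (by decide) (by decide) (by decide)
  have d24 := hD 2 4 6 1 (by decide) (by decide) (by decide) (by decide)
  have d25 := hD 2 5 1 0 (by decide) (by decide) (by decide) (by decide)
  have d26 := hD 2 6 4 (-1) (by decide) (by decide) (by decide) (by decide)
  have d27 := hD 2 7 3 (-1) (by decide) (by decide) (by decide) (by decide)
  have d34 := hD 3 4 5 1 (by decide) (by decide) (by decide) (by decide)
  have d36 := hD 3 6 1 0 (by decide) (by decide) (by decide) (by decide)
  have d37 := hD 3 7 2 1 (by decide) (by decide) (by decide) (by decide)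
  have d38 := hD 3 8 1 1 (by decide) (by decide) (by decide) (by decide)
  have d45 := hD 4 5 3 1 (by decide) (by decide) (by decide) (by decide)
  have d46 := hD 4 6 2 1 (by decide) (by decide) (by decide) (by decide)
  have d47 := hD 4 7 1 1 (by decide) (by decide) (by decide) (by decide)
  have d48 := hD 4 8 1 0 (by decide) (by decide) (by decide) (by decide)
  have d58 := hD 5 8 1 0 (by decide) (by decide) (by decide) (by decide)
  have d67 := hD 6 7 1 0 (by decide) (by decide) (by decide) (by decide)
  have d78 := hD 7 8 1 0 (by decide) (by decide) (by decide) (by decide)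
  have f1 : h 8 1 = 0 := by simpa [d34, d78, d37, d48, d38, d47] using pl 3 4 7 8
  have f2 : h 8 2 = 0 := by simpa [d34, d67, d36, d47, d37, d46] using pl 3 4 6 7
  have f3 : h 8 3 = 0 := by simpa [d14, d58, d15, d48, d18, d45] using pl 1 4 5 8
  have f4 : h 8 4 = 0 := by simpa [d12, d67, d16, d27, d17, d26, f3] using pl 1 2 6 7
  have f5 : h 8 5 = 0 := by simpa [d13, d46, d14, d36, d16, d34, f2] using pl 1 3 4 6
  have f6 : h 8 6 = 0 := by simpa [d12, d45, d14, d25, d15, d24] using pl 1 2 4 5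
  have f7 : h 8 7 = 0 := by simpa [d12, d34, d13, d24, d14, d23, f6] using pl 1 2 3 4
  intro i hi j hj
  rw [Finset.mem_singleton] at hi hj
  subst hi
  fin_cases j
  · exact h0 8 (by decide)
  · exact f1
  · exact f2
  · exact f3
  · exact f4
  · exact f5
  · exact f6
  · exact f7
  · exact absurd rfl hj

end Rigidity

section Triangular

theorem gradWt_lt : ∀ i j : Fin 9, i < j → gradWt j < gradWt i := by decide

theorem gradWt_le {i j : Fin 9} (h : i ≤ j) : gradWt j ≤ gradWt i := by
  rcases h.eq_or_lt with h | h
  · rw [h]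
  · exact (gradWt_lt i j h).le

theorem suppGE_slice (c : Fin 4 → ℂ) : SuppGE gradWt 0 (slice c) :=
  suppGE_simple.add ((suppGE_tail c).mono (by norm_num))

theorem act_corner {h : Mat ℂ} {x : Ten ℂ} (hx : SuppGE gradWt 0 x) {i j k p q r : Fin 9}
    (hi : ∀ a < p, h i a = 0) (hj : ∀ a < q, h j a = 0) (hk : ∀ a < r, h k a = 0)
    (h0 : gradWt p + gradWt q + gradWt r = 0) :
    act h x i j k = h i p * h j q * h k r * x p q r := by
  have key : ∀ a b c, ¬ (a = p ∧ b = q ∧ c = r) → h i a * h j b * h k c * x a b c = 0 := by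
    intro a b c hne
    by_cases ha : a < p
    · simp [hi a ha]
    by_cases hb : b < q
    · simp [hj b hb]
    by_cases hc : c < r
    · simp [hk c hc]
    rw [not_lt] at ha hb hc
    have h1 := gradWt_le ha
    have h2 := gradWt_le hb
    have h3 := gradWt_le hc
    suffices hlt : gradWt a + gradWt b + gradWt c < 0 by rw [hx a b c hlt, mul_zero]
    by_contra hge
    refine hne ⟨?_, ?_, ?_⟩ <;> by_contra hh
    · have := gradWt_lt _ _ (lt_of_le_of_ne ha (Ne.symm hh)); omega
    · have := gradWt_lt _ _ (lt_of_le_of_ne hb (Ne.symm hh)); omega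
    · have := gradWt_lt _ _ (lt_of_le_of_ne hc (Ne.symm hh)); omega
  rw [act_apply]
  simp only [Finset.mul_sum, ← mul_assoc]
  rw [Finset.sum_eq_single p, Finset.sum_eq_single q, Finset.sum_eq_single r]
  · exact fun c _ hc => key _ _ _ fun hh => hc hh.2.2
  · simp
  · exact fun b _ hb => Finset.sum_eq_zero fun c _ => key _ _ _ fun hh => hb hh.2.1
  · simp
  · exact fun a _ ha => Finset.sum_eq_zero fun b _ => Finset.sum_eq_zero fun c _ =>
      key _ _ _ fun hh => ha hh.1
  · simp

theorem weights_eq {m : Fin 9 → ℂ} (e058 : m 0 * m 5 * m 8 = 1) (e067 : m 0 * m 6 * m 7 = 1)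
    (e138 : m 1 * m 3 * m 8 = 1) (e147 : m 1 * m 4 * m 7 = 1) (e156 : m 1 * m 5 * m 6 = 1)
    (e237 : m 2 * m 3 * m 7 = 1) (e246 : m 2 * m 4 * m 6 = 1) (e345 : m 3 * m 4 * m 5 = 1)
    (hp : ∏ i, m i = 1) (i : Fin 9) : m i = m 4 := by
  have hne : ∀ i, m i ≠ 0 := fun i hi => by
    rw [Finset.prod_eq_zero (Finset.mem_univ i) hi] at hp
    exact zero_ne_one hp
  have h4 : m 4 ^ 3 = 1 := by
    linear_combination (-(m 4 ^ 3 * (m 1 * m 5 * m 6))) * e237 - m 4 ^ 3 * e156 +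
      (m 2 * m 4 * m 6) * (m 3 * m 4 * m 5) * e147 + (m 3 * m 4 * m 5) * e246 + e345
  obtain ⟨z, hz⟩ : ∃ z, m 3 = z * m 4 := ⟨m 3 / m 4, (div_mul_cancel₀ _ (hne 4)).symm⟩
  have z0 : z ≠ 0 := fun h => hne 3 (by rw [hz, h, zero_mul])
  have m5 : z * m 5 = m 4 := by
    rw [hz] at e345
    linear_combination m 4 * e345 - z * m 5 * h4
  have m2 : z * m 2 = m 1 := by
    refine mul_right_cancel₀ (mul_ne_zero (hne 5) (hne 6)) ?_
    linear_combination m 2 * m 6 * m5 + e246 - e156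
  have m0 : m 0 = z ^ 2 * m 1 := by
    refine mul_right_cancel₀ (mul_ne_zero (hne 5) (hne 8)) ?_
    rw [hz] at e138
    linear_combination e058 - e138 - m 1 * m 8 * z * m5
  have m1 : m 1 = z ^ 3 * m 4 := by
    have h1 : m 1 ^ 2 * m 4 * m 5 = m 0 := by
      refine mul_right_cancel₀ (mul_ne_zero (hne 6) (hne 7)) ?_
      linear_combination (m 1 * m 4 * m 7) * e156 + e147 - e067
    refine mul_right_cancel₀ (hne 1) ?_
    linear_combination (z * m 4 * h1) - m 1 ^ 2 * m 4 ^ 2 * m5 + z * m 4 * m0 - m 1 ^ 2 * h4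
  have m0' : m 0 = z ^ 5 * m 4 := by rw [m0, m1]; ring
  have m2' : m 2 = z ^ 2 * m 4 := mul_left_cancel₀ z0 (by rw [m2, m1]; ring)
  have m6 : z ^ 2 * m 6 = m 4 := by
    rw [m2'] at e246
    linear_combination m 4 * e246 - z ^ 2 * m 6 * h4
  have m7 : z ^ 3 * m 7 = m 4 := by
    rw [m1] at e147
    linear_combination m 4 * e147 - z ^ 3 * m 7 * h4
  have m8 : z ^ 4 * m 8 = m 4 := by
    rw [m1, hz] at e138
    linear_combination m 4 * e138 - z ^ 4 * m 8 * h4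
  have hz1 : z = 1 := by
    have h1 : z ^ 10 * ∏ i, m i = z ^ 11 * (m 4 ^ 3) ^ 3 := by
      calc z ^ 10 * ∏ i, m i = m 0 * m 1 * m 2 * m 3 * m 4 * (z * m 5) * (z ^ 2 * m 6) *
            (z ^ 3 * m 7) * (z ^ 4 * m 8) := by
            simp [Fin.prod_univ_succ]
            ring
        _ = _ := by
            rw [m5, m6, m7, m8, m0', m1, m2', hz]
            ring
    rw [hp, h4] at h1
    refine mul_left_cancel₀ (pow_ne_zero 10 z0) ?_
    linear_combination -h1
  subst hz1
  fin_cases i <;> simp_all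

theorem eq_smul_one_of_cube {h : Mat ℂ} {z μ : ℂ} (hμ : μ ≠ 0) (hd : ∀ i, h i i = μ)
    (ht : ∀ i j, j < i → h i j = 0) (h3 : h * h * h = z • (1 : Mat ℂ)) : h = μ • (1 : Mat ℂ) := by
  have hz : z = μ ^ 3 := by
    have e := congrFun (congrFun h3 8) 8
    have hr : ∀ j, h 8 j = if j = 8 then μ else 0 := fun j => by
      split_ifs with hj
      · rw [hj, hd]
      · exact ht 8 j (lt_of_le_of_ne (Fin.le_last j) hj)
    simp [Matrix.mul_apply, hr] at e
    rw [← e]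
    ring
  set N : Mat ℂ := h - μ • (1 : Mat ℂ) with hN
  have hh : h = N + μ • (1 : Mat ℂ) := by simp [hN]
  have hN9 : N ^ 9 = 0 := by
    have e := Matrix.aeval_self_charpoly h
    rw [Matrix.charpoly_of_isUpperTriangular h fun i j hij => ht i j hij] at e
    simp only [hd, Finset.prod_const, Finset.card_univ, Fintype.card_fin, map_pow, map_sub,
      Polynomial.aeval_X, Polynomial.aeval_C] at e
    rw [Algebra.algebraMap_eq_smul_one] at e
    exact e
  have hrec : N = (-(μ ^ 2 * 3)⁻¹ • (N + (3 * μ) • (1 : Mat ℂ))) * N ^ 2 := by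
    have e : N ^ 3 + (3 * μ) • N ^ 2 + (3 * μ ^ 2) • N = 0 := by
      rw [hh, hz] at h3
      simp only [mul_add, add_mul, Matrix.mul_smul, Matrix.smul_mul, mul_one, one_mul,
        smul_smul] at h3
      rw [← sub_eq_zero] at h3
      rw [← h3]
      simp only [pow_succ, pow_zero, one_mul]
      module
    have e2 : (3 * μ ^ 2) • N = -(N ^ 3 + (3 * μ) • N ^ 2) := by
      rw [eq_neg_iff_add_eq_zero, ← e]
      abel
    have hne : (3 * μ ^ 2 : ℂ) ≠ 0 := mul_ne_zero (by norm_num) (pow_ne_zero 2 hμ)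
    conv_lhs => rw [← inv_smul_smul₀ hne N, e2]
    rw [Matrix.smul_mul, add_mul, Matrix.smul_mul, one_mul, ← pow_succ', smul_neg, neg_smul,
      mul_comm (3 : ℂ) (μ ^ 2)]
  have hpow : ∀ k : ℕ, ∃ M : Mat ℂ, N = M * N ^ (k + 1) := by
    intro k
    induction k with
    | zero => exact ⟨1, by simp⟩
    | succ k ih =>
      obtain ⟨M, hM⟩ := ih
      refine ⟨M * (-(μ ^ 2 * 3)⁻¹ • (N + (3 * μ) • (1 : Mat ℂ))), ?_⟩
      calc N = M * N ^ (k + 1) := hM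
        _ = M * (N * N ^ k) := by rw [pow_succ']
        _ = M * (((-(μ ^ 2 * 3)⁻¹ • (N + (3 * μ) • (1 : Mat ℂ))) * N ^ 2) * N ^ k) := by
          rw [← hrec]
        _ = _ := by
          rw [mul_assoc, ← pow_add, mul_assoc, add_comm 2 k]
  obtain ⟨M, hM⟩ := hpow 8
  rw [hN9, mul_zero] at hM
  rw [hh, hM, zero_add]

theorem eq_smul_one_of_fixes_flag {c : Fin 4 → ℂ} {h : Mat ℂ} {z : ℂ} (hdet : h.det = 1)
    (hx : act h (slice c) = slice c) (h0 : ∀ i, i ≠ 0 → h i 0 = 0)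
    (h3 : h * h * h = z • (1 : Mat ℂ)) : ∃ μ : ℂ, h = μ • (1 : Mat ℂ) := by
  have hz : z ≠ 0 := by
    rintro rfl
    have e := congrArg Matrix.det h3
    simp [hdet] at e
  set k : Mat ℂ := z⁻¹ • (h * h) with hk
  have kh : k * h = 1 := by rw [hk, Matrix.smul_mul, h3, smul_smul, inv_mul_cancel₀ hz, one_smul]
  have hS : ∀ {A : Finset (Fin 9)}, Stab h A → Stab k A := fun hA => (hA.mul hA).smul _
  have fK : Stab h {1, 2, 3, 4, 5, 6, 7, 8} := by
    intro i hi j hj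
    have hj' : j = 0 := by revert hj; revert j; decide
    have hi' : i ≠ 0 := by revert hi; revert i; decide
    rw [hj', h0 i hi']
  have f8 : Stab h {8} := row_eight kh hx h0 fun i hi =>
    hS fK i (by revert hi; revert i; decide) 0 (by decide)
  have fU : Stab k Finset.univ := fun i _ j hj => absurd (Finset.mem_univ j) hj
  have fQ : Stab h {2, 4, 5, 6, 7, 8} :=
    fK.annihilator kh hx (hS f8) (hS fK) _ (by decide) (by decide +kernel) (by decide +kernel)
  have fR : Stab h {5, 7, 8} :=
    fQ.annihilator kh hx (hS fQ) (hS fQ) _ (by decide) (by decide +kernel) (by decide +kernel)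
  have fQ' : Stab h {2, 4, 6, 7, 8} :=
    fK.annihilator kh hx (hS f8) fU _ (by decide) (by decide +kernel) (by decide +kernel)
  have f7 : Stab h {7, 8} := fQ'.inter fR
  have f5 : Stab h {5, 6, 7, 8} :=
    fQ.annihilator kh hx (hS f7) (hS fK) _ (by decide) (by decide +kernel) (by decide +kernel)
  have f6 : Stab h {6, 7, 8} := fQ'.inter f5
  have f2 : Stab h {2, 3, 4, 5, 6, 7, 8} :=
    fK.annihilator kh hx (hS fR) (hS f6) _ (by decide) (by decide +kernel) (by decide +kernel)
  have f4 : Stab h {4, 5, 6, 7, 8} :=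
    fQ.annihilator kh hx (hS f7) (hS f2) _ (by decide) (by decide +kernel) (by decide +kernel)
  have low : ∀ i, i ≠ 3 → ∀ a < i, h i a = 0 := by
    intro i hi a ha
    fin_cases i
    · exact absurd ha (by simp)
    · exact fK 1 (by decide) a (by revert ha; revert a; decide)
    · exact fQ 2 (by decide) a (by revert ha; revert a; decide)
    · exact absurd rfl hi
    · exact f4 4 (by decide) a (by revert ha; revert a; decide)
    · exact f5 5 (by decide) a (by revert ha; revert a; decide)
    · exact f6 6 (by decide) a (by revert ha; revert a; decide)
    · exact f7 7 (by decide) a (by revert ha; revert a; decide)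
    · exact f8 8 (by decide) a (by revert ha; revert a; decide)
  have low3 : ∀ a < 2, h 3 a = 0 := fun a ha => f2 3 (by decide) a (by revert ha; revert a; decide)
  have corner : ∀ i j k p q r : Fin 9, (∀ a < p, h i a = 0) → (∀ a < q, h j a = 0) →
      (∀ a < r, h k a = 0) → gradWt p + gradWt q + gradWt r = 0 → TailFree i j k →
      TailFree p q r → evalL simpleL p q r = 1 →
      h i p * h j q * h k r = evalL simpleL i j k := by
    intro i j k p q r hi hj hk h0 ht ht' he
    have e := act_corner (suppGE_slice c) hi hj hk h0
    rw [hx, ht.slice_apply, ht'.slice_apply, he, Int.cast_one, mul_one] at e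
    exact e.symm
  have diag : ∀ i j k : Fin 9, i ≠ 3 → j ≠ 3 → k ≠ 3 → gradWt i + gradWt j + gradWt k = 0 →
      TailFree i j k → evalL simpleL i j k = 1 → h i i * h j j * h k k = 1 := by
    intro i j k hi hj hk h0 ht he
    rw [corner i j k i j k (low i hi) (low j hj) (low k hk) h0 ht ht he, he, Int.cast_one]
  have d147 := diag 1 4 7 (by decide) (by decide) (by decide) (by decide) (by decide) (by decide)
  have d156 := diag 1 5 6 (by decide) (by decide) (by decide) (by decide) (by decide) (by decide)
  have h32 : h 3 2 = 0 := by
    have e := corner 3 4 6 2 4 6 low3 (low 4 (by decide)) (low 6 (by decide)) (by decide)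
      (by decide) (by decide) (by decide)
    rw [show evalL simpleL 3 4 6 = 0 by decide, Int.cast_zero] at e
    refine ((mul_eq_zero.1 e).resolve_right fun h6 => ?_) |> mul_eq_zero.1 |>.resolve_right
      fun h4 => ?_
    · rw [h6, mul_zero] at d156
      exact zero_ne_one d156
    · rw [h4, mul_zero, zero_mul] at d147
      exact zero_ne_one d147
  have lower : ∀ i, ∀ a < i, h i a = 0 := by
    intro i a ha
    by_cases hi : i = 3
    · subst hi
      by_cases h2 : a = 2
      · rw [h2, h32]
      · exact low3 a (by revert ha h2; revert a; decide)
    · exact low i hi a ha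
  have diag' : ∀ i j k : Fin 9, gradWt i + gradWt j + gradWt k = 0 →
      TailFree i j k → evalL simpleL i j k = 1 → h i i * h j j * h k k = 1 := by
    intro i j k h0 ht he
    rw [corner i j k i j k (lower i) (lower j) (lower k) h0 ht ht he, he, Int.cast_one]
  have hd := weights_eq (m := fun i => h i i)
    (diag' 0 5 8 (by decide) (by decide) (by decide))
    (diag' 0 6 7 (by decide) (by decide) (by decide))
    (diag' 1 3 8 (by decide) (by decide) (by decide)) d147 d156
    (diag' 2 3 7 (by decide) (by decide) (by decide))
    (diag' 2 4 6 (by decide) (by decide) (by decide))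
    (diag' 3 4 5 (by decide) (by decide) (by decide))
    (by rw [← Matrix.det_of_isUpperTriangular fun i j hij => lower i j hij, hdet])
  refine ⟨h 4 4, eq_smul_one_of_cube ?_ hd lower h3⟩
  intro h4
  rw [h4, mul_zero, zero_mul] at d147
  exact zero_ne_one d147

end Triangular

section Dominance

open MvPolynomial

variable {σ τ : Type} [Fintype σ] [Fintype τ]

/-- The image of a principal open set under an injective polynomial map contains a principal open
set. -/
theorem exists_eval_ne_zero_subset_image {P : τ → MvPolynomial σ ℂ}
    (hP : Function.Injective (aeval P : MvPolynomial τ ℂ →ₐ[ℂ] MvPolynomial σ ℂ))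
    {q : MvPolynomial σ ℂ} (hq : q ≠ 0) :
    ∃ p : MvPolynomial τ ℂ, p ≠ 0 ∧
      ∀ y, eval y p ≠ 0 → ∃ x, eval x q ≠ 0 ∧ ∀ t, eval x (P t) = y t := by
  set φ : MvPolynomial τ ℂ →ₐ[ℂ] MvPolynomial σ ℂ := aeval P with hφ
  have hfin : φ.toRingHom.FinitePresentation := by
    refine RingHom.FinitePresentation.of_finiteType.1 ?_
    refine RingHom.FiniteType.of_comp_finiteType (f := (C : ℂ →+* MvPolynomial τ ℂ)) ?_
    have : φ.toRingHom.comp (C : ℂ →+* MvPolynomial τ ℂ) = algebraMap ℂ (MvPolynomial σ ℂ) :=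
      φ.comp_algebraMap
    rw [this]
    exact RingHom.finiteType_algebraMap.2 inferInstance
  have hcon := PrimeSpectrum.isConstructible_comap_image hfin
    (PrimeSpectrum.isConstructible_basicOpen (f := q))
  obtain ⟨S, hS⟩ := PrimeSpectrum.exists_constructibleSetData_iff.2 hcon
  have hbot : (⊥ : PrimeSpectrum (MvPolynomial τ ℂ)) ∈ S.toSet := by
    rw [hS]
    refine ⟨⊥, hq, ?_⟩
    ext f
    simp only [PrimeSpectrum.comap_asIdeal]
    change φ f = 0 ↔ f = 0
    exact map_eq_zero_iff φ hP
  simp only [PrimeSpectrum.ConstructibleSetData.toSet, Set.mem_iUnion] at hbot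
  obtain ⟨D, hD, hbD⟩ := hbot
  refine ⟨D.f, fun h => hbD.2 (by
    rintro _ rfl
    rw [h]
    exact Ideal.zero_mem _), fun y hy => ?_⟩
  have hm : (vanishingIdeal ℂ {y} : Ideal (MvPolynomial τ ℂ)).IsMaximal := inferInstance
  let m : PrimeSpectrum (MvPolynomial τ ℂ) := ⟨vanishingIdeal ℂ {y}, hm.isPrime⟩
  have hmS : m ∈ S.toSet := by
    simp only [PrimeSpectrum.ConstructibleSetData.toSet, Set.mem_iUnion]
    refine ⟨D, hD, ?_, fun h => hy ?_⟩
    · rintro _ ⟨i, rfl⟩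
      have : D.g i ∈ (⊥ : Ideal (MvPolynomial τ ℂ)) := hbD.1 ⟨i, rfl⟩
      rw [Ideal.mem_bot.1 this]
      exact Ideal.zero_mem _
    · have := h rfl
      exact (mem_vanishingIdeal_singleton_iff y _).1 this
  rw [hS] at hmS
  obtain ⟨Q, hqQ, hQm⟩ := hmS
  have hz := IsPrime.vanishingIdeal_zeroLocus (K := ℂ) Q.asIdeal
  have hx : ∃ x ∈ zeroLocus ℂ Q.asIdeal, eval x q ≠ 0 := by
    by_contra! hcontra
    refine hqQ ?_
    change q ∈ Q.asIdeal
    rw [← hz, mem_vanishingIdeal_iff]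
    exact hcontra
  obtain ⟨x, hx, hxq⟩ := hx
  refine ⟨x, hxq, fun t => ?_⟩
  have h1 : (X t - C (y t) : MvPolynomial τ ℂ) ∈ m.asIdeal :=
    (mem_vanishingIdeal_singleton_iff y _).2 (by simp)
  rw [← hQm] at h1
  have h2 : φ (X t - C (y t)) ∈ Q.asIdeal := h1
  have h3 := hx _ h2
  simp [hφ] at h3
  exact sub_eq_zero.1 h3

theorem aeval_injective_of_surjective_derivative
    {P : τ → MvPolynomial σ ℂ} (x₀ : σ → ℂ)
    (hd : ∀ y : τ → ℂ, ∃ v : σ → ℂ, ∀ t,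
      HasDerivAt (fun s : ℂ => eval (x₀ + s • v) (P t)) (y t) 0) :
    Function.Injective (aeval P : MvPolynomial τ ℂ →ₐ[ℂ] MvPolynomial σ ℂ) := by
  let F : (σ → ℂ) → τ → ℂ := fun x t => eval x (P t)
  have hF : HasStrictFDerivAt F (fderiv ℂ F x₀) x₀ := by
    have : AnalyticAt ℂ F x₀ := 
      analyticAt_pi_iff.2 fun t => AnalyticOnNhd.eval_mvPolynomial (P t) x₀ trivial
    exact this.hasStrictFDerivAt
  have hsurj : (fderiv ℂ F x₀).range = ⊤ := by
    rw [LinearMap.range_eq_top]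
    intro y
    obtain ⟨v, hv⟩ := hd y
    refine ⟨v, ?_⟩
    have h1 : HasDerivAt (fun s : ℂ => F (x₀ + s • v)) y 0 := hasDerivAt_pi.2 hv
    have h2 : HasDerivAt (fun s : ℂ => x₀ + s • v) v 0 := by
      simpa using ((hasDerivAt_id (0 : ℂ)).smul_const v).const_add x₀
    have h3 : HasDerivAt (fun s : ℂ => F (x₀ + s • v)) (fderiv ℂ F x₀ v) 0 := by
      have h4 : HasFDerivAt F (fderiv ℂ F x₀) (x₀ + (0 : ℂ) • v) := by
        simpa using hF.hasFDerivAt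
      exact h4.comp_hasDerivAt (0 : ℂ) h2
    exact h3.unique h1
  have hnhds := hF.map_nhds_eq_of_surj hsurj
  rw [injective_iff_map_eq_zero]
  intro f hf
  have hrange : Set.range F ∈ nhds (F x₀) := by
    rw [← hnhds]
    exact Filter.mem_map.2 (Filter.univ_mem' fun x => ⟨x, rfl⟩)
  rw [nhds_pi, Filter.mem_pi'] at hrange
  obtain ⟨I, s, hs, hsub⟩ := hrange
  refine funext_set (s := s) (fun t => ?_) fun y hy => ?_
  · exact infinite_of_mem_nhds (F x₀ t) (hs t)
  · obtain ⟨x, rfl⟩ := hsub fun t _ => hy t trivial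
    have := congrArg (eval x) hf
    rw [map_zero] at this ⊢
    rw [← this, aeval_def, eval_eq, eval₂_eq]
    simp [F]

end Dominance

section TangentSpace

/-- Strictly increasing triples of indices. -/
abbrev Tri : Type := {t : Fin 9 × Fin 9 × Fin 9 // t.1 < t.2.1 ∧ t.2.1 < t.2.2}

theorem card_tri : Fintype.card Tri = 84 := by decide +kernel

/-- The entries of a tensor at strictly increasing triples. -/
def restr {R : Type*} [CommRing R] : Ten R →ₗ[R] Tri → R :=
  LinearMap.pi fun t => coordAt t.1.1 t.1.2.1 t.1.2.2

theorem restr_apply {R : Type*} [CommRing R] (x : Ten R) (t : Tri) :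
    restr x t = x t.1.1 t.1.2.1 t.1.2.2 := rfl

theorem IsAlt.eq_of_restr {x y : Ten ℂ} (hx : IsAlt x) (hy : IsAlt y)
    (h : restr x = restr y) : x = y := by
  rw [← sub_eq_zero]
  have hz := hx.sub hy
  ext i j k
  refine forall_triple (P := fun a b c => (x - y) a b c = 0) ?_ ?_ (fun a c => hz.self12 a c) ?_
    i j k
  · intro a b c h
    rw [hz.swap12, h, neg_zero]
  · intro a b c h
    rw [hz.swap23, h, neg_zero]
  · intro a b c h1 h2
    exact sub_eq_zero.2 (congrFun h ⟨(a, b, c), h1, h2⟩)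

variable {ρ : Type} [Fintype ρ]

/-- Linear combinations of integral trivectors. -/
def combo {R : Type*} [CommRing R] (L : ρ → TenList) : (ρ → R) →ₗ[R] Ten R :=
  Fintype.linearCombination R fun r => toTen (L r)

theorem combo_apply {R : Type*} [CommRing R] (L : ρ → TenList) (a : ρ → R) :
    combo L a = ∑ r, a r • (toTen (L r) : Ten R) := rfl

theorem isAlt_combo (L : ρ → TenList) (a : ρ → ℂ) : IsAlt (combo L a) :=
  IsAlt.sum fun _ _ => (isAlt_toTen _).smul _

theorem mapTen_combo {R S : Type*} [CommRing R] [CommRing S] (φ : R →+* S) (L : ρ → TenList)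
    (a : ρ → R) : mapTen φ (combo L a) = combo L fun r => φ (a r) := by
  ext i j k
  simp only [combo_apply, mapTen, Finset.sum_apply, Pi.smul_apply, smul_eq_mul, toTen_apply,
    map_sum, map_mul, map_intCast]

theorem mapTen_act {R S : Type*} [CommRing R] [CommRing S] (φ : R →+* S) (g : Mat R) (x : Ten R) :
    mapTen φ (act g x) = act (g.map φ) (mapTen φ x) := by
  ext i j k
  simp only [mapTen, act_apply, map_sum, map_mul, Matrix.map_apply]

theorem hasDerivAt_act (X : Mat ℂ) (y z : Ten ℂ) (i j k : Fin 9) :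
    HasDerivAt (fun s : ℂ => act (1 + s • X) (y + s • z) i j k) ((der X y + z) i j k) 0 := by
  obtain ⟨u2, u3, u4, hu⟩ : ∃ u2 u3 u4 : Ten ℂ, ∀ s : ℂ, act (1 + s • X) (y + s • z) =
      y + s • (der X y + z) + s ^ 2 • u2 + s ^ 3 • u3 + s ^ 4 • u4 := by
    refine ⟨slotA X (slotB X y) + slotA X (slotC X y) + slotB X (slotC X y) + der X z,
      slotA X (slotB X (slotC X y)) + slotA X (slotB X z) + slotA X (slotC X z) +
        slotB X (slotC X z), slotA X (slotB X (slotC X z)), fun s => ?_⟩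
    simp only [act_eq, der_eq, map_add, map_smul, LinearMap.add_apply, LinearMap.smul_apply,
      slotA_one, slotB_one, slotC_one]
    module
  have e : (fun s : ℂ => act (1 + s • X) (y + s • z) i j k) = fun s =>
      y i j k + s * (der X y + z) i j k + s ^ 2 * u2 i j k + s ^ 3 * u3 i j k +
        s ^ 4 * u4 i j k := by
    funext s
    rw [hu]
    rfl
  rw [e]
  have h1 := ((((hasDerivAt_const (0 : ℂ) (y i j k)).add
    ((hasDerivAt_id (0 : ℂ)).mul_const ((der X y + z) i j k))).add
    ((hasDerivAt_pow 2 (0 : ℂ)).mul_const (u2 i j k))).add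
    ((hasDerivAt_pow 3 (0 : ℂ)).mul_const (u3 i j k))).add
    ((hasDerivAt_pow 4 (0 : ℂ)).mul_const (u4 i j k))
  refine HasDerivAt.congr_deriv h1 ?_
  simp

/-- The differential at the identity of the map moving a linear system of trivectors around. -/
def tangentMap (L : ρ → TenList) (a : ρ → ℂ) : Mat ℂ × (ρ → ℂ) →ₗ[ℂ] Tri → ℂ :=
  restr ∘ₗ ((der.flip (combo L a)).coprod (combo L))

theorem tangentMap_apply (L : ρ → TenList) (a : ρ → ℂ) (X : Mat ℂ) (b : ρ → ℂ) :
    tangentMap L a (X, b) = restr (der X (combo L a) + combo L b) := rfl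

open MvPolynomial

/-- The matrix described by a point of the parameter space. -/
def matOf {R : Type*} (x : (Fin 9 × Fin 9) ⊕ ρ → R) : Mat R := Matrix.of fun i j => x (.inl (i, j))

theorem exists_poly_of_tangentMap (L : ρ → TenList) (a : ρ → ℂ)
    (hs : Function.Surjective (tangentMap L a)) {q : MvPolynomial ((Fin 9 × Fin 9) ⊕ ρ) ℂ}
    (hq : q ≠ 0) : ∃ p : MvPolynomial Tri ℂ, p ≠ 0 ∧ ∀ y : Ten ℂ, IsAlt y →
      eval (restr y) p ≠ 0 → ∃ x, eval x q ≠ 0 ∧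
        act (matOf x) (combo L fun r => x (.inr r)) = y := by
  let Z : Ten (MvPolynomial ((Fin 9 × Fin 9) ⊕ ρ) ℂ) := act (matOf X) (combo L fun r => X (.inr r))
  have hZ : ∀ x, mapTen (eval x) Z = act (matOf x) (combo L fun r => x (.inr r)) := fun x => by
    rw [mapTen_act, mapTen_combo]
    congr 2
    · ext i j
      simp [matOf]
    · ext r
      simp
  have hinj : Function.Injective (aeval (restr Z) : MvPolynomial Tri ℂ →ₐ[ℂ] _) := by
    refine aeval_injective_of_surjective_derivative
      (Sum.elim (fun ij => (1 : Mat ℂ) ij.1 ij.2) a) ?_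
    intro y
    obtain ⟨⟨D, b⟩, hb⟩ := hs y
    refine ⟨Sum.elim (fun ij => D ij.1 ij.2) b, fun t => ?_⟩
    have e := hasDerivAt_act D (combo L a) (combo L b) t.1.1 t.1.2.1 t.1.2.2
    rw [← restr_apply (der D (combo L a) + combo L b) t, ← tangentMap_apply, hb] at e
    convert e using 2 with s
    have := congrFun (congrFun (congrFun (hZ (Sum.elim (fun ij => (1 : Mat ℂ) ij.1 ij.2) a +
      s • Sum.elim (fun ij => D ij.1 ij.2) b)) t.1.1) t.1.2.1) t.1.2.2
    refine this.trans ?_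
    rw [← map_smul, ← map_add]
    rfl
  obtain ⟨p, hp, h⟩ := exists_eval_ne_zero_subset_image hinj hq
  refine ⟨p, hp, fun y hy hyp => ?_⟩
  obtain ⟨x, hx, hxy⟩ := h _ hyp
  refine ⟨x, hx, IsAlt.eq_of_restr ((isAlt_combo _ _).act _) hy ?_⟩
  rw [← hZ]
  exact funext hxy

end TangentSpace

section FlagSpace

/-- The degree of a triple with respect to the flag. -/
def triWt (t : Tri) : ℤ := flagWt t.1.1 + flagWt t.1.2.1 + flagWt t.1.2.2

/-- The products of basis vectors of nonnegative degree with respect to the flag. -/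
def flagList (t : Tri) : TenList := if 0 ≤ triWt t then [(1, t.1)] else []

theorem monoZ_of_sorted (t u : Tri) :
    monoZ t.1.1 t.1.2.1 t.1.2.2 u.1.1 u.1.2.1 u.1.2.2 = if u = t then 1 else 0 := by
  obtain ⟨⟨a, b, c⟩, hab, hbc⟩ := t
  obtain ⟨⟨i, j, k⟩, hij, hjk⟩ := u
  simp only [monoZ, Subtype.mk.injEq, Prod.mk.injEq] at *
  rw [if_neg (c := i = b ∧ j = a ∧ k = c) (by grind),
    if_neg (c := i = b ∧ j = c ∧ k = a) (by grind),
    if_neg (c := i = c ∧ j = b ∧ k = a) (by grind),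
    if_neg (c := i = c ∧ j = a ∧ k = b) (by grind),
    if_neg (c := i = a ∧ j = c ∧ k = b) (by grind)]
  simp

theorem restr_combo_flagList (b : Tri → ℂ) (t : Tri) :
    restr (combo flagList b) t = if 0 ≤ triWt t then b t else 0 := by
  rw [restr_apply, combo_apply]
  simp only [Finset.sum_apply, Pi.smul_apply, smul_eq_mul]
  rw [Finset.sum_eq_single t]
  · simp only [toTen_apply, flagList]
    split_ifs
    · simp [evalL, monoZ_of_sorted]
    · simp [evalL]
  · intro u _ hu
    simp only [toTen_apply, flagList]
    split_ifs
    · simp [evalL, monoZ_of_sorted, hu.symm]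
    · simp [evalL]
  · simp

theorem suppGE_combo_flagList (b : Tri → ℂ) : SuppGE flagWt 0 (combo flagList b) := by
  refine suppGE_of_sorted (isAlt_combo _ _) fun i j k hij hjk h => ?_
  have := restr_combo_flagList b ⟨(i, j, k), hij, hjk⟩
  rw [if_neg (by simpa [triWt] using h), restr_apply] at this
  exact this

theorem exists_combo_flagList_simple : ∃ a, combo flagList a = (toTen simpleL : Ten ℂ) := by
  refine ⟨restr (toTen simpleL), IsAlt.eq_of_restr (isAlt_combo _ _) (isAlt_toTen _) ?_⟩
  ext t
  rw [restr_combo_flagList]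
  split_ifs with h
  · rfl
  · have : SuppGE flagWt 0 (toTen simpleL) := suppGE_toTen (by decide)
    exact (this _ _ _ (not_le.1 h)).symm

/-- Solutions of `X • e = d • e_a ∧ e_b ∧ e_c` up to terms of nonnegative degree. -/
def negTable : List ((Fin 9 × Fin 9 × Fin 9) × ℤ × MatList) :=
  [((1, 2, 8), 1, [(1, 2, 3), (-1, 5, 6)]),
   ((1, 4, 8), 3, [(-1, 2, 1), (2, 4, 3), (1, 5, 4), (-1, 7, 6), (1, 8, 7)]),
   ((1, 5, 7), 3, [(-1, 2, 1), (-1, 4, 3), (1, 5, 4), (2, 7, 6), (1, 8, 7)]),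
   ((1, 5, 8), 1, [(1, 1, 0)]),
   ((1, 6, 8), 3, [(-2, 4, 1), (-1, 5, 2), (1, 6, 3), (1, 7, 4), (-2, 8, 5)]),
   ((1, 7, 8), 1, [(1, 3, 0), (1, 5, 1), (1, 7, 3)]),
   ((2, 3, 8), 3, [(1, 2, 1), (-2, 4, 3), (-1, 5, 4), (1, 7, 6), (2, 8, 7)]),
   ((2, 4, 5), 1, [(1, 5, 6)]),
   ((2, 4, 7), 3, [(1, 2, 1), (1, 4, 3), (-1, 5, 4), (1, 7, 6), (-1, 8, 7)]),
   ((2, 4, 8), 1, [(-1, 1, 0), (1, 8, 6)]),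
   ((2, 5, 6), 3, [(1, 2, 1), (1, 4, 3), (2, 5, 4), (-2, 7, 6), (-1, 8, 7)]),
   ((2, 5, 7), 1, [(-1, 1, 0), (1, 5, 3)]),
   ((2, 5, 8), 3, [(3, 2, 0), (-1, 4, 1), (-2, 5, 2), (-1, 6, 3), (2, 7, 4), (-1, 8, 5)]),
   ((2, 6, 7), 3, [(1, 4, 1), (2, 5, 2), (1, 6, 3), (-2, 7, 4), (1, 8, 5)]),
   ((2, 6, 8), 1, [(-2, 3, 0), (-1, 5, 1), (-1, 7, 3), (-1, 8, 4)]),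
   ((2, 7, 8), 1, [(1, 4, 0), (-1, 7, 2), (-1, 8, 3)]),
   ((3, 4, 8), 3, [(-2, 4, 1), (-1, 5, 2), (1, 6, 3), (1, 7, 4), (1, 8, 5)]),
   ((3, 5, 7), 3, [(-1, 4, 1), (-2, 5, 2), (-1, 6, 3), (-1, 7, 4), (-1, 8, 5)]),
   ((3, 5, 8), 1, [(1, 3, 0)]), ((3, 6, 8), 1, [(-1, 6, 1), (-1, 7, 2)]),
   ((3, 7, 8), 1, [(1, 5, 0), (-1, 7, 1)]),
   ((4, 5, 6), 3, [(1, 4, 1), (-1, 5, 2), (1, 6, 3), (1, 7, 4), (1, 8, 5)]),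
   ((4, 5, 7), 1, [(-1, 3, 0), (-1, 5, 1)]), ((4, 5, 8), 1, [(1, 4, 0), (-1, 7, 2)]),
   ((4, 6, 7), 1, [(1, 7, 2)]), ((4, 6, 8), 1, [(-1, 5, 0), (1, 7, 1), (1, 8, 2)]),
   ((4, 7, 8), 1, [(1, 6, 0), (1, 8, 1)]), ((5, 6, 7), 1, [(1, 5, 0)]),
   ((5, 6, 8), 1, [(-1, 6, 0)]), ((5, 7, 8), 1, [(-1, 7, 0)]), ((6, 7, 8), 1, [(1, 8, 0)])]

theorem negTable_spec : ∀ a b c : Fin 9, a < b → b < c → flagWt a + flagWt b + flagWt c < 0 →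
    let u := (negTable.lookup (a, b, c)).getD (0, [])
    u.1 ≠ 0 ∧ ∀ i j k : Fin 9, i < j → j < k → flagWt i + flagWt j + flagWt k < 0 →
      u.1 * monoZ a b c i j k = evalL (derL u.2 simpleL) i j k := by
  decide +kernel

theorem surjective_tangentMap_flagList {a : Tri → ℂ} (ha : combo flagList a = toTen simpleL) :
    Function.Surjective (tangentMap flagList a) := by
  have hnn : ∀ y : Tri → ℂ, (∀ t, triWt t < 0 → y t = 0) →
      y ∈ LinearMap.range (tangentMap flagList a) := fun y hy => by
    refine ⟨(0, y), ?_⟩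
    ext t
    rw [tangentMap_apply, map_zero, LinearMap.zero_apply, zero_add, restr_combo_flagList]
    split_ifs with h
    · rfl
    · exact (hy t (not_le.1 h)).symm
  rw [← LinearMap.range_eq_top, eq_top_iff, ← (Pi.basisFun ℂ Tri).span_eq, Submodule.span_le]
  rintro _ ⟨t, rfl⟩
  rw [Pi.basisFun_apply, SetLike.mem_coe]
  rcases le_or_gt 0 (triWt t) with h | h
  · refine hnn _ fun u hu => Pi.single_eq_of_ne ?_ _
    rintro rfl
    omega
  · obtain ⟨h1, h2⟩ := negTable_spec t.1.1 t.1.2.1 t.1.2.2 t.2.1 t.2.2 h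
    generalize (negTable.lookup (t.1.1, t.1.2.1, t.1.2.2)).getD (0, []) = u at h1 h2
    have h1' : (u.1 : ℂ) ≠ 0 := by exact_mod_cast h1
    have h3 : (u.1 : ℂ) • Pi.single t (1 : ℂ) - tangentMap flagList a (toMat u.2, 0) ∈
        LinearMap.range (tangentMap flagList a) := by
      refine hnn _ fun v hv => ?_
      rw [tangentMap_apply, map_zero, add_zero, ha, ← toTen_derL, Pi.sub_apply, restr_apply,
        toTen_apply, ← h2 _ _ _ v.2.1 v.2.2 hv, monoZ_of_sorted, sub_eq_zero]
      simp [Pi.single_apply]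
    have h4 := (LinearMap.range (tangentMap flagList a)).smul_mem (u.1 : ℂ)⁻¹
      (add_mem h3 (LinearMap.mem_range_self _ (toMat u.2, (0 : Tri → ℂ))))
    rwa [sub_add_cancel, inv_smul_smul₀ h1'] at h4

open MvPolynomial

/-- A generic trivector is equivalent to one compatible with the flag. -/
theorem exists_poly_flag : ∃ p : MvPolynomial Tri ℂ, p ≠ 0 ∧ ∀ y : Ten ℂ, IsAlt y →
    eval (restr y) p ≠ 0 → ∃ h : Mat ℂ, h.det ≠ 0 ∧ ∃ z, SuppGE flagWt 0 z ∧ act h z = y := by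
  obtain ⟨a, ha⟩ := exists_combo_flagList_simple
  have hq : ∀ x, eval x (matOf X : Mat (MvPolynomial ((Fin 9 × Fin 9) ⊕ Tri) ℂ)).det =
      (matOf x : Mat ℂ).det := fun x => by
    rw [RingHom.map_det]
    congr 1
    ext i j
    simp [matOf]
  have hq0 : (matOf X : Mat (MvPolynomial ((Fin 9 × Fin 9) ⊕ Tri) ℂ)).det ≠ 0 := fun h => by
    have := hq (Sum.elim (fun ij => (1 : Mat ℂ) ij.1 ij.2) 0)
    rw [h, map_zero] at this
    have e : (matOf (Sum.elim (fun ij => (1 : Mat ℂ) ij.1 ij.2) (0 : Tri → ℂ))) = 1 := rfl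
    rw [e, Matrix.det_one] at this
    exact zero_ne_one this
  obtain ⟨p, hp, h⟩ := exists_poly_of_tangentMap _ _ (surjective_tangentMap_flagList ha) hq0
  refine ⟨p, hp, fun y hy hyp => ?_⟩
  obtain ⟨x, hx, hxy⟩ := h y hy hyp
  exact ⟨matOf x, hq x ▸ hx, _, suppGE_combo_flagList _, hxy⟩

end FlagSpace

section CartanSpace

theorem psi_toTen_eq_zero {l m : TenList} (h : ∀ u ∈ l, ∀ v ∈ m, disjT u.2 v.2 = false)
    {γ : Ten ℂ} (hγ : IsAlt γ) : psi (toTen l) (toTen m) γ = 0 := by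
  have h1 : ∀ u ∈ l, ∀ v ∈ m,
      psi (mono u.2.1 u.2.2.1 u.2.2.2) (mono v.2.1 v.2.2.1 v.2.2.2) γ = 0 := by
    intro u hu v hv
    rw [hγ.eq_sum]
    simp only [map_sum, map_smul, psi_mono]
    refine Finset.sum_eq_zero fun i _ => Finset.sum_eq_zero fun j _ =>
      Finset.sum_eq_zero fun k _ => ?_
    rw [sgnL_eq_zero fun h' => by simp [h u hu v hv] at h']
    simp
  have h2 : ∀ u ∈ l, psi (mono u.2.1 u.2.2.1 u.2.2.2) (toTen m) γ = 0 := by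
    intro u hu
    replace h1 := h1 u hu
    clear h hu
    induction m with
    | nil => simp [toTen_nil]
    | cons v m ih =>
      rw [toTen_cons, map_add, LinearMap.add_apply, map_smul, LinearMap.smul_apply,
        h1 v (by simp), ih fun w hw => h1 w (by simp [hw])]
      simp
  clear h h1
  induction l with
  | nil => simp [toTen_nil]
  | cons u l ih =>
    rw [toTen_cons, map_add, LinearMap.add_apply, LinearMap.add_apply, map_smul,
      LinearMap.smul_apply, LinearMap.smul_apply, h2 u (by simp),
      ih fun w hw => h2 w (by simp [hw])]
    simp

theorem psi_cartan (a b : Fin 4 → ℂ) {γ : Ten ℂ} (hγ : IsAlt γ) :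
    psi (cartan a) (cartan b) γ = 0 := by
  simp only [cartan, map_sum, map_smul, LinearMap.sum_apply, LinearMap.smul_apply]
  refine Finset.sum_eq_zero fun r _ => ?_
  rw [Finset.sum_eq_zero, smul_zero]
  intro s _
  have h : psi (toTen (lineClass s)) (toTen (lineClass r)) γ = 0 := by
    rcases eq_or_ne s r with rfl | h
    · exact psi_self_left
    · exact psi_toTen_eq_zero (by revert s r; decide) hγ
  simp [h]

theorem cartan_injective : Function.Injective (cartan : (Fin 4 → ℂ) → Ten ℂ) := by
  intro a b h
  have h1 : ∀ r : Fin 4, ∃ i j k : Fin 9, ∀ s : Fin 4,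
      evalL (lineClass s) i j k = if s = r then 1 else 0 := by decide +kernel
  ext r
  obtain ⟨i, j, k, h2⟩ := h1 r
  have h3 : ∀ a : Fin 4 → ℂ, cartan a i j k = a r := fun a => by
    simp [cartan, Finset.sum_apply, toTen_apply, h2]
  rw [← h3 a, h, h3]

theorem surjective_tangentMap_lineClass {a : Fin 4 → ℂ} (ha : IsNice (cartan a)) :
    Function.Surjective (tangentMap lineClass a) := by
  have hker : ∀ X b, (X, b) ∈ LinearMap.ker (tangentMap lineClass a) →
      ∃ s : ℂ, (X, b) = s • ((1 : Mat ℂ), (-3 : ℂ) • a) := fun X b h => by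
    rw [LinearMap.mem_ker, tangentMap_apply] at h
    have h1 : der X (cartan a) + cartan b = 0 := IsAlt.eq_of_restr
      (((isAlt_cartan a).der X).add (isAlt_cartan b)) isAlt_zero (h.trans (map_zero _).symm)
    have h2 : der X (cartan a) = -cartan b := eq_neg_of_add_eq_zero_left h1
    obtain ⟨s, rfl⟩ := ha X fun Y => by
      rw [h2, map_neg, LinearMap.neg_apply, psi_cartan _ _ ((isAlt_cartan a).der Y), neg_zero]
    refine ⟨s, Prod.ext rfl (cartan_injective ?_)⟩
    have h3 : ∀ (t : ℂ) (a : Fin 4 → ℂ), cartan (t • a) = t • cartan a := fun t a => by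
      simp [cartan, Finset.smul_sum, mul_smul]
    rw [map_smul, LinearMap.smul_apply, der_one] at h1
    change cartan b = cartan (s • (-3 : ℂ) • a)
    rw [h3, h3]
    rw [eq_neg_of_add_eq_zero_right h1]
    module
  have h1 : Module.finrank ℂ (LinearMap.ker (tangentMap lineClass a)) ≤ 1 :=
    (Submodule.finrank_mono (t := ℂ ∙ ((1 : Mat ℂ), (-3 : ℂ) • a)) fun v hv => by
      obtain ⟨s, hs⟩ := hker v.1 v.2 hv
      exact Submodule.mem_span_singleton.2 ⟨s, hs.symm⟩).trans
      ((finrank_span_le_card _).trans (by simp))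
  have h2 := (tangentMap lineClass a).finrank_range_add_finrank_ker
  rw [Module.finrank_prod, Module.finrank_matrix, Module.finrank_self,
    Module.finrank_fintype_fun_eq_card,
    Fintype.card_fin, Fintype.card_fin] at h2
  rw [← LinearMap.range_eq_top]
  refine Submodule.eq_top_of_finrank_eq (le_antisymm (Submodule.finrank_le _) ?_)
  rw [Module.finrank_fintype_fun_eq_card, card_tri]
  omega

open MvPolynomial

/-- A generic trivector is equivalent to a regular one in the Cartan subspace. -/
theorem exists_poly_cartan {ζ : ℂ} (hζ : IsPrimitiveRoot ζ 3) (him : ζ.im ≠ 0) :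
    ∃ p : MvPolynomial Tri ℂ, p ≠ 0 ∧ ∀ y : Ten ℂ, IsAlt y → eval (restr y) p ≠ 0 →
      ∃ g : Mat ℂ, g.det ≠ 0 ∧ ∃ z, IsAlt z ∧ IsRegular ζ z ∧ act g z = y := by
  obtain ⟨a, ha⟩ := exists_lam_injective hζ him
  have hreg : ∀ b : Fin 4 → ℂ, Function.Injective (lam ζ (cartan b)) → IsRegular ζ (cartan b) :=
    fun b hb => ⟨fun c d => act_heis_cartan hζ.pow_eq_one c d b, hb⟩
  let A : Mat (MvPolynomial ((Fin 9 × Fin 9) ⊕ Fin 4) ℂ) := matOf X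
  let B : Ten (MvPolynomial ((Fin 9 × Fin 9) ⊕ Fin 4) ℂ) := cartan fun i => X (.inr i)
  let q := A.det * ∏ v, ∏ w, if v = w then 1 else lam (C ζ) B v - lam (C ζ) B w
  have hq : ∀ x, eval x q = (matOf x : Mat ℂ).det * ∏ v, ∏ w, if v = w then 1 else
      lam ζ (cartan fun i => x (.inr i)) v - lam ζ (cartan fun i => x (.inr i)) w := fun x => by
    have e : ∀ v, eval x (lam (C ζ) B v) = lam ζ (cartan fun i => x (.inr i)) v := fun v => by
      rw [← lam_mapTen, mapTen_cartan, eval_C]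
      simp
    rw [map_mul, RingHom.map_det]
    simp only [map_prod, apply_ite (eval x), map_one, map_sub, e]
    congr 2
    ext i j
    simp [A, matOf]
  have hq0 : q ≠ 0 := fun h => by
    have := hq (Sum.elim (fun ij => (1 : Mat ℂ) ij.1 ij.2) a)
    rw [h, map_zero] at this
    have e : (matOf (Sum.elim (fun ij => (1 : Mat ℂ) ij.1 ij.2) a)) = 1 := rfl
    rw [e, Matrix.det_one, one_mul] at this
    obtain ⟨v, -, h1⟩ := Finset.prod_eq_zero_iff.1 this.symm
    obtain ⟨w, -, h2⟩ := Finset.prod_eq_zero_iff.1 h1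
    split_ifs at h2 with hvw
    · exact one_ne_zero h2
    · exact hvw (ha (sub_eq_zero.1 h2))
  obtain ⟨p, hp, h⟩ := exists_poly_of_tangentMap _ _
    (surjective_tangentMap_lineClass ((hreg a ha).isNice hζ)) hq0
  refine ⟨p, hp, fun y hy hyp => ?_⟩
  obtain ⟨x, hx, hxy⟩ := h y hy hyp
  rw [hq] at hx
  refine ⟨matOf x, left_ne_zero_of_mul hx, cartan fun i => x (.inr i), isAlt_cartan _,
    hreg _ fun v w hvw => ?_, hxy⟩
  by_contra hne
  have h1 := Finset.prod_ne_zero_iff.1 (Finset.prod_ne_zero_iff.1 (right_ne_zero_of_mul hx) v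
    (Finset.mem_univ _)) w (Finset.mem_univ _)
  rw [if_neg hne] at h1
  exact h1 (sub_eq_zero.2 hvw)

end CartanSpace

section Coefficients

theorem ι_swap (u v : W) : ι ℂ v * ι ℂ u = -(ι ℂ u * ι ℂ v) :=
  eq_neg_of_add_eq_zero_left (ι_add_mul_swap v u)

theorem ιMulti_three (u v w : W) :
    ιMulti ℂ 3 ![u, v, w] = ι ℂ u * ι ℂ v * ι ℂ w := by
  simp [ExteriorAlgebra.ιMulti_apply, mul_assoc]

/-- Linear maps are determined on the third exterior power by their values on products. -/
theorem eqOn_exteriorPower {N : Type*} [AddCommGroup N] [Module ℂ N]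
    {f g : ExteriorAlgebra ℂ W →ₗ[ℂ] N}
    (h : ∀ u v w, f (ι ℂ u * ι ℂ v * ι ℂ w) = g (ι ℂ u * ι ℂ v * ι ℂ w))
    {ω : ExteriorAlgebra ℂ W} (hω : ω ∈ ⋀[ℂ]^3 W) : f ω = g ω := by
  rw [← exteriorPower.ιMulti_span_fixedDegree] at hω
  refine LinearMap.eqOn_span (f := f) (g := g) ?_ hω
  rintro _ ⟨v, rfl⟩
  have : v = ![v 0, v 1, v 2] := by ext i; fin_cases i <;> rfl
  rw [this, ιMulti_three]
  exact h _ _ _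

/-- The determinant of the values of three linear forms. -/
def detAlt (φ : Fin 3 → Module.Dual ℂ W) : W [⋀^Fin 3]→ₗ[ℂ] ℂ :=
  Matrix.detRowAlternating.compLinearMap (LinearMap.pi φ)

/-- The pairing of the exterior algebra with a product of three linear forms. -/
def coef (φ ψ χ : Module.Dual ℂ W) : ExteriorAlgebra ℂ W →ₗ[ℂ] ℂ :=
  liftAlternating (Pi.single 3 (detAlt ![φ, ψ, χ]))

theorem coef_apply (φ ψ χ : Module.Dual ℂ W) (u v w : W) :
    coef φ ψ χ (ι ℂ u * ι ℂ v * ι ℂ w) = φ u * ψ v * χ w - φ u * χ v * ψ w - ψ u * φ v * χ w +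
      ψ u * χ v * φ w + χ u * φ v * ψ w - χ u * ψ v * φ w := by
  rw [← ιMulti_three, coef, liftAlternating_apply_ιMulti, Pi.single_eq_same]
  change (Matrix.of fun i j : Fin 3 => (![φ, ψ, χ] j) (![u, v, w] i)).det = _
  rw [Matrix.det_fin_three]
  simp

theorem coef_swap12 (φ ψ χ : Module.Dual ℂ W) {ω : ExteriorAlgebra ℂ W} (hω : ω ∈ ⋀[ℂ]^3 W) :
    coef ψ φ χ ω = -coef φ ψ χ ω :=
  eqOn_exteriorPower (g := -coef φ ψ χ)
    (fun u v w => by rw [LinearMap.neg_apply, coef_apply, coef_apply]; ring) hω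

theorem coef_swap23 (φ ψ χ : Module.Dual ℂ W) {ω : ExteriorAlgebra ℂ W} (hω : ω ∈ ⋀[ℂ]^3 W) :
    coef φ χ ψ ω = -coef φ ψ χ ω :=
  eqOn_exteriorPower (g := -coef φ ψ χ)
    (fun u v w => by rw [LinearMap.neg_apply, coef_apply, coef_apply]; ring) hω

theorem coef_map {V : Type*} [AddCommGroup V] [Module ℂ V] (f : V →ₗ[ℂ] W)
    (φ ψ χ : Module.Dual ℂ W) {ω : ExteriorAlgebra ℂ V} (hω : ω ∈ ⋀[ℂ]^3 V) :
    coef φ ψ χ (ExteriorAlgebra.map f ω) = coef (φ ∘ₗ f) (ψ ∘ₗ f) (χ ∘ₗ f) ω :=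
  eqOn_exteriorPower (f := coef φ ψ χ ∘ₗ (ExteriorAlgebra.map f).toLinearMap)
    (fun u v w => by
      rw [LinearMap.comp_apply, AlgHom.toLinearMap_apply, map_mul (ExteriorAlgebra.map f),
        map_mul (ExteriorAlgebra.map f), map_apply_ι,
        map_apply_ι, map_apply_ι, coef_apply, coef_apply]
      rfl) hω

/-- Expansion of a trivector in a pair of dual families. -/
theorem sum_coef_smul {b : Fin 9 → W} {φ : Fin 9 → Module.Dual ℂ W}
    (h : ∀ v, ∑ i, φ i v • b i = v) {ω : ExteriorAlgebra ℂ W} (hω : ω ∈ ⋀[ℂ]^3 W) :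
    ∑ i, ∑ j, ∑ k, coef (φ i) (φ j) (φ k) ω • (ι ℂ (b i) * ι ℂ (b j) * ι ℂ (b k)) =
      (6 : ℂ) • ω := by
  have e : ∀ u v w, ∑ i, ∑ j, ∑ k, (φ i u * φ j v * φ k w) •
      (ι ℂ (b i) * ι ℂ (b j) * ι ℂ (b k)) = ι ℂ u * ι ℂ v * ι ℂ w := fun u v w => by
    conv_rhs => rw [← h u, ← h v, ← h w]
    simp only [map_sum, map_smul, Finset.sum_mul, Finset.mul_sum, smul_mul_assoc, mul_smul_comm,
      Finset.smul_sum, smul_smul]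
    refine (Finset.sum_congr rfl fun i _ => Finset.sum_comm).trans ?_
    rw [Finset.sum_comm]
    refine (Finset.sum_congr rfl fun i _ => Finset.sum_comm).trans ?_
    refine Finset.sum_congr rfl fun i _ => Finset.sum_congr rfl fun j _ =>
      Finset.sum_congr rfl fun k _ => ?_
    congr 1
    ring
  refine (?_ : _ = (LinearMap.lsmul ℂ _ 6) ω)
  have := eqOn_exteriorPower (ω := ω) (f := ∑ i, ∑ j, ∑ k, (coef (φ i) (φ j) (φ k)).smulRight
    (ι ℂ (b i) * ι ℂ (b j) * ι ℂ (b k))) (g := LinearMap.lsmul ℂ _ 6) (fun u v w => ?_) hω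
  · rw [← this]
    simp only [LinearMap.sum_apply, LinearMap.smulRight_apply]
  · have e1 := e u v w
    have e2 := e u w v
    have e3 := e v u w
    have e4 := e v w u
    have e5 := e w u v
    have e6 := e w v u
    simp only [LinearMap.sum_apply, LinearMap.smulRight_apply, coef_apply, LinearMap.lsmul_apply]
    have e0 : ∀ i j k, (φ i u * φ j v * φ k w - φ i u * φ k v * φ j w - φ j u * φ i v * φ k w +
      φ j u * φ k v * φ i w + φ k u * φ i v * φ j w - φ k u * φ j v * φ i w) •
      (ι ℂ (b i) * ι ℂ (b j) * ι ℂ (b k)) =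
      (φ i u * φ j v * φ k w) • (ι ℂ (b i) * ι ℂ (b j) * ι ℂ (b k)) -
      (φ i u * φ j w * φ k v) • (ι ℂ (b i) * ι ℂ (b j) * ι ℂ (b k)) -
      (φ i v * φ j u * φ k w) • (ι ℂ (b i) * ι ℂ (b j) * ι ℂ (b k)) +
      (φ i w * φ j u * φ k v) • (ι ℂ (b i) * ι ℂ (b j) * ι ℂ (b k)) +
      (φ i v * φ j w * φ k u) • (ι ℂ (b i) * ι ℂ (b j) * ι ℂ (b k)) -
      (φ i w * φ j v * φ k u) • (ι ℂ (b i) * ι ℂ (b j) * ι ℂ (b k)) := fun i j k => by module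
    simp only [e0, Finset.sum_add_distrib, Finset.sum_sub_distrib, e1, e2, e3, e4, e5, e6]
    have s1 : ι ℂ u * ι ℂ w * ι ℂ v = -(ι ℂ u * ι ℂ v * ι ℂ w) := by
      rw [mul_assoc, ι_swap v w, mul_neg, mul_assoc]
    have s2 : ι ℂ v * ι ℂ u * ι ℂ w = -(ι ℂ u * ι ℂ v * ι ℂ w) := by
      rw [ι_swap u v, neg_mul]
    have s3 : ι ℂ v * ι ℂ w * ι ℂ u = ι ℂ u * ι ℂ v * ι ℂ w := by
      rw [mul_assoc, ι_swap u w, mul_neg, ← mul_assoc, s2, neg_neg]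
    have s4 : ι ℂ w * ι ℂ u * ι ℂ v = ι ℂ u * ι ℂ v * ι ℂ w := by
      rw [ι_swap u w, neg_mul, s1, neg_neg]
    have s5 : ι ℂ w * ι ℂ v * ι ℂ u = -(ι ℂ u * ι ℂ v * ι ℂ w) := by
      rw [ι_swap v w, neg_mul, s3]
    rw [s1, s2, s3, s4, s5]
    module

/-- The linear form with given coefficients. -/
def form (r : V9) : Module.Dual ℂ V9 := dotProductEquiv ℂ (Fin 9) r

theorem form_apply (r v : V9) : form r v = r ⬝ᵥ v := rfl

/-- The tensor of coordinates of a trivector. -/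
def coords : (⋀[ℂ]^3 V9) →ₗ[ℂ] Ten ℂ :=
  LinearMap.pi fun i => LinearMap.pi fun j => LinearMap.pi fun k =>
    coef (form (Pi.single i 1)) (form (Pi.single j 1)) (form (Pi.single k 1)) ∘ₗ
      (⋀[ℂ]^3 V9).subtype

theorem coords_apply (ω : ⋀[ℂ]^3 V9) (i j k : Fin 9) : coords ω i j k =
    coef (form (Pi.single i 1)) (form (Pi.single j 1)) (form (Pi.single k 1)) ω := rfl

theorem isAlt_coords (ω : ⋀[ℂ]^3 V9) : IsAlt (coords ω) :=
  ⟨fun _ _ _ => coef_swap12 _ _ _ ω.2, fun _ _ _ => coef_swap23 _ _ _ ω.2⟩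

theorem act_coords (A : Mat ℂ) (ω : ⋀[ℂ]^3 V9) (i j k : Fin 9) :
    act A (coords ω) i j k = coef (form (A i)) (form (A j)) (form (A k)) ω := by
  let f : ExteriorAlgebra ℂ V9 →ₗ[ℂ] ℂ := ∑ a, A i a • ∑ b, A j b • ∑ c, A k c •
    coef (form (Pi.single a 1)) (form (Pi.single b 1)) (form (Pi.single c 1))
  have : act A (coords ω) i j k = f ω := by
    simp only [f, act_apply, coords_apply, LinearMap.sum_apply, LinearMap.smul_apply, smul_eq_mul]
  rw [this]
  refine eqOn_exteriorPower (fun u v w => ?_) ω.2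
  have e : ∀ u v w : V9, ∑ a, A i a * ∑ b, A j b * ∑ c, A k c * (u a * v b * w c) =
      (A i ⬝ᵥ u) * (A j ⬝ᵥ v) * (A k ⬝ᵥ w) := fun u v w => by
    simp only [dotProduct, Finset.sum_mul, Finset.mul_sum]
    refine (Finset.sum_congr rfl fun i _ => Finset.sum_comm).trans ?_
    rw [Finset.sum_comm]
    refine (Finset.sum_congr rfl fun i _ => Finset.sum_comm).trans ?_
    refine Finset.sum_congr rfl fun i _ => Finset.sum_congr rfl fun j _ =>
      Finset.sum_congr rfl fun k _ => ?_
    ring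
  simp only [f, LinearMap.sum_apply, LinearMap.smul_apply, smul_eq_mul, coef_apply, form_apply,
    single_one_dotProduct]
  have e0 : ∀ a b c, u a * v b * w c - u a * v c * w b - u b * v a * w c +
      u b * v c * w a + u c * v a * w b - u c * v b * w a = u a * v b * w c - u a * w b * v c -
      v a * u b * w c + w a * u b * v c + v a * w b * u c - w a * v b * u c := fun a b c => by ring
  simp only [e0, mul_add, mul_sub, Finset.sum_add_distrib, Finset.sum_sub_distrib, e]
  ring

theorem exists_coords_eq {y : Ten ℂ} (hy : IsAlt y) : ∃ ω, coords ω = y := by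
  let E : Fin 9 → V9 := fun a => Pi.single a 1
  have h : ∀ a b c, coords (exteriorPower.ιMulti ℂ 3 ![E a, E b, E c]) = mono a b c :=
    fun a b c => by
      ext i j k
      rw [coords_apply, exteriorPower.ιMulti_apply_coe, ιMulti_three, coef_apply]
      simp only [form_apply, single_one_dotProduct, E, mono, monoZ, Pi.single_apply]
      have e : ∀ p q r : Prop, ∀ [Decidable p] [Decidable q] [Decidable r],
          (((if p ∧ q ∧ r then 1 else 0 : ℤ)) : ℂ) =
            (if p then 1 else 0) * (if q then 1 else 0) * (if r then 1 else 0) := by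
        intros
        simp only [ite_and]
        split_ifs <;> simp
      simp only [Int.cast_add, Int.cast_sub, e]
      ring
  refine ⟨∑ a, ∑ b, ∑ c, (y a b c / 6) • exteriorPower.ιMulti ℂ 3 ![E a, E b, E c], ?_⟩
  conv_rhs => rw [hy.eq_sum]
  simp only [map_sum, map_smul, h]

theorem isPolyFun_eval (p : MvPolynomial Tri ℂ) :
    IsPolyFun fun ω : ⋀[ℂ]^3 V9 => MvPolynomial.eval (restr (coords ω)) p := by
  unfold IsPolyFun
  induction p using MvPolynomial.induction_on with
  | C a =>
    simp only [MvPolynomial.eval_C]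
    exact Subalgebra.algebraMap_mem _ a
  | add p q hp hq =>
    simp only [map_add]
    exact add_mem hp hq
  | mul_X p t hp =>
    simp only [map_mul, MvPolynomial.eval_X]
    exact mul_mem hp (Algebra.subset_adjoin ⟨LinearMap.proj t ∘ₗ restr ∘ₗ coords, rfl⟩)

theorem exists_eval_coords_ne_zero {p : MvPolynomial Tri ℂ} (hp : p ≠ 0) :
    ∃ ω : ⋀[ℂ]^3 V9, MvPolynomial.eval (restr (coords ω)) p ≠ 0 := by
  obtain ⟨y, hy⟩ : ∃ y, MvPolynomial.eval y p ≠ 0 := by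
    by_contra! h
    exact hp (MvPolynomial.funext fun y => by rw [h, map_zero])
  let L : Tri → TenList := fun t => [(1, t.1)]
  obtain ⟨ω, hω⟩ := exists_coords_eq (isAlt_combo L y)
  refine ⟨ω, ?_⟩
  rw [hω]
  convert hy
  ext t
  rw [restr_apply, combo_apply]
  simp only [Finset.sum_apply, Pi.smul_apply, smul_eq_mul]
  rw [Finset.sum_eq_single t]
  · simp [L, toTen_apply, evalL, monoZ_of_sorted]
  · intro u _ hu
    simp [L, toTen_apply, evalL, monoZ_of_sorted, hu.symm]
  · simp

end Coefficients

section Flags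

theorem exists_linearIndependent_mem [FiniteDimensional ℂ W] {n : ℕ} (G : Fin n → Submodule ℂ W)
    (hG : ∀ i : Fin n, (i : ℕ) < Module.finrank ℂ (G i)) :
    ∃ b : Fin n → W, LinearIndependent ℂ b ∧ ∀ i, b i ∈ G i := by
  induction n with
  | zero => exact ⟨0, linearIndependent_empty_type, fun i => i.elim0⟩
  | succ n ih =>
    obtain ⟨b, hb, hbG⟩ := ih (fun i => G i.castSucc) fun i => hG i.castSucc
    obtain ⟨v, hv, hvb⟩ : ∃ v ∈ G (Fin.last n), v ∉ Submodule.span ℂ (Set.range b) := by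
      by_contra! h
      have h1 := Submodule.finrank_mono (show G (Fin.last n) ≤ _ from h)
      have h2 := hG (Fin.last n)
      rw [finrank_span_eq_card hb, Fintype.card_fin] at h1
      rw [Fin.val_last] at h2
      omega
    refine ⟨Fin.snoc b v, linearIndependent_finSnoc.2 ⟨hb, hvb⟩, fun i => ?_⟩
    refine Fin.lastCases ?_ (fun i => ?_) i
    · rwa [Fin.snoc_last]
    · rw [Fin.snoc_castSucc]
      exact hbG i

theorem coef_eq_zero {Φ : Fin 9 → Module.Dual ℂ W} {S T U : Submodule ℂ W} {p q r : ℤ}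
    (hS : ∀ i, i ≠ 0 → flagWt i < p → ∀ s ∈ S, Φ i s = 0)
    (hT : ∀ i, i ≠ 0 → flagWt i < q → ∀ s ∈ T, Φ i s = 0)
    (hU : ∀ i, i ≠ 0 → flagWt i < r → ∀ s ∈ U, Φ i s = 0) (hpqr : 0 ≤ p + q + r)
    {i j k : Fin 9} (hi : i ≠ 0) (hj : j ≠ 0) (hk : k ≠ 0)
    (h : flagWt i + flagWt j + flagWt k < 0) {x : ExteriorAlgebra ℂ W} (hx : x ∈ wSpan S T U) :
    coef (Φ i) (Φ j) (Φ k) x = 0 := by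
  refine (Submodule.span_le.2 ?_ hx : x ∈ LinearMap.ker (coef (Φ i) (Φ j) (Φ k)))
  rintro _ ⟨s, hs, t, ht, u, hu, rfl⟩
  rw [SetLike.mem_coe, LinearMap.mem_ker, coef_apply]
  have e : ∀ a b c : Fin 9, a ≠ 0 → b ≠ 0 → c ≠ 0 → flagWt a + flagWt b + flagWt c < 0 →
      Φ a s * Φ b t * Φ c u = 0 := fun a b c ha hb hc habc => by
    rcases lt_or_ge (flagWt a) p with h1 | h1
    · simp [hS a ha h1 s hs]
    rcases lt_or_ge (flagWt b) q with h2 | h2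
    · simp [hT b hb h2 t ht]
    rcases lt_or_ge (flagWt c) r with h3 | h3
    · simp [hU c hc h3 u hu]
    omega
  rw [e i j k hi hj hk h, e i k j hi hk hj (by omega), e j i k hj hi hk (by omega),
    e j k i hj hk hi (by omega), e k i j hk hi hj (by omega), e k j i hk hj hi (by omega)]
  ring

/-- The row vectors vanishing on the preimage of a subspace of a quotient. -/
def ann {V₁ : Submodule ℂ V9} (U : Submodule ℂ (V9 ⧸ V₁)) : Submodule ℂ V9 :=
  (U.comap V₁.mkQ).dualAnnihilator.comap (dotProductEquiv ℂ (Fin 9)).toLinearMap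

variable {V₁ : Submodule ℂ V9}

theorem mem_ann {U : Submodule ℂ (V9 ⧸ V₁)} {r : V9} :
    r ∈ ann U ↔ ∀ v, V₁.mkQ v ∈ U → form r v = 0 := by
  rw [ann, Submodule.mem_comap, Submodule.mem_dualAnnihilator]
  rfl

theorem ann_anti {U U' : Submodule ℂ (V9 ⧸ V₁)} (h : U ≤ U') : ann U' ≤ ann U :=
  fun _ hr => mem_ann.2 fun v hv => mem_ann.1 hr v (h hv)

theorem finrank_ann (h : Module.finrank ℂ V₁ = 1) (U : Submodule ℂ (V9 ⧸ V₁)) :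
    Module.finrank ℂ (ann U) + Module.finrank ℂ U = 8 := by
  have h9 : Module.finrank ℂ V9 = 9 := by simp
  have h1 : Module.finrank ℂ (ann U) = Module.finrank ℂ (U.comap V₁.mkQ).dualAnnihilator :=
    LinearEquiv.finrank_eq ((dotProductEquiv ℂ (Fin 9)).ofSubmodule' _)
  have h2 := Subspace.finrank_add_finrank_dualAnnihilator_eq (U.comap V₁.mkQ)
  have h3 := (U.mkQ ∘ₗ V₁.mkQ).finrank_range_add_finrank_ker
  have h4 : LinearMap.range (U.mkQ ∘ₗ V₁.mkQ) = ⊤ :=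
    LinearMap.range_eq_top.2 (U.mkQ_surjective.comp V₁.mkQ_surjective)
  have h5 : LinearMap.ker (U.mkQ ∘ₗ V₁.mkQ) = U.comap V₁.mkQ := by
    rw [LinearMap.ker_comp, Submodule.ker_mkQ]
  rw [h4, h5, finrank_top] at h3
  have h6 := Submodule.finrank_quotient_add_finrank U
  have h7 := Submodule.finrank_quotient_add_finrank V₁
  omega

/-- A flag for which the trivector is degenerate provides an adapted basis. -/
theorem exists_suppGE_of_flag {ω : ⋀[ℂ]^3 V9} (hV : Module.finrank ℂ V₁ = 1)
    {U₂ U₅ U₇ : Submodule ℂ (V9 ⧸ V₁)} (h25 : U₂ ≤ U₅) (h57 : U₅ ≤ U₇)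
    (h2 : Module.finrank ℂ U₂ = 2) (h5 : Module.finrank ℂ U₅ = 5) (h7 : Module.finrank ℂ U₇ = 7)
    (hω : ExteriorAlgebra.map V₁.mkQ (ω : ExteriorAlgebra ℂ V9) ∈
      wSpan U₂ U₂ ⊤ ⊔ wSpan U₂ U₅ U₇ ⊔ wSpan U₅ U₅ U₅) :
    ∃ A B : Mat ℂ, A * B = 1 ∧ SuppGE flagWt 0 (act A (coords ω)) ∧
      V₁ = ℂ ∙ (fun i => B i 0) := by
  obtain ⟨b, hb, hbG⟩ := exists_linearIndependent_mem
    ![ann U₇, ann U₅, ann U₅, ann U₂, ann U₂, ann U₂, ann (⊥ : Submodule ℂ (V9 ⧸ V₁)),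
      ann (⊥ : Submodule ℂ (V9 ⧸ V₁)), ⊤] (by
    have e2 := finrank_ann hV U₂
    have e5 := finrank_ann hV U₅
    have e7 := finrank_ann hV U₇
    have e0 := finrank_ann hV ⊥
    rw [finrank_bot] at e0
    intro i
    fin_cases i
    exacts [show 0 < Module.finrank ℂ (ann U₇) by omega,
      show 1 < Module.finrank ℂ (ann U₅) by omega,
      show 2 < Module.finrank ℂ (ann U₅) by omega, show 3 < Module.finrank ℂ (ann U₂) by omega,
      show 4 < Module.finrank ℂ (ann U₂) by omega, show 5 < Module.finrank ℂ (ann U₂) by omega,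
      show 6 < Module.finrank ℂ (ann (⊥ : Submodule ℂ (V9 ⧸ V₁))) by omega,
      show 7 < Module.finrank ℂ (ann (⊥ : Submodule ℂ (V9 ⧸ V₁))) by omega,
      show 8 < Module.finrank ℂ (⊤ : Submodule ℂ V9) by simp])
  let A : Mat ℂ := fun i => b (![8, 6, 3, 7, 4, 1, 5, 2, 0] i)
  have hAu : IsUnit A := Matrix.linearIndependent_rows_iff_isUnit.1
    (hb.comp (![8, 6, 3, 7, 4, 1, 5, 2, 0] : Fin 9 → Fin 9) (by decide))
  obtain ⟨B, hAB⟩ := hAu.exists_right_inv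
  have hBA : B * A = 1 := mul_eq_one_comm.1 hAB
  have a7 : ∀ i, i ≠ 0 → flagWt i < -1 → A i ∈ ann U₇ := by
    intro i
    fin_cases i <;> simp [flagWt]
    exact hbG 0
  have a5 : ∀ i, i ≠ 0 → flagWt i < 0 → A i ∈ ann U₅ := by
    intro i
    fin_cases i <;> simp [flagWt]
    exacts [hbG 1, hbG 2, ann_anti h57 (hbG 0)]
  have a2 : ∀ i, i ≠ 0 → flagWt i < 1 → A i ∈ ann U₂ := by
    intro i
    fin_cases i <;> simp [flagWt]
    exacts [hbG 3, hbG 4, ann_anti h25 (hbG 1), hbG 5, ann_anti h25 (hbG 2),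
      ann_anti (h25.trans h57) (hbG 0)]
  have a0 : ∀ i, i ≠ 0 → A i ∈ ann (⊥ : Submodule ℂ (V9 ⧸ V₁)) := by
    intro i
    fin_cases i <;> simp
    exacts [hbG 6, ann_anti bot_le (hbG 3), hbG 7, ann_anti bot_le (hbG 4),
      ann_anti bot_le (hbG 1), ann_anti bot_le (hbG 5), ann_anti bot_le (hbG 2),
      ann_anti bot_le (hbG 0)]
  have hA0 : ∀ i, i ≠ 0 → V₁ ≤ LinearMap.ker (form (A i)) := fun i hi v hv =>
    mem_ann.1 (a0 i hi) v (by simpa using hv)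
  refine ⟨A, B, hAB, ?_, ?_⟩
  · refine suppGE_of_sorted ((isAlt_coords ω).act A) fun i j k hij hjk h => ?_
    have hi : i ≠ 0 := by
      rintro rfl
      revert j k
      decide
    have hj : j ≠ 0 := (lt_of_le_of_lt (Fin.zero_le i) hij).ne'
    have hk : k ≠ 0 := (lt_of_le_of_lt (Fin.zero_le j) hjk).ne'
    classical
    let Φ : Fin 9 → Module.Dual ℂ (V9 ⧸ V₁) := fun i =>
      if h : V₁ ≤ LinearMap.ker (form (A i)) then V₁.liftQ _ h else 0
    have hΦ : ∀ i, i ≠ 0 → Φ i ∘ₗ V₁.mkQ = form (A i) := fun i hi => by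
      simp only [Φ]
      rw [dif_pos (hA0 i hi), Submodule.liftQ_mkQ]
    have hΦU : ∀ (U : Submodule ℂ (V9 ⧸ V₁)) (p : ℤ), (∀ i, i ≠ 0 → flagWt i < p → A i ∈ ann U) →
        ∀ i, i ≠ 0 → flagWt i < p → ∀ s ∈ U, Φ i s = 0 := fun U p h i hi hip s hs => by
      obtain ⟨v, rfl⟩ := V₁.mkQ_surjective s
      rw [← LinearMap.comp_apply, hΦ i hi]
      exact mem_ann.1 (h i hi hip) v hs
    have l2 := hΦU U₂ 1 a2
    have l5 := hΦU U₅ 0 a5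
    have l7 := hΦU U₇ (-1) a7
    have l8 : ∀ i, i ≠ 0 → flagWt i < -2 → ∀ s ∈ (⊤ : Submodule ℂ (V9 ⧸ V₁)), Φ i s = 0 :=
      fun i _ h => absurd h (by revert i; decide)
    rw [act_coords, ← hΦ i hi, ← hΦ j hj, ← hΦ k hk, ← coef_map _ _ _ _ ω.2]
    obtain ⟨y, hy, z, hz, hyz⟩ := Submodule.mem_sup.1 hω
    obtain ⟨u, hu, v, hv, rfl⟩ := Submodule.mem_sup.1 hy
    rw [← hyz, map_add, map_add, coef_eq_zero l2 l2 l8 (by norm_num) hi hj hk h hu,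
      coef_eq_zero l2 l5 l7 (by norm_num) hi hj hk h hv,
      coef_eq_zero l5 l5 l5 (by norm_num) hi hj hk h hz, add_zero, add_zero]
  · have hle : V₁ ≤ ℂ ∙ (fun i => B i 0) := fun v hv => by
      refine Submodule.mem_span_singleton.2 ⟨A.mulVec v 0, ?_⟩
      have h1 : A.mulVec v = Pi.single 0 (A.mulVec v 0) := by
        ext i
        rcases eq_or_ne i 0 with rfl | hi
        · rw [Pi.single_eq_same]
        · rw [Pi.single_eq_of_ne hi]
          exact hA0 i hi hv
      have h2 : B.mulVec (A.mulVec v) = v := by rw [Matrix.mulVec_mulVec, hBA, Matrix.one_mulVec]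
      rw [h1, Matrix.mulVec_single] at h2
      ext i
      rw [← congrFun h2 i]
      simp [mul_comm]
    refine Submodule.eq_of_le_of_finrank_le hle ?_
    rw [hV]
    exact (finrank_span_le_card _).trans (by simp)

theorem mem_of_sorted {w : Fin 9 → ℤ} {P : Fin 9 → Fin 9 → Fin 9 → Prop}
    (h12 : ∀ a b c, P a b c → P b a c) (h23 : ∀ a b c, P a b c → P a c b)
    (h : ∀ a b c, w b ≤ w a → w c ≤ w b → P a b c) (a b c : Fin 9) : P a b c := by
  rcases le_total (w a) (w b) with h1 | h1 <;> rcases le_total (w b) (w c) with h2 | h2 <;>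
    rcases le_total (w a) (w c) with h3 | h3
  · exact h12 _ _ _ (h23 _ _ _ (h12 _ _ _ (h c b a h2 h1)))
  · exact h12 _ _ _ (h23 _ _ _ (h12 _ _ _ (h c b a h2 h1)))
  · exact h12 _ _ _ (h23 _ _ _ (h b c a h2 h3))
  · exact h12 _ _ _ (h b a c h1 h3)
  · exact h23 _ _ _ (h12 _ _ _ (h c a b h3 h1))
  · exact h23 _ _ _ (h a c b h3 h2)
  · exact h a b c h1 h2
  · exact h a b c h1 h2

/-- An adapted basis provides a flag for which the trivector is degenerate. -/
theorem exists_flag_of_suppGE {ω : ⋀[ℂ]^3 V9} {A B : Mat ℂ} (hAB : A * B = 1)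
    (hA : SuppGE flagWt 0 (act A (coords ω))) (hV : V₁ = ℂ ∙ (fun i => B i 0)) :
    Module.finrank ℂ V₁ = 1 ∧ ∃ U₂ U₅ U₇ : Submodule ℂ (V9 ⧸ V₁), U₂ ≤ U₅ ∧ U₅ ≤ U₇ ∧
      Module.finrank ℂ U₂ = 2 ∧ Module.finrank ℂ U₅ = 5 ∧ Module.finrank ℂ U₇ = 7 ∧
      ExteriorAlgebra.map V₁.mkQ (ω : ExteriorAlgebra ℂ V9) ∈
        wSpan U₂ U₂ ⊤ ⊔ wSpan U₂ U₅ U₇ ⊔ wSpan U₅ U₅ U₅ := by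
  have hBA : B * A = 1 := mul_eq_one_comm.1 hAB
  let b : Fin 9 → V9 := fun j i => B i j
  have hb : LinearIndependent ℂ b := by
    have : IsUnit B := IsUnit.of_mul_eq_one _ hBA
    exact Matrix.linearIndependent_cols_iff_isUnit.2 this
  have hV' : V₁ = ℂ ∙ b 0 := hV
  have hq0 : V₁.mkQ (b 0) = 0 := by
    rw [Submodule.mkQ_apply, Submodule.Quotient.mk_eq_zero, hV']
    exact Submodule.mem_span_singleton_self _
  have hq : LinearIndependent ℂ fun i : {i : Fin 9 // i ≠ 0} => V₁.mkQ (b i) := by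
    refine (hb.comp _ Subtype.val_injective).map (f := V₁.mkQ) ?_
    rw [Submodule.ker_mkQ, hV']
    have := hb.disjoint_span_image (s := {i | i ≠ 0}) (t := {0}) (by simp)
    rw [Set.image_singleton] at this
    rw [Set.range_comp]
    have hr : Set.range (Subtype.val : {i : Fin 9 // i ≠ 0} → Fin 9) = {i | i ≠ 0} :=
      Subtype.range_val
    exact (congrArg (fun s => Disjoint (Submodule.span ℂ (b '' s)) (ℂ ∙ b 0)) hr).mpr this
  let U : ℤ → Submodule ℂ (V9 ⧸ V₁) := fun p =>
    Submodule.span ℂ (Set.range fun i : {i : Fin 9 // i ≠ 0 ∧ p ≤ flagWt i} => V₁.mkQ (b i))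
  have hU : ∀ p, Module.finrank ℂ (U p) = Fintype.card {i : Fin 9 // i ≠ 0 ∧ p ≤ flagWt i} :=
    fun p => finrank_span_eq_card (hq.comp (fun i : {i : Fin 9 // i ≠ 0 ∧ p ≤ flagWt i} =>
      (⟨i.1, i.2.1⟩ : {i : Fin 9 // i ≠ 0})) fun i j h => Subtype.ext (Subtype.mk.inj h))
  have hmono : ∀ p q, q ≤ p → U p ≤ U q := fun p q h => Submodule.span_mono (by
    rintro _ ⟨i, rfl⟩
    exact ⟨⟨i.1, i.2.1, h.trans i.2.2⟩, rfl⟩)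
  have hmem : ∀ p i, i ≠ 0 → p ≤ flagWt i → V₁.mkQ (b i) ∈ U p := fun p i hi h =>
    Submodule.subset_span ⟨⟨i, hi, h⟩, rfl⟩
  refine ⟨?_, U 1, U 0, U (-1), hmono _ _ (by norm_num), hmono _ _ (by norm_num),
    (hU _).trans (by decide),
    (hU _).trans (by decide), (hU _).trans (by decide), ?_⟩
  · rw [hV']
    exact finrank_span_singleton (hb.ne_zero 0)
  set M := wSpan (U 1) (U 1) ⊤ ⊔ wSpan (U 1) (U 0) (U (-1)) ⊔ wSpan (U 0) (U 0) (U 0) with hM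
  have hgen : ∀ i j k, 0 ≤ flagWt i + flagWt j + flagWt k →
      ι ℂ (V₁.mkQ (b i)) * ι ℂ (V₁.mkQ (b j)) * ι ℂ (V₁.mkQ (b k)) ∈ M := by
    refine mem_of_sorted (w := flagWt) ?_ ?_ ?_
    · intro i j k h h'
      rw [ι_swap, neg_mul]
      exact neg_mem (h (by omega))
    · intro i j k h h'
      rw [mul_assoc, ι_swap, mul_neg, ← mul_assoc]
      exact neg_mem (h (by omega))
    · intro i j k hij hjk h
      rcases eq_or_ne i 0 with rfl | hi
      · rw [hq0, map_zero, zero_mul, zero_mul]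
        exact zero_mem _
      rcases eq_or_ne j 0 with rfl | hj
      · rw [hq0, map_zero, mul_zero, zero_mul]
        exact zero_mem _
      rcases eq_or_ne k 0 with rfl | hk
      · rw [hq0, map_zero, mul_zero]
        exact zero_mem _
      have hcase : (1 ≤ flagWt i ∧ 1 ≤ flagWt j) ∨
          (1 ≤ flagWt i ∧ 0 ≤ flagWt j ∧ -1 ≤ flagWt k) ∨
          (0 ≤ flagWt i ∧ 0 ≤ flagWt j ∧ 0 ≤ flagWt k) := by
        have : ∀ i : Fin 9, i ≠ 0 → flagWt i ≤ 1 := by decide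
        have := this i hi
        omega
      rcases hcase with ⟨h1, h2⟩ | ⟨h1, h2, h3⟩ | ⟨h1, h2, h3⟩
      · exact Submodule.mem_sup_left (Submodule.mem_sup_left (Submodule.subset_span
          ⟨_, hmem _ i hi h1, _, hmem _ j hj h2, _, Submodule.mem_top, rfl⟩))
      · exact Submodule.mem_sup_left (Submodule.mem_sup_right (Submodule.subset_span
          ⟨_, hmem _ i hi h1, _, hmem _ j hj h2, _, hmem _ k hk h3, rfl⟩))
      · exact Submodule.mem_sup_right (Submodule.subset_span
          ⟨_, hmem _ i hi h1, _, hmem _ j hj h2, _, hmem _ k hk h3, rfl⟩)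
  have hexp := sum_coef_smul (b := b) (φ := fun i => form (A i)) (fun v => by
    have h2 : B.mulVec (A.mulVec v) = v := by rw [Matrix.mulVec_mulVec, hBA, Matrix.one_mulVec]
    conv_rhs => rw [← h2]
    ext i
    simp [b, Matrix.mulVec, dotProduct, form_apply, mul_comm]) ω.2
  have h6 : (6 : ℂ) • ExteriorAlgebra.map V₁.mkQ (ω : ExteriorAlgebra ℂ V9) ∈ M := by
    rw [← map_smul, ← hexp]
    simp only [map_sum, map_smul, map_mul, map_apply_ι, ← act_coords]
    refine Submodule.sum_mem _ fun i _ => Submodule.sum_mem _ fun j _ =>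
      Submodule.sum_mem _ fun k _ => ?_
    rcases lt_or_ge (flagWt i + flagWt j + flagWt k) 0 with h | h
    · rw [hA _ _ _ h, zero_smul]
      exact zero_mem _
    · exact M.smul_mem _ (hgen i j k h)
  exact (M.smul_mem_iff (by norm_num)).1 h6

end Flags

section Lines

theorem suppGE_flagWt_slice (c : Fin 4 → ℂ) : SuppGE flagWt 0 (slice c) :=
  (suppGE_toTen (by decide)).add
    ((((((suppGE_mono _ _ _ _).mono (by decide)).smul _).add
    (((suppGE_mono _ _ _ _).mono (by decide)).smul _)).add
    (((suppGE_mono _ _ _ _).mono (by decide)).smul _)).add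
    (((suppGE_mono _ _ _ _).mono (by decide)).smul _))

theorem exists_act_eq_slice_of_suppGE {x : Ten ℂ} (hx : IsAlt x) (hn : IsNice x) {A B : Mat ℂ}
    (hAB : A * B = 1) (h : SuppGE flagWt 0 (act A x)) :
    ∃ A' B' : Mat ℂ, A' * B' = 1 ∧ A'.det = 1 ∧
      (ℂ ∙ (fun i => B i 0) : Submodule ℂ V9) = ℂ ∙ (fun i => B' i 0) ∧
      ∃ c, act A' x = slice c := by
  have hd : A.det * B.det = 1 := by rw [← Matrix.det_mul, hAB, Matrix.det_one]
  have hB : B.det ≠ 0 := right_ne_zero_of_mul_eq_one hd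
  obtain ⟨D, hD, hD0, c, hc⟩ := exists_normal_form (hx.act A) (hn.act hAB) h hB
  have hDu : IsUnit D.det := by rw [hD]; exact hB.isUnit
  have hD00 : D 0 0 ≠ 0 := fun h0 => hB (by
    rw [← hD]
    refine Matrix.det_eq_zero_of_column_eq_zero 0 fun i => ?_
    rcases eq_or_ne i 0 with rfl | hi
    · exact h0
    · exact hD0 i hi)
  refine ⟨D * A, B * D⁻¹, ?_, ?_, ?_, c, ?_⟩
  · rw [mul_assoc, ← mul_assoc A, hAB, one_mul, Matrix.mul_nonsing_inv _ hDu]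
  · rw [Matrix.det_mul, hD, mul_comm, hd]
  · have hcol : (fun i => B i 0) = D 0 0 • fun i => (B * D⁻¹) i 0 := by
      ext i
      have e : B = B * D⁻¹ * D := by rw [mul_assoc, Matrix.nonsing_inv_mul _ hDu, mul_one]
      conv_lhs => rw [e, Matrix.mul_apply]
      rw [Finset.sum_eq_single 0 (fun k _ hk => by rw [hD0 k hk, mul_zero]) (by simp), mul_comm]
      rfl
    rw [hcol, Submodule.span_singleton_smul_eq hD00.isUnit]
  · rw [act_mul, hc]

theorem heis_injective {ζ : ℂ} (hζ : IsPrimitiveRoot ζ 3) {v w : Fin 9 × Fin 9} {μ : ℂ}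
    (h : heis ζ w.1 w.2 = μ • heis ζ v.1 v.2) : v = w := by
  have h0 : ∀ a : Fin 9, tAdd 0 a = a := by decide
  have hz : ∀ b : Fin 9, tDot b 0 = 0 := by decide
  have entry : ∀ y x, heis ζ w.1 w.2 y x = μ * heis ζ v.1 v.2 y x := fun y x => by
    rw [h]
    rfl
  have e1 := entry w.1 0
  rw [heis_apply, heis_apply, h0, h0, hz, hz, if_pos rfl, pow_zero] at e1
  have h1 : w.1 = v.1 := by
    by_contra hne
    rw [if_neg hne, mul_zero] at e1
    exact one_ne_zero e1
  rw [if_pos h1, mul_one] at e1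
  have key : ∀ x, tDot w.2 x < 3 → tDot v.2 x < 3 → tDot w.2 x = tDot v.2 x := fun x hw hv => by
    have := entry (tAdd x w.1) x
    rw [← e1, one_mul, heis_apply, heis_apply, h1, if_pos rfl, if_pos rfl] at this
    exact hζ.pow_inj hw hv this
  have k1 := key 1
  have k3 := key 3
  refine Prod.ext h1.symm ?_
  generalize w.2 = b at k1 k3
  generalize v.2 = d at k1 k3
  clear * - k1 k3
  revert b d
  decide +kernel

/-- A generic trivector is degenerate along exactly 81 lines. -/
theorem encard_lines {ζ : ℂ} (hζ : IsPrimitiveRoot ζ 3) {x z y : Ten ℂ} {g h : Mat ℂ}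
    (hx : IsAlt x) (hg : g.det ≠ 0) (hz : IsRegular ζ z) (hgz : act g z = x) (hh : h.det ≠ 0)
    (hy : SuppGE flagWt 0 y) (hhy : act h y = x) :
    {V : Submodule ℂ V9 | ∃ A B : Mat ℂ, A * B = 1 ∧ SuppGE flagWt 0 (act A x) ∧
      V = ℂ ∙ (fun i => B i 0)}.encard = 81 := by
  have h3 : ζ ^ 3 = 1 := hζ.pow_eq_one
  obtain ⟨gi, hggi⟩ : ∃ gi, g * gi = 1 := ⟨g⁻¹, Matrix.mul_nonsing_inv _ hg.isUnit⟩
  have hgig : gi * g = 1 := mul_eq_one_comm.1 hggi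
  have hgix : act gi x = z := by rw [← hgz, ← act_mul, hgig, act_one]
  have hn : IsNice x := hgz ▸ (hz.isNice hζ).act hggi
  obtain ⟨A₀, C₀, hAC, hA₀, -, c₀, hc₀⟩ := exists_act_eq_slice_of_suppGE hx hn
    (Matrix.nonsing_inv_mul h hh.isUnit) (by
      rwa [← hhy, ← act_mul, Matrix.nonsing_inv_mul h hh.isUnit, act_one])
  have hCA : C₀ * A₀ = 1 := mul_eq_one_comm.1 hAC
  have hCx : act C₀ (slice c₀) = x := by rw [← hc₀, ← act_mul, hCA, act_one]
  let P : Fin 9 × Fin 9 → Mat ℂ := fun v => g * heis ζ v.1 v.2 * (gi * C₀)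
  let Q : Fin 9 × Fin 9 → Mat ℂ := fun v => A₀ * g * heisInv ζ v.1 v.2 * gi
  have hPQ : ∀ v, P v * Q v = 1 := fun v => by
    calc P v * Q v = g * heis ζ v.1 v.2 * (gi * (C₀ * A₀) * g) * heisInv ζ v.1 v.2 * gi := by
          simp only [P, Q, mul_assoc]
      _ = g * (heis ζ v.1 v.2 * heisInv ζ v.1 v.2) * gi := by
          rw [hCA, mul_one, hgig, mul_one, mul_assoc g]
      _ = 1 := by rw [heis_mul_heisInv h3, mul_one, hggi]
  have hQP : ∀ v, Q v * P v = 1 := fun v => mul_eq_one_comm.1 (hPQ v)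
  have hQx : ∀ v, act (Q v) x = slice c₀ := fun v => by
    have e : act (heisInv ζ v.1 v.2) z = z := by
      conv_lhs => rw [← hz.act_heis v.1 v.2]
      rw [← act_mul, mul_eq_one_comm.1 (heis_mul_heisInv h3 _ _), act_one]
    simp only [Q, act_mul]
    rw [hgix, e, hgz, hc₀]
  have hrange : {V : Submodule ℂ V9 | ∃ A B : Mat ℂ, A * B = 1 ∧ SuppGE flagWt 0 (act A x) ∧
      V = ℂ ∙ (fun i => B i 0)} = Set.range fun v => (ℂ ∙ (fun i => P v i 0) : Submodule ℂ V9) := by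
    ext V
    constructor
    · rintro ⟨A, B, hAB, hA, rfl⟩
      obtain ⟨A₁, C₁, hAC₁, hA₁, hspan, c, hc⟩ := exists_act_eq_slice_of_suppGE hx hn hAB hA
      have hCA₁ : C₁ * A₁ = 1 := mul_eq_one_comm.1 hAC₁
      have hdC₁ : C₁.det = 1 := by
        have := congrArg Matrix.det hAC₁
        rwa [Matrix.det_mul, hA₁, one_mul, Matrix.det_one] at this
      have hdC : C₀.det = 1 := by
        have := congrArg Matrix.det hAC
        rwa [Matrix.det_mul, hA₀, one_mul, Matrix.det_one] at this
      have hdg : gi.det * g.det = 1 := by rw [← Matrix.det_mul, hgig, Matrix.det_one]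
      have hcc : c₀ = c := by
        refine eq_of_act_slice (g := A₁ * C₀) (h := A₀ * C₁) ?_ ?_ ?_ ?_ inv_slice_single_ne_zero
        · rw [mul_assoc, ← mul_assoc C₀, hCA, one_mul, hAC₁]
        · rw [mul_assoc, ← mul_assoc C₁, hCA₁, one_mul, hAC]
        · rw [Matrix.det_mul, hA₁, hdC, one_mul]
        · rw [act_mul, hCx, hc]
      have hC₁x : act C₁ (slice c₀) = x := by rw [hcc, ← hc, ← act_mul, hCA₁, act_one]
      obtain ⟨v, r, hN⟩ := hz.eq_smul_heis hζ (g := gi * C₁ * A₀ * g) (by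
        simp only [Matrix.det_mul, hdC₁, hA₀, mul_one, hdg]) (by
        simp only [act_mul]
        rw [hgz, hc₀, hC₁x, hgix])
      have hC₁ : C₁ = r • P v := by
        calc C₁ = (g * gi) * C₁ * (A₀ * (g * gi) * C₀) := by
              rw [hggi, one_mul, mul_one, hAC, mul_one]
          _ = g * (gi * C₁ * A₀ * g) * (gi * C₀) := by simp only [mul_assoc]
          _ = r • P v := by rw [hN, mul_smul_comm, smul_mul_assoc]
      have hr : r ≠ 0 := by
        rintro rfl
        rw [zero_smul] at hC₁
        rw [hC₁, Matrix.det_zero] at hdC₁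
        exact zero_ne_one hdC₁
      refine ⟨v, ?_⟩
      rw [hspan, hC₁]
      exact (Submodule.span_singleton_smul_eq hr.isUnit _).symm
    · rintro ⟨v, rfl⟩
      refine ⟨Q v, P v, hQP v, ?_, rfl⟩
      rw [hQx]
      exact suppGE_flagWt_slice _
  have hinj : Function.Injective fun v => (ℂ ∙ (fun i => P v i 0) : Submodule ℂ V9) := by
    intro v w hvw
    have hmem : (fun i => P w i 0) ∈ (ℂ ∙ (fun i => P v i 0) : Submodule ℂ V9) := by
      rw [show (ℂ ∙ (fun i => P v i 0) : Submodule ℂ V9) = _ from hvw]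
      exact Submodule.mem_span_singleton_self _
    obtain ⟨r, hr⟩ := Submodule.mem_span_singleton.1 hmem
    have hPx : act (P w) (slice c₀) = x := by rw [← hQx w, ← act_mul, hPQ, act_one]
    obtain ⟨u, s, hu⟩ : ∃ (u : Fin 9 × Fin 9) (s : ℂ),
        heisInv ζ v.1 v.2 * heis ζ w.1 w.2 = s • heis ζ u.1 u.2 := by
      rw [heisInv, smul_mul_assoc, heis_mul h3, smul_smul]
      exact ⟨(_, _), _, rfl⟩
    have hform : Q v * P w = s • (A₀ * g * heis ζ u.1 u.2 * (gi * C₀)) := by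
      calc Q v * P w = A₀ * g * heisInv ζ v.1 v.2 * (gi * g) * heis ζ w.1 w.2 * (gi * C₀) := by
            simp only [P, Q, mul_assoc]
        _ = A₀ * g * (heisInv ζ v.1 v.2 * heis ζ w.1 w.2) * (gi * C₀) := by
            rw [hgig, mul_one, mul_assoc (A₀ * g)]
        _ = _ := by rw [hu, mul_smul_comm, smul_mul_assoc]
    have hcancel : (gi * C₀) * (A₀ * g) = 1 := by
      rw [mul_assoc, ← mul_assoc C₀, hCA, one_mul, hgig]
    have hcancel' : (A₀ * g) * (gi * C₀) = 1 := mul_eq_one_comm.1 hcancel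
    have hdP : ∀ v, (P v).det = C₀.det := fun v => by
      have hdg : g.det * gi.det = 1 := by rw [← Matrix.det_mul, hggi, Matrix.det_one]
      simp only [P, Matrix.det_mul, det_heis h3]
      linear_combination C₀.det * hdg
    have hdet : (Q v * P w).det = 1 := by
      rw [Matrix.det_mul, hdP, ← hdP v, ← Matrix.det_mul, hQP, Matrix.det_one]
    obtain ⟨μ, hμ⟩ := eq_smul_one_of_fixes_flag (c := c₀) (h := Q v * P w) (z := s ^ 3) hdet
      (by rw [act_mul, hPx, hQx]) (fun i hi => by
        have e : (Q v * P w) i 0 = r * (Q v * P v) i 0 := by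
          rw [Matrix.mul_apply, Matrix.mul_apply, Finset.mul_sum]
          refine Finset.sum_congr rfl fun k _ => ?_
          have : P w k 0 = r * P v k 0 := (congrFun hr k).symm
          rw [this]
          ring
        rw [e, hQP, Matrix.one_apply_ne hi, mul_zero]) (by
        have e : A₀ * g * heis ζ u.1 u.2 * (gi * C₀) * (A₀ * g * heis ζ u.1 u.2 * (gi * C₀)) *
            (A₀ * g * heis ζ u.1 u.2 * (gi * C₀)) = 1 := by
          calc _ = A₀ * g * heis ζ u.1 u.2 * ((gi * C₀) * (A₀ * g)) * heis ζ u.1 u.2 *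
                ((gi * C₀) * (A₀ * g)) * heis ζ u.1 u.2 * (gi * C₀) := by simp only [mul_assoc]
            _ = A₀ * g * (heis ζ u.1 u.2 * heis ζ u.1 u.2 * heis ζ u.1 u.2) * (gi * C₀) := by
                rw [hcancel, mul_one, mul_one]
                simp only [mul_assoc]
            _ = 1 := by
                rw [← pow_two, ← pow_succ, heis_pow_three h3, mul_one, hcancel']
        rw [hform, smul_mul_smul_comm, smul_mul_smul_comm, e]
        congr 1
        ring)
    have hPw : P w = μ • P v := by
      rw [← one_mul (P w), ← hPQ v, mul_assoc, hμ, mul_smul_comm, mul_one]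
    refine heis_injective hζ (μ := μ) ?_
    have hback : ∀ v, gi * P v * (A₀ * g) = heis ζ v.1 v.2 := fun v => by
      calc gi * P v * (A₀ * g) = (gi * g) * heis ζ v.1 v.2 * ((gi * C₀) * (A₀ * g)) := by
            simp only [P, mul_assoc]
        _ = _ := by rw [hgig, hcancel, one_mul, mul_one]
    rw [← hback, hPw, mul_smul_comm, smul_mul_assoc, hback]
  rw [hrange, ← Set.image_univ, hinj.encard_image, Set.encard_univ, ENat.card_eq_coe_fintype_card]
  simp

end Lines

end Trivector

theorem D_Y8_eightyone_points :
    ∃ p : (⋀[ℂ]^3 V9) → ℂ, IsPolyFun p ∧ p ≠ 0 ∧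
      ∀ ω : ⋀[ℂ]^3 V9, p ω ≠ 0 →
        {V₁ : Submodule ℂ V9 | Module.finrank ℂ V₁ = 1 ∧
          ∃ U₂ U₅ U₇ : Submodule ℂ (V9 ⧸ V₁),
            U₂ ≤ U₅ ∧ U₅ ≤ U₇ ∧
            Module.finrank ℂ U₂ = 2 ∧ Module.finrank ℂ U₅ = 5 ∧
            Module.finrank ℂ U₇ = 7 ∧
            ExteriorAlgebra.map V₁.mkQ (ω : ExteriorAlgebra ℂ V9) ∈
              wSpan U₂ U₂ ⊤ ⊔ wSpan U₂ U₅ U₇ ⊔ wSpan U₅ U₅ U₅}.encard = 81 := by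
  obtain ⟨ζ, hζ, him⟩ : ∃ ζ : ℂ, IsPrimitiveRoot ζ 3 ∧ ζ.im ≠ 0 := by
    have h := Complex.isPrimitiveRoot_exp 3 (by norm_num)
    refine ⟨_, h, fun him => ?_⟩
    set ζ := Complex.exp (2 * Real.pi * Complex.I / (3 : ℕ)) with hζ
    have hre : ((ζ.re : ℝ) : ℂ) = ζ := Complex.ext rfl (by simp [him])
    have h3 := h.pow_eq_one
    rw [← hre] at h3
    have h3' : ζ.re ^ 3 = 1 := by exact_mod_cast h3
    have h1 : ζ.re = 1 := by nlinarith [sq_nonneg (ζ.re + 1), sq_nonneg (ζ.re - 1)]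
    refine h.ne_one (by norm_num) ?_
    rw [← hre, h1, Complex.ofReal_one]
  obtain ⟨p, hp, hflag⟩ := Trivector.exists_poly_flag
  obtain ⟨q, hq, hcartan⟩ := Trivector.exists_poly_cartan hζ him
  refine ⟨_, Trivector.isPolyFun_eval (p * q), fun h0 => ?_, fun ω hω => ?_⟩
  · obtain ⟨ω, hω⟩ := Trivector.exists_eval_coords_ne_zero (mul_ne_zero hp hq)
    exact hω (congrFun h0 ω)
  rw [map_mul, mul_ne_zero_iff] at hω
  obtain ⟨h, hh, y, hy, hhy⟩ := hflag _ (Trivector.isAlt_coords ω) hω.1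
  obtain ⟨g, hg, z, -, hz, hgz⟩ := hcartan _ (Trivector.isAlt_coords ω) hω.2
  rw [← Trivector.encard_lines hζ (Trivector.isAlt_coords ω) hg hz hgz hh hy hhy]
  congr 1
  ext V₁
  constructor
  · rintro ⟨hV, U₂, U₅, U₇, h25, h57, h2, h5, h7, h⟩
    exact Trivector.exists_suppGE_of_flag hV h25 h57 h2 h5 h7 h
  · rintro ⟨A, B, hAB, hA, hV⟩
    exact Trivector.exists_flag_of_suppGE hAB hA hV
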